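/- Let n ≥ 1, let Ω ⊆ ℝⁿ be a bounded convex open set with smooth boundary, T > 0, M > 0, λ > 0, x₀ ∈ Ω, and let u be a classical solution of the parabolic differential inequality |∂_t u − Δu| ≤ M(|∇u| + |u|) on Ω × (0,T] vanishing on ∂Ω, two times continuously differentiable in x and once in t up to the closure. Define H_λ(t) = ∫_Ω |u(x,t)|² G_λ(x,t) dx, D_λ(t) = ∫_Ω |∇u(x,t)|² G_λ(x,t) dx, and N_λ(t) = 2 D_λ(t)/H_λ(t), and assume H_λ(t) > 0 for all t ∈ (0,T). Then there exists a constant C > 0, depending only on the dimension n, such that for every t ∈ (0,T): d/dt [ (T−t+λ) e^{−M²t} N_λ(t) ] ≤ C M² (T+λ). -/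

import Mathlib

open MeasureTheory Real

/-- The Laplacian in the spatial variable: sum of second partial derivatives. -/
noncomputable def lap {n : ℕ} (f : EuclideanSpace ℝ (Fin n) → ℝ) (x : EuclideanSpace ℝ (Fin n)) : ℝ :=
  ∑ i : Fin n, fderiv ℝ (fun y => fderiv ℝ f y (EuclideanSpace.single i 1)) x (EuclideanSpace.single i 1)

/-- The caloric weight `G_λ(x,t) = (T−t+λ)^{−n/2} exp(−|x−x₀|²/(4(T−t+λ)))`. -/
noncomputable def caloric {n : ℕ} (T lam : ℝ) (x₀ : EuclideanSpace ℝ (Fin n))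
    (x : EuclideanSpace ℝ (Fin n)) (t : ℝ) : ℝ :=
  (T - t + lam) ^ (-(n : ℝ)/2) * Real.exp (-‖x - x₀‖^2 / (4 * (T - t + lam)))

/-- `H_λ(t) = ∫_Ω u(x,t)² G_λ(x,t) dx`. -/
noncomputable def Hfun {n : ℕ} (Ω : Set (EuclideanSpace ℝ (Fin n))) (T lam : ℝ)
    (x₀ : EuclideanSpace ℝ (Fin n)) (u : EuclideanSpace ℝ (Fin n) → ℝ → ℝ) (t : ℝ) : ℝ :=
  ∫ x in Ω, (u x t)^2 * caloric T lam x₀ x t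

/-- `D_λ(t) = ∫_Ω |∇u(x,t)|² G_λ(x,t) dx`. -/
noncomputable def Dfun {n : ℕ} (Ω : Set (EuclideanSpace ℝ (Fin n))) (T lam : ℝ)
    (x₀ : EuclideanSpace ℝ (Fin n)) (u : EuclideanSpace ℝ (Fin n) → ℝ → ℝ) (t : ℝ) : ℝ :=
  ∫ x in Ω, ‖gradient (fun y => u y t) x‖^2 * caloric T lam x₀ x t

/-- The frequency function `N_λ(t) = 2 D_λ(t) / H_λ(t)`. -/
noncomputable def Nfun {n : ℕ} (Ω : Set (EuclideanSpace ℝ (Fin n))) (T lam : ℝ)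
    (x₀ : EuclideanSpace ℝ (Fin n)) (u : EuclideanSpace ℝ (Fin n) → ℝ → ℝ) (t : ℝ) : ℝ :=
  2 * Dfun Ω T lam x₀ u t / Hfun Ω T lam x₀ u t

section FrequencyEstimate

open Set Filter Topology
open scoped ENNReal NNReal

/-! ### Essentially bounded functions on a finite measure space -/

section EssentiallyBounded

variable {X : Type*} [MeasurableSpace X] {μ : Measure X}

theorem MeasureTheory.MemLp.top_mul {f g : X → ℝ} (hf : MemLp f ⊤ μ) (hg : MemLp g ⊤ μ) :
    MemLp (fun x => f x * g x) ⊤ μ :=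
  MemLp.mul hg hf

theorem MeasureTheory.MemLp.top_sq {f : X → ℝ} (hf : MemLp f ⊤ μ) :
    MemLp (fun x => f x ^ 2) ⊤ μ := by
  simpa only [sq] using hf.top_mul hf

theorem MeasureTheory.MemLp.top_sub {f g : X → ℝ} (hf : MemLp f ⊤ μ) (hg : MemLp g ⊤ μ) :
    MemLp (fun x => f x - g x) ⊤ μ :=
  hf.sub hg

theorem MeasureTheory.MemLp.top_add {f g : X → ℝ} (hf : MemLp f ⊤ μ) (hg : MemLp g ⊤ μ) :
    MemLp (fun x => f x + g x) ⊤ μ :=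
  hf.add hg

theorem MeasureTheory.MemLp.exists_abs_le {f : X → ℝ} (hf : MemLp f ⊤ μ) :
    ∃ C, 0 ≤ C ∧ ∀ᵐ x ∂μ, |f x| ≤ C := by
  refine ⟨(eLpNorm f ⊤ μ).toReal, ENNReal.toReal_nonneg, ?_⟩
  have h := hf.eLpNorm_ne_top
  rw [eLpNorm_exponent_top] at h ⊢
  filter_upwards [ae_le_eLpNormEssSup (f := f) (μ := μ)] with x hx
  rw [← Real.norm_eq_abs, ← toReal_enorm]
  exact ENNReal.toReal_mono h hx

/-- The quadratic form `∫ (f - g)²`. -/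
noncomputable def sqDist (μ : Measure X) (f g : X → ℝ) : ℝ := ∫ x, (f x - g x) ^ 2 ∂μ

theorem sqDist_nonneg (f g : X → ℝ) : 0 ≤ sqDist μ f g :=
  integral_nonneg fun _ => sq_nonneg _

theorem sqDist_comm (f g : X → ℝ) : sqDist μ f g = sqDist μ g f := by
  unfold sqDist
  congr 1 with x
  ring

@[simp] theorem sqDist_self (f : X → ℝ) : sqDist μ f f = 0 := by simp [sqDist]

theorem sqDist_zero (f : X → ℝ) : sqDist μ f (fun _ => 0) = ∫ x, f x ^ 2 ∂μ := by
  simp [sqDist]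

variable [IsFiniteMeasure μ]

theorem MeasureTheory.MemLp.top_integrable {f : X → ℝ} (hf : MemLp f ⊤ μ) : Integrable f μ :=
  hf.integrable le_top

theorem sq_integral_mul_le {f g : X → ℝ} (hf : MemLp f ⊤ μ) (hg : MemLp g ⊤ μ) :
    (∫ x, f x * g x ∂μ) ^ 2 ≤ (∫ x, f x ^ 2 ∂μ) * ∫ x, g x ^ 2 ∂μ := by
  have key : ∀ r : ℝ, 0 ≤ (∫ x, g x ^ 2 ∂μ) * (r * r) + (2 * ∫ x, f x * g x ∂μ) * r
      + ∫ x, f x ^ 2 ∂μ := by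
    intro r
    have h : ∫ x, (f x + r * g x) ^ 2 ∂μ = (∫ x, g x ^ 2 ∂μ) * (r * r)
        + (2 * ∫ x, f x * g x ∂μ) * r + ∫ x, f x ^ 2 ∂μ := by
      have e : ∀ x, (f x + r * g x) ^ 2
          = (r * r) * g x ^ 2 + (2 * r) * (f x * g x) + f x ^ 2 := fun x => by ring
      simp_rw [e]
      have i1 : Integrable (fun x => (r * r) * g x ^ 2) μ := hg.top_sq.top_integrable.const_mul _
      have i2 : Integrable (fun x => (2 * r) * (f x * g x)) μ :=
        (hf.top_mul hg).top_integrable.const_mul _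
      have i12 : Integrable (fun x => (r * r) * g x ^ 2 + (2 * r) * (f x * g x)) μ := i1.add i2
      rw [integral_add i12 hf.top_sq.top_integrable, integral_add i1 i2,
        integral_const_mul, integral_const_mul]
      ring
    rw [← h]
    exact integral_nonneg fun _ => sq_nonneg _
  have := discrim_le_zero key
  rw [discrim] at this
  nlinarith

theorem abs_integral_mul_le {f g : X → ℝ} (hf : MemLp f ⊤ μ) (hg : MemLp g ⊤ μ) :
    |∫ x, f x * g x ∂μ| ≤ √(∫ x, f x ^ 2 ∂μ) * √(∫ x, g x ^ 2 ∂μ) := by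
  rw [← Real.sqrt_mul (integral_nonneg fun _ => sq_nonneg _)]
  exact Real.abs_le_sqrt (sq_integral_mul_le hf hg)

theorem integral_sub_sq {f g : X → ℝ} (hf : MemLp f ⊤ μ) (hg : MemLp g ⊤ μ) :
    ∫ x, (f x - g x) ^ 2 ∂μ
      = ∫ x, f x ^ 2 ∂μ - 2 * ∫ x, f x * g x ∂μ + ∫ x, g x ^ 2 ∂μ := by
  have e : ∀ x, (f x - g x) ^ 2 = f x ^ 2 - 2 * (f x * g x) + g x ^ 2 := fun x => by ring
  simp_rw [e]
  have i2 : Integrable (fun x => 2 * (f x * g x)) μ := (hf.top_mul hg).top_integrable.const_mul _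
  have i12 : Integrable (fun x => f x ^ 2 - 2 * (f x * g x)) μ := hf.top_sq.top_integrable.sub i2
  rw [integral_add i12 hg.top_sq.top_integrable,
    integral_sub hf.top_sq.top_integrable i2, integral_const_mul]

theorem sqrt_sqDist_triangle {f g h : X → ℝ} (hf : MemLp f ⊤ μ) (hg : MemLp g ⊤ μ)
    (hh : MemLp h ⊤ μ) : √(sqDist μ f h) ≤ √(sqDist μ f g) + √(sqDist μ g h) := by
  have hfg := hf.top_sub hg
  have hhg := hh.top_sub hg
  have e : sqDist μ f h = ∫ x, ((f x - g x) - (h x - g x)) ^ 2 ∂μ := by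
    simp [sqDist]
  have b := (neg_le_abs _).trans (abs_integral_mul_le hfg hhg)
  rw [Real.sqrt_le_left (by positivity), e, integral_sub_sq hfg hhg, sqDist_comm g h,
    add_sq, Real.sq_sqrt (sqDist_nonneg _ _), Real.sq_sqrt (sqDist_nonneg _ _)]
  unfold sqDist
  linarith

theorem integral_sq_sub_le {f g : X → ℝ} (hf : MemLp f ⊤ μ) (hg : MemLp g ⊤ μ) :
    ∫ x, (f x - g x) ^ 2 ∂μ ≤ 2 * (∫ x, f x ^ 2 ∂μ) + 2 * ∫ x, g x ^ 2 ∂μ := by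
  rw [← integral_const_mul, ← integral_const_mul, ← integral_add
    (hf.top_sq.top_integrable.const_mul _) (hg.top_sq.top_integrable.const_mul _)]
  refine integral_mono (hf.top_sub hg).top_sq.top_integrable
    ((hf.top_sq.top_integrable.const_mul _).add (hg.top_sq.top_integrable.const_mul _)) fun x => ?_
  nlinarith [sq_nonneg (f x + g x)]

/-- Pointwise convergence together with an `L²` bound implies convergence of integrals. -/
theorem tendsto_integral_of_integral_sq_le {ι : Type*} {l : Filter ι} [l.IsCountablyGenerated]
    {q : ι → X → ℝ} {q₀ : X → ℝ} {C : ℝ} (hq : ∀ᶠ i in l, MemLp (q i) ⊤ μ) (hq₀ : MemLp q₀ ⊤ μ)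
    (hlim : ∀ᵐ x ∂μ, Tendsto (fun i => q i x) l (𝓝 (q₀ x)))
    (hC : ∀ᶠ i in l, ∫ x, q i x ^ 2 ∂μ ≤ C) :
    Tendsto (fun i => ∫ x, q i x ∂μ) l (𝓝 (∫ x, q₀ x ∂μ)) := by
  obtain ⟨B, hB0, hB⟩ : ∃ B : ℝ, 0 < B ∧ 2 * C + 2 * ∫ x, q₀ x ^ 2 ∂μ ≤ B :=
    ⟨max 1 _, by positivity, le_max_right _ _⟩
  rw [Metric.tendsto_nhds]
  intro ε hε
  set m : ℝ := 2 * B / ε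
  have hm : 0 < m := by positivity
  have hmin : Tendsto (fun i => ∫ x, min |q i x - q₀ x| m ∂μ) l (𝓝 (∫ _x, (0 : ℝ) ∂μ)) := by
    refine tendsto_integral_filter_of_dominated_convergence (fun _ => m) ?_ ?_
      (integrable_const _) ?_
    · filter_upwards [hq] with i hi
      exact ((hi.top_sub hq₀).1.norm.inf aestronglyMeasurable_const)
    · filter_upwards with i
      filter_upwards with x
      rw [Real.norm_of_nonneg (le_min (abs_nonneg _) hm.le)]
      exact min_le_right _ _
    · filter_upwards [hlim] with x hx
      have h1 : Tendsto (fun i => |q i x - q₀ x|) l (𝓝 0) := by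
        simpa using (hx.sub_const (q₀ x)).abs
      simpa [hm.le] using h1.min (tendsto_const_nhds (x := m))
  simp only [integral_zero] at hmin
  filter_upwards [hq, hC, (hmin.eventually (gt_mem_nhds (half_pos hε)))] with i hi hiC hi2
  have hsub := hi.top_sub hq₀
  rw [dist_eq_norm, ← integral_sub hi.top_integrable hq₀.top_integrable]
  have h1 : ∫ x, (q i x - q₀ x) ^ 2 ∂μ ≤ B :=
    (integral_sq_sub_le hi hq₀).trans (by linarith)
  have imin : Integrable (fun x => min |q i x - q₀ x| m) μ :=
    (hsub.top_integrable.abs).inf (integrable_const m)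
  calc ‖∫ x, (q i x - q₀ x) ∂μ‖ ≤ ∫ x, ‖q i x - q₀ x‖ ∂μ := norm_integral_le_integral_norm _
    _ ≤ ∫ x, (min |q i x - q₀ x| m + m⁻¹ * (q i x - q₀ x) ^ 2) ∂μ := by
        refine integral_mono hsub.top_integrable.norm
          (imin.add (hsub.top_sq.top_integrable.const_mul _)) fun x => ?_
        simp only [Real.norm_eq_abs]
        have : 0 ≤ m⁻¹ * (q i x - q₀ x) ^ 2 := by positivity
        rcases le_total |q i x - q₀ x| m with h | h
        · rw [min_eq_left h]; linarith
        · have h2 : |q i x - q₀ x| ≤ m⁻¹ * (q i x - q₀ x) ^ 2 := by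
            rw [← sq_abs, inv_mul_eq_div, le_div_iff₀ hm, sq]
            exact mul_le_mul_of_nonneg_left h (abs_nonneg _)
          linarith [le_min (abs_nonneg (q i x - q₀ x)) hm.le]
    _ = ∫ x, min |q i x - q₀ x| m ∂μ + m⁻¹ * ∫ x, (q i x - q₀ x) ^ 2 ∂μ := by
        rw [integral_add imin (hsub.top_sq.top_integrable.const_mul _), integral_const_mul]
    _ ≤ ∫ x, min |q i x - q₀ x| m ∂μ + m⁻¹ * B := by gcongr
    _ < ε / 2 + ε / 2 := by
        have : m⁻¹ * B = ε / 2 := by simp only [m]; field_simp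
        linarith
    _ = ε := by ring

/-- Fatou's lemma for square integrals with an essentially bounded limit. -/
theorem integral_sq_le_of_tendsto {ι : Type*} {l : Filter ι} [l.IsCountablyGenerated] [l.NeBot]
    {q : ι → X → ℝ} {q₀ : X → ℝ} {c : ι → ℝ} {C : ℝ} (hq : ∀ᶠ i in l, MemLp (q i) ⊤ μ)
    (hq₀ : MemLp q₀ ⊤ μ) (hlim : ∀ᵐ x ∂μ, Tendsto (fun i => q i x) l (𝓝 (q₀ x)))
    (hc : ∀ᶠ i in l, ∫ x, q i x ^ 2 ∂μ ≤ c i) (hC : Tendsto c l (𝓝 C)) :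
    ∫ x, q₀ x ^ 2 ∂μ ≤ C := by
  obtain ⟨m, hm0, hm⟩ := hq₀.exists_abs_le
  have hlim' : Tendsto (fun i => ∫ x, min (q i x ^ 2) (m ^ 2) ∂μ) l
      (𝓝 (∫ x, q₀ x ^ 2 ∂μ)) := by
    refine tendsto_integral_filter_of_dominated_convergence (fun _ => m ^ 2) ?_ ?_
      (integrable_const _) ?_
    · filter_upwards [hq] with i hi
      exact hi.top_sq.1.inf aestronglyMeasurable_const
    · filter_upwards with i
      filter_upwards with x
      rw [Real.norm_of_nonneg (le_min (sq_nonneg _) (sq_nonneg _))]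
      exact min_le_right _ _
    · filter_upwards [hlim, hm] with x hx hmx
      have h1 := (hx.pow 2).min (tendsto_const_nhds (x := m ^ 2))
      rwa [min_eq_left (sq_le_sq' (by linarith [(abs_le.1 hmx).1]) (abs_le.1 hmx).2)] at h1
  refine le_of_tendsto_of_tendsto hlim' hC ?_
  filter_upwards [hq, hc] with i hi hci
  refine le_trans (integral_mono (hi.top_sq.top_integrable.inf (integrable_const _))
    hi.top_sq.top_integrable fun x => min_le_left _ _) hci

end EssentiallyBounded

/-! ### Square-integrable time regularity of pointwise differentiable families -/

section EnergyFlow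

variable {X : Type*} [MeasurableSpace X] {μ : Measure X} {u u' : ℝ → X → ℝ} {α β K : ℝ}

/-- A family of bounded functions, continuously differentiable in time at every point separately,
whose time derivatives satisfy integrated energy inequalities at each fixed time. -/
structure EnergyFlow (μ : Measure X) (u u' : ℝ → X → ℝ) (α β K : ℝ) : Prop where
  measurable : ∀ t ∈ Icc α β, Measurable (u t)
  measurable_deriv : ∀ t ∈ Icc α β, Measurable (u' t)
  bounded : ∀ t ∈ Icc α β, ∃ C, ∀ x, |u t x| ≤ C
  bounded_deriv : ∀ t ∈ Icc α β, ∃ C, ∀ x, |u' t x| ≤ C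
  hasDerivAt : ∀ t ∈ Icc α β, ∀ x, HasDerivAt (fun s => u s x) (u' t x) t
  continuousOn_deriv : ∀ x, ContinuousOn (fun t => u' t x) (Icc α β)
  nonneg : 0 ≤ K
  growth : ∀ t ∈ Icc α β, |2 * ∫ x, u t x * u' t x ∂μ| ≤ K * ∫ x, u t x ^ 2 ∂μ
  holder : ∀ t ∈ Icc α β, ∀ a ∈ Icc α β, 2 * ∫ x, (u t x - u a x) * u' t x ∂μ
    ≤ K * ((∫ x, u t x ^ 2 ∂μ) + ∫ x, u a x ^ 2 ∂μ)
  forward : ∀ t ∈ Icc α β, ∀ a ∈ Icc α β, ∀ r > 0, 2 * ∫ x, (u t x - u a x) * u' t x ∂μ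
    ≤ sqDist μ (u t) (u a) / (2 * r)
      + r * (K * ((∫ x, u' a x ^ 2 ∂μ) + (∫ x, u t x ^ 2 ∂μ) + ∫ x, u a x ^ 2 ∂μ))

/-- Continuity in mean square at `t`, with a linear rate forward in time. -/
def MeanSquareRegularAt (μ : Measure X) (u : ℝ → X → ℝ) (t : ℝ) : Prop :=
  Tendsto (fun s => sqDist μ (u s) (u t)) (𝓝 t) (𝓝 0) ∧
    ∃ C, ∀ᶠ s in 𝓝[>] t, sqDist μ (u s) (u t) ≤ C * (s - t) ^ 2

theorem sub_le_of_hasDerivWithinAt_Ici {y y' : ℝ → ℝ} {a b C : ℝ} (hab : a ≤ b)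
    (hy : ContinuousOn y (Icc a b)) (hy' : ∀ x ∈ Ioo a b, HasDerivWithinAt y (y' x) (Ici x) x)
    (hC : ∀ x ∈ Ioo a b, y' x ≤ C) : y b - y a ≤ C * (b - a) := by
  rcases hab.eq_or_lt with rfl | hab
  · simp
  have key : ∀ c ∈ Ioo a b, y b - y c ≤ C * (b - c) := by
    intro c hc
    have hsub : Icc c b ⊆ Icc a b := Icc_subset_Icc_left hc.1.le
    have h := image_le_of_deriv_right_le_deriv_boundary (f := y) (f' := y')
      (B := fun x => y c + C * (x - c)) (B' := fun _ => C) (hy.mono hsub)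
      (fun x hx => hy' x ⟨hc.1.trans_le hx.1, hx.2⟩) (by simp) (by fun_prop)
      (fun x _ => by
        simpa using (((hasDerivAt_id x).sub_const c).const_mul C).const_add (y c)
          |>.hasDerivWithinAt)
      (fun x hx => hC x ⟨hc.1.trans_le hx.1, hx.2⟩) (right_mem_Icc.2 hc.2.le)
    linarith
  have hlim : Tendsto (fun c => y b - y c) (𝓝[Ioo a b] a) (𝓝 (y b - y a)) :=
    tendsto_const_nhds.sub
      ((hy a (left_mem_Icc.2 hab.le)).mono_left (nhdsWithin_mono a Ioo_subset_Icc_self))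
  have hlim2 : Tendsto (fun c => C * (b - c)) (𝓝[Ioo a b] a) (𝓝 (C * (b - a))) :=
    ((by fun_prop : Continuous fun c => C * (b - c)).tendsto a).mono_left nhdsWithin_le_nhds
  have : (𝓝[Ioo a b] a).NeBot := by
    rw [nhdsWithin_Ioo_eq_nhdsGT hab]
    infer_instance
  exact le_of_tendsto_of_tendsto hlim hlim2 (eventually_nhdsWithin_of_forall key)

/-- A nonnegative function vanishing at the initial point whose right derivative is at most
`sup y / (2 r) + r B` on an interval of length `r` is at most `2 B r ^ 2`. -/
theorem le_two_mul_sq_of_hasDerivWithinAt_Ici {y y' : ℝ → ℝ} {a b B : ℝ} (hab : a < b)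
    (hy : ContinuousOn y (Icc a b)) (ha : y a = 0)
    (hy' : ∀ x ∈ Ioo a b, HasDerivWithinAt y (y' x) (Ici x) x) (hB : 0 ≤ B)
    (hbound : ∀ x ∈ Ioo a b, y' x ≤ y x / (2 * (b - a)) + (b - a) * B) :
    y b ≤ 2 * B * (b - a) ^ 2 := by
  have hr : 0 < b - a := sub_pos.2 hab
  obtain ⟨z, hz, hmax⟩ := isCompact_Icc.exists_isMaxOn (nonempty_Icc.2 hab.le) hy
  have hmax' : ∀ x ∈ Icc a b, y x ≤ y z := fun x hx => hmax hx
  have h0 : 0 ≤ y z := ha ▸ hmax' a (left_mem_Icc.2 hab.le)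
  have h := sub_le_of_hasDerivWithinAt_Ici (C := y z / (2 * (b - a)) + (b - a) * B) hz.1
    (hy.mono (Icc_subset_Icc_right hz.2)) (fun x hx => hy' x ⟨hx.1, hx.2.trans_le hz.2⟩)
    (fun x hx => (hbound x ⟨hx.1, hx.2.trans_le hz.2⟩).trans (by
      have := hmax' x ⟨hx.1.le, hx.2.le.trans hz.2⟩
      gcongr))
  have h2 : (y z / (2 * (b - a)) + (b - a) * B) * (z - a)
      ≤ (y z / (2 * (b - a)) + (b - a) * B) * (b - a) :=
    mul_le_mul_of_nonneg_left (by linarith [hz.2]) (by positivity)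
  have h3 : (y z / (2 * (b - a)) + (b - a) * B) * (b - a) = y z / 2 + B * (b - a) ^ 2 := by
    field_simp
  have := hmax' b (right_mem_Icc.2 hab.le)
  linarith

namespace EnergyFlow

theorem memLp (h : EnergyFlow μ u u' α β K) {t : ℝ} (ht : t ∈ Icc α β) : MemLp (u t) ⊤ μ := by
  obtain ⟨C, hC⟩ := h.bounded t ht
  exact memLp_top_of_bound (h.measurable t ht).aestronglyMeasurable C (.of_forall hC)

theorem memLp_deriv (h : EnergyFlow μ u u' α β K) {t : ℝ} (ht : t ∈ Icc α β) :
    MemLp (u' t) ⊤ μ := by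
  obtain ⟨C, hC⟩ := h.bounded_deriv t ht
  exact memLp_top_of_bound (h.measurable_deriv t ht).aestronglyMeasurable C (.of_forall hC)

theorem tendsto_apply (h : EnergyFlow μ u u' α β K) {t : ℝ} (ht : t ∈ Icc α β) (x : X) :
    Tendsto (fun s => u s x) (𝓝 t) (𝓝 (u t x)) :=
  (h.hasDerivAt t ht x).continuousAt

variable [IsFiniteMeasure μ]

theorem tendsto_sqDist (h : EnergyFlow μ u u' α β K) {t : ℝ} {l : Filter ℝ} (ht : t ∈ Icc α β)
    (hl : ∀ᶠ s in l, s ∈ Icc α β) (hd : Tendsto (fun s => sqDist μ (u s) (u t)) l (𝓝 0))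
    {w : X → ℝ} (hw : MemLp w ⊤ μ) :
    Tendsto (fun s => sqDist μ (u s) w) l (𝓝 (sqDist μ (u t) w)) := by
  have hs : Tendsto (fun s => √(sqDist μ (u s) w)) l (𝓝 √(sqDist μ (u t) w)) := by
    rw [tendsto_iff_dist_tendsto_zero]
    refine squeeze_zero' (.of_forall fun _ => dist_nonneg) ?_ (by simpa using hd.sqrt)
    filter_upwards [hl] with s hs
    rw [Real.dist_eq, abs_sub_le_iff]
    have h1 := sqrt_sqDist_triangle (h.memLp hs) (h.memLp ht) hw
    have h2 := sqrt_sqDist_triangle (h.memLp ht) (h.memLp hs) hw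
    rw [sqDist_comm (u t) (u s)] at h2
    constructor <;> linarith
  simpa [Real.sq_sqrt (sqDist_nonneg _ _)] using hs.pow 2

theorem sqDist_le_of_tendsto (h : EnergyFlow μ u u' α β K) {t : ℝ} {l : Filter ℝ} [l.NeBot]
    [l.IsCountablyGenerated] (ht : t ∈ Icc α β) (hlt : l ≤ 𝓝 t) (hl : ∀ᶠ s in l, s ∈ Icc α β)
    {w : X → ℝ} (hw : MemLp w ⊤ μ) {c : ℝ → ℝ} {C : ℝ}
    (hc : ∀ᶠ s in l, sqDist μ (u s) w ≤ c s) (hC : Tendsto c l (𝓝 C)) :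
    sqDist μ (u t) w ≤ C :=
  integral_sq_le_of_tendsto (hl.mono fun _ hs => (h.memLp hs).top_sub hw)
    ((h.memLp ht).top_sub hw)
    (.of_forall fun x => ((h.tendsto_apply ht x).mono_left hlt).sub_const _) hc hC

/-- Under a one-sided mean square Lipschitz bound, difference quotients may be integrated. -/
theorem tendsto_integral_slope_mul (h : EnergyFlow μ u u' α β K) {t C : ℝ} (ht : t ∈ Icc α β)
    {l : Filter ℝ} [l.IsCountablyGenerated] (hlt : l ≤ 𝓝[≠] t) (hl : ∀ᶠ s in l, s ∈ Icc α β)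
    (hC : ∀ᶠ s in l, sqDist μ (u s) (u t) ≤ C * (s - t) ^ 2) {φ : ℝ → X → ℝ} {φ₀ : X → ℝ}
    {B : ℝ} (hφ : ∀ᶠ s in l, AEStronglyMeasurable (φ s) μ) (hφB : ∀ᶠ s in l, ∀ x, |φ s x| ≤ B)
    (hφ₀ : MemLp φ₀ ⊤ μ) (hlim : ∀ᵐ x ∂μ, Tendsto (fun s => φ s x) l (𝓝 (φ₀ x))) :
    Tendsto (fun s => (s - t)⁻¹ * ∫ x, (u s x - u t x) * φ s x ∂μ) l
      (𝓝 (∫ x, u' t x * φ₀ x ∂μ)) := by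
  have hmem : ∀ᶠ s in l, MemLp (φ s) ⊤ μ := by
    filter_upwards [hφ, hφB] with s hs hsB
    exact memLp_top_of_bound hs B (.of_forall hsB)
  have key : Tendsto (fun s => ∫ x, ((s - t)⁻¹ * (u s x - u t x)) * φ s x ∂μ) l
      (𝓝 (∫ x, u' t x * φ₀ x ∂μ)) := by
    refine tendsto_integral_of_integral_sq_le (C := B ^ 2 * C) ?_
      ((h.memLp_deriv ht).top_mul hφ₀) ?_ ?_
    · filter_upwards [hmem, hl] with s hs hsI
      exact (((h.memLp hsI).top_sub (h.memLp ht)).const_mul _).top_mul hs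
    · filter_upwards [hlim] with x hx
      refine Tendsto.mul ?_ hx
      have := (hasDerivAt_iff_tendsto_slope.1 (h.hasDerivAt t ht x)).mono_left hlt
      exact this.congr fun s => by rw [slope_def_field, div_eq_inv_mul]
    · have hne : ∀ᶠ s in l, s ∈ ({t}ᶜ : Set ℝ) := hlt self_mem_nhdsWithin
      filter_upwards [hmem, hl, hφB, hC, hne] with s hs hsI hsB hsC hst
      have hst' : s - t ≠ 0 := sub_ne_zero.2 hst
      have hd := (h.memLp hsI).top_sub (h.memLp ht)
      calc ∫ x, (((s - t)⁻¹ * (u s x - u t x)) * φ s x) ^ 2 ∂μ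
          ≤ ∫ x, B ^ 2 * ((s - t)⁻¹ ^ 2 * (u s x - u t x) ^ 2) ∂μ := by
            refine integral_mono ((hd.const_mul _).top_mul hs).top_sq.top_integrable
              ((hd.top_sq.top_integrable.const_mul _).const_mul _) fun x => ?_
            have : φ s x ^ 2 ≤ B ^ 2 := sq_le_sq' (by linarith [(abs_le.1 (hsB x)).1])
              (abs_le.1 (hsB x)).2
            simp only
            rw [mul_pow, mul_pow, mul_comm]
            gcongr
        _ = B ^ 2 * ((s - t)⁻¹ ^ 2 * sqDist μ (u s) (u t)) := by
            rw [integral_const_mul, integral_const_mul, sqDist]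
        _ ≤ B ^ 2 * ((s - t)⁻¹ ^ 2 * (C * (s - t) ^ 2)) := by gcongr
        _ = B ^ 2 * C := by field_simp
  refine key.congr fun s => ?_
  rw [← integral_const_mul]
  simp only [mul_assoc]

theorem hasDerivWithinAt_sqDist (h : EnergyFlow μ u u' α β K) {t : ℝ} (ht : t ∈ Ioo α β)
    (hreg : MeanSquareRegularAt μ u t) {w : X → ℝ} (hw : MemLp w ⊤ μ) (hwB : ∃ B, ∀ x, |w x| ≤ B) :
    HasDerivWithinAt (fun s => sqDist μ (u s) w) (2 * ∫ x, (u t x - w x) * u' t x ∂μ) (Ici t) t := by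
  obtain ⟨C, hC⟩ := hreg.2
  have htI := Ioo_subset_Icc_self ht
  have hl : ∀ᶠ s in 𝓝[>] t, s ∈ Icc α β :=
    nhdsWithin_le_nhds (Icc_mem_nhds ht.1 ht.2)
  obtain ⟨B, hB⟩ := hwB
  obtain ⟨B', hB'⟩ := h.bounded t htI
  rw [← hasDerivWithinAt_Ioi_iff_Ici, hasDerivWithinAt_iff_tendsto_slope' (by simp)]
  have h1 := h.tendsto_integral_slope_mul htI (l := 𝓝[>] t)
    (nhdsWithin_mono t fun s (hs : t < s) => hs.ne') hl hC
    (φ := fun _ x => u t x - w x) (φ₀ := fun x => u t x - w x) (B := B' + B)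
    (.of_forall fun _ => ((h.memLp htI).top_sub hw).1)
    (.of_forall fun _ x => (abs_sub _ _).trans (add_le_add (hB' x) (hB x)))
    ((h.memLp htI).top_sub hw) (.of_forall fun x => tendsto_const_nhds)
  have h2 : Tendsto (fun s => (s - t)⁻¹ * sqDist μ (u s) (u t)) (𝓝[>] t) (𝓝 0) := by
    have hz : Tendsto (fun s => C * (s - t)) (𝓝[>] t) (𝓝 0) := by
      have : Tendsto (fun s => C * (s - t)) (𝓝 t) (𝓝 (C * (t - t))) :=
        (by fun_prop : Continuous fun s => C * (s - t)).tendsto t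
      simpa using this.mono_left nhdsWithin_le_nhds
    refine squeeze_zero' ?_ ?_ hz
    · filter_upwards [self_mem_nhdsWithin] with s hs
      exact mul_nonneg (inv_nonneg.2 (sub_pos.2 hs).le) (sqDist_nonneg _ _)
    · filter_upwards [self_mem_nhdsWithin, hC] with s hs hsC
      have : 0 < s - t := sub_pos.2 hs
      rw [inv_mul_le_iff₀ this]
      linarith
  have h3 := (h1.const_mul 2).add h2
  have e : (2 * ∫ x, (u t x - w x) * u' t x ∂μ) = 2 * (∫ x, u' t x * (u t x - w x) ∂μ) + 0 := by
    simp_rw [mul_comm (u' t _)]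
    simp
  rw [e]
  refine h3.congr' ?_
  filter_upwards [hl] with s hs
  have hd := (h.memLp hs).top_sub (h.memLp htI)
  have hdw := (h.memLp htI).top_sub hw
  have := integral_sub_sq hd (hdw.neg)
  simp only [Pi.neg_apply, sub_neg_eq_add, mul_neg, integral_neg, neg_sq] at this
  have e2 : sqDist μ (u s) w = ∫ x, ((u s x - u t x) + (u t x - w x)) ^ 2 ∂μ := by simp [sqDist]
  rw [slope_def_field, e2, this, ← sqDist, ← sqDist]
  ring

end EnergyFlow

end EnergyFlow

section EnergyFlowRegularity

namespace EnergyFlow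

variable {X : Type*} [MeasurableSpace X] {μ : Measure X} [IsFiniteMeasure μ]
  {u u' : ℝ → X → ℝ} {α β K : ℝ}

theorem hasDerivWithinAt_integral_sq (h : EnergyFlow μ u u' α β K) {t : ℝ} (ht : t ∈ Ioo α β)
    (hreg : MeanSquareRegularAt μ u t) :
    HasDerivWithinAt (fun s => ∫ x, u s x ^ 2 ∂μ) (2 * ∫ x, u t x * u' t x ∂μ) (Ici t) t := by
  simpa [sqDist_zero] using
    h.hasDerivWithinAt_sqDist ht hreg (w := fun _ => 0) (by simp) ⟨0, by simp⟩

/-- Two-sided exponential control of `∫ u²` on an interval of regular times. -/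
theorem integral_sq_le_exp_mul (h : EnergyFlow μ u u' α β K) {a b : ℝ} (ha : α ≤ a) (hb : b ≤ β)
    (hreg : ∀ t ∈ Ioo a b, MeanSquareRegularAt μ u t)
    (hcont : ContinuousOn (fun t => ∫ x, u t x ^ 2 ∂μ) (Icc a b))
    {s t : ℝ} (hs : s ∈ Icc a b) (ht : t ∈ Icc a b) :
    ∫ x, u s x ^ 2 ∂μ ≤ exp (K * (β - α)) * ∫ x, u t x ^ 2 ∂μ := by
  set y : ℝ → ℝ := fun t => ∫ x, u t x ^ 2 ∂μ with hy
  have hy0 : ∀ t, 0 ≤ y t := fun t => integral_nonneg fun _ => sq_nonneg _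
  have hexp : ∀ c x : ℝ, HasDerivWithinAt (fun τ => exp (c * τ)) (exp (c * x) * c) (Ici x) x :=
    fun c x => by simpa using (((hasDerivAt_id x).const_mul c).exp).hasDerivWithinAt
  have hsub : ∀ {s t : ℝ}, s ∈ Icc a b → t ∈ Icc a b → Icc s t ⊆ Icc a b :=
    fun hs ht => Icc_subset_Icc hs.1 ht.2
  have hder : ∀ {s t : ℝ}, s ∈ Icc a b → t ∈ Icc a b → ∀ τ ∈ Ioo s t,
      HasDerivWithinAt y (2 * ∫ x, u τ x * u' τ x ∂μ) (Ici τ) τ ∧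
        |2 * ∫ x, u τ x * u' τ x ∂μ| ≤ K * y τ := by
    intro s t hs ht τ hτ
    have hτ' : τ ∈ Ioo a b := ⟨hs.1.trans_lt hτ.1, hτ.2.trans_le ht.2⟩
    have hτ'' : τ ∈ Ioo α β := ⟨ha.trans_lt hτ'.1, hτ'.2.trans_le hb⟩
    exact ⟨h.hasDerivWithinAt_integral_sq hτ'' (hreg τ hτ'), h.growth τ (Ioo_subset_Icc_self hτ'')⟩
  have hst : ∀ {s t : ℝ}, s ∈ Icc a b → t ∈ Icc a b → s ≤ t →
      y t ≤ exp (K * (t - s)) * y s ∧ y s ≤ exp (K * (t - s)) * y t := by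
    intro s t hs ht hle
    have h1 := sub_le_of_hasDerivWithinAt_Ici (C := 0) hle
      (((by fun_prop : Continuous fun τ => exp (-K * τ)).continuousOn).mul
        (hcont.mono (hsub hs ht)))
      (fun τ hτ => (hexp (-K) τ).mul (hder hs ht τ hτ).1)
      (fun τ hτ => by
        have := (le_abs_self _).trans (hder hs ht τ hτ).2
        have e := (exp_pos (-K * τ)).le
        nlinarith [mul_le_mul_of_nonneg_left this e])
    have h2 := sub_le_of_hasDerivWithinAt_Ici (C := 0) hle
      ((((by fun_prop : Continuous fun τ => exp (K * τ)).continuousOn).mul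
        (hcont.mono (hsub hs ht))).neg)
      (fun τ hτ => ((hexp K τ).mul (hder hs ht τ hτ).1).neg)
      (fun τ hτ => by
        have := (neg_le_abs _).trans (hder hs ht τ hτ).2
        have e := (exp_pos (K * τ)).le
        nlinarith [mul_le_mul_of_nonneg_left this e])
    simp only [Pi.mul_apply, Pi.neg_apply, zero_mul] at h1 h2
    constructor
    · have e : y t = exp (K * t) * (exp (-K * t) * y t) := by
        rw [← mul_assoc, ← Real.exp_add]; simp
      have e2 : exp (K * (t - s)) * y s = exp (K * t) * (exp (-K * s) * y s) := by
        rw [← mul_assoc, ← Real.exp_add]; ring_nf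
      rw [e, e2]
      exact mul_le_mul_of_nonneg_left (by linarith) (exp_pos _).le
    · have e : y s = exp (-K * s) * (exp (K * s) * y s) := by
        rw [← mul_assoc, ← Real.exp_add]; simp
      have e2 : exp (K * (t - s)) * y t = exp (-K * s) * (exp (K * t) * y t) := by
        rw [← mul_assoc, ← Real.exp_add]; ring_nf
      rw [e, e2]
      exact mul_le_mul_of_nonneg_left (by linarith) (exp_pos _).le
  have hmono : ∀ {s t : ℝ}, s ∈ Icc a b → t ∈ Icc a b → exp (K * (t - s)) ≤ exp (K * (β - α)) :=
    fun hs ht => exp_le_exp.2 (mul_le_mul_of_nonneg_left (by linarith [hs.1, ht.2]) h.nonneg)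
  rcases le_total s t with hle | hle
  · exact (hst hs ht hle).2.trans (mul_le_mul_of_nonneg_right (hmono hs ht) (hy0 t))
  · exact (hst ht hs hle).1.trans (mul_le_mul_of_nonneg_right (hmono ht hs) (hy0 t))

theorem sqDist_le_of_integral_sq_le (h : EnergyFlow μ u u' α β K) {s t B : ℝ} (hs : s ∈ Icc α β)
    (ht : t ∈ Icc α β) (hst : s ≤ t) (hreg : ∀ τ ∈ Ioo s t, MeanSquareRegularAt μ u τ)
    (hcont : ContinuousOn (fun τ => sqDist μ (u τ) (u s)) (Icc s t))
    (hB : ∀ τ ∈ Ico s t, ∫ x, u τ x ^ 2 ∂μ ≤ B) :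
    sqDist μ (u t) (u s) ≤ 2 * K * B * (t - s) := by
  have := sub_le_of_hasDerivWithinAt_Ici (C := 2 * K * B) hst hcont
    (fun τ hτ => h.hasDerivWithinAt_sqDist ⟨hs.1.trans_lt hτ.1, hτ.2.trans_le ht.2⟩ (hreg τ hτ)
      (h.memLp hs) (h.bounded s hs))
    (fun τ hτ => by
      have h1 := h.holder τ ⟨hs.1.trans hτ.1.le, hτ.2.le.trans ht.2⟩ s hs
      have h2 := hB τ ⟨hτ.1.le, hτ.2⟩
      have h3 := hB s ⟨le_rfl, hτ.1.trans hτ.2⟩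
      nlinarith [h.nonneg])
  simpa using this

theorem continuousOn_of_regular (h : EnergyFlow μ u u' α β K) {a b : ℝ} (ha : α ≤ a) (hb : b ≤ β)
    (hreg : ∀ t ∈ Ioo a b, MeanSquareRegularAt μ u t) {w : X → ℝ} (hw : MemLp w ⊤ μ) :
    ContinuousOn (fun t => sqDist μ (u t) w) (Ioo a b) := by
  intro t ht
  have ht' : t ∈ Ioo α β := ⟨ha.trans_lt ht.1, ht.2.trans_le hb⟩
  exact (h.tendsto_sqDist (Ioo_subset_Icc_self ht') (Icc_mem_nhds ht'.1 ht'.2)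
    (hreg t ht).1 hw).mono_left nhdsWithin_le_nhds

theorem exists_sqDist_le (h : EnergyFlow μ u u' α β K) {a b : ℝ} (ha : α ≤ a) (hab : a < b)
    (hb : b ≤ β) (hreg : ∀ t ∈ Ioo a b, MeanSquareRegularAt μ u t) :
    ∃ C, ∀ s ∈ Icc a b, ∀ t ∈ Icc a b, s ≤ t → sqDist μ (u t) (u s) ≤ C * (t - s) := by
  have hI : Icc a b ⊆ Icc α β := Icc_subset_Icc ha hb
  obtain ⟨m, hm⟩ := exists_between hab
  set B := exp (K * (β - α)) * ∫ x, u m x ^ 2 ∂μ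
  have hBnd : ∀ τ ∈ Ioo a b, ∫ x, u τ x ^ 2 ∂μ ≤ B := by
    intro τ hτ
    have hsub : Icc (min τ m) (max τ m) ⊆ Ioo a b :=
      fun x hx => ⟨(lt_min hτ.1 hm.1).trans_le hx.1, hx.2.trans_lt (max_lt hτ.2 hm.2)⟩
    refine h.integral_sq_le_exp_mul (a := min τ m) (b := max τ m)
      (ha.trans (le_min hτ.1.le hm.1.le)) ((max_le hτ.2.le hm.2.le).trans hb)
      (fun t ht => hreg t (hsub (Ioo_subset_Icc_self ht))) ?_
      ⟨min_le_left _ _, le_max_left _ _⟩ ⟨min_le_right _ _, le_max_right _ _⟩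
    have := h.continuousOn_of_regular ha hb hreg (w := fun _ => 0) (by simp)
    simp only [sqDist_zero] at this
    exact this.mono hsub
  have hoo : ∀ s ∈ Ioo a b, ∀ t ∈ Ioo a b, s ≤ t →
      sqDist μ (u t) (u s) ≤ 2 * K * B * (t - s) := by
    intro s hs t ht hst
    have hsub : Icc s t ⊆ Ioo a b := fun x hx => ⟨hs.1.trans_le hx.1, hx.2.trans_lt ht.2⟩
    exact h.sqDist_le_of_integral_sq_le (hI (Ioo_subset_Icc_self hs)) (hI (Ioo_subset_Icc_self ht))
      hst (fun τ hτ => hreg τ (hsub (Ioo_subset_Icc_self hτ)))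
      ((h.continuousOn_of_regular ha hb hreg (h.memLp (hI (Ioo_subset_Icc_self hs)))).mono hsub)
      (fun τ hτ => hBnd τ (hsub (Ico_subset_Icc_self hτ)))
  have hoc : ∀ s ∈ Ioo a b, ∀ t ∈ Ioc a b, s ≤ t →
      sqDist μ (u t) (u s) ≤ 2 * K * B * (t - s) := by
    intro s hs t ht hst
    rcases ht.2.eq_or_lt with rfl | htb
    · have hIo : ∀ᶠ τ in 𝓝[<] t, τ ∈ Ioo s t := Ioo_mem_nhdsLT hs.2
      refine h.sqDist_le_of_tendsto (l := 𝓝[<] t) (hI (right_mem_Icc.2 hab.le)) nhdsWithin_le_nhds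
        (hIo.mono fun τ hτ => hI ⟨(hs.1.trans hτ.1).le, hτ.2.le⟩)
        (h.memLp (hI (Ioo_subset_Icc_self hs)))
        (hIo.mono fun τ hτ => hoo s hs τ ⟨hs.1.trans hτ.1, hτ.2⟩ hτ.1.le) ?_
      exact ((by fun_prop : Continuous fun τ => 2 * K * B * (τ - s)).tendsto t).mono_left
        nhdsWithin_le_nhds
    · exact hoo s hs t ⟨ht.1, htb⟩ hst
  refine ⟨2 * K * B, fun s hs t ht hst => ?_⟩
  rcases hst.eq_or_lt with rfl | hst
  · simp
  rcases hs.1.eq_or_lt with rfl | has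
  · have hIo : ∀ᶠ τ in 𝓝[>] a, τ ∈ Ioo a t := Ioo_mem_nhdsGT hst
    rw [sqDist_comm]
    refine h.sqDist_le_of_tendsto (l := 𝓝[>] a) (hI hs) nhdsWithin_le_nhds
      (hIo.mono fun τ hτ => hI ⟨hτ.1.le, hτ.2.le.trans ht.2⟩) (h.memLp (hI ht))
      (c := fun τ => 2 * K * B * (t - τ))
      (hIo.mono fun τ hτ => by
        rw [sqDist_comm]
        exact hoc τ ⟨hτ.1, hτ.2.trans_le ht.2⟩ t ⟨hst, ht.2⟩ hτ.2.le) ?_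
    exact ((by fun_prop : Continuous fun τ => 2 * K * B * (t - τ)).tendsto a).mono_left
        nhdsWithin_le_nhds
  · exact hoc s ⟨has, hst.trans_le ht.2⟩ t ⟨has.trans hst, ht.2⟩ hst.le

/-- Between two times separated by regular times only, the family is continuous in mean square
up to the end points. -/
theorem continuousOn_sqDist (h : EnergyFlow μ u u' α β K) {a b : ℝ} (ha : α ≤ a) (hab : a < b)
    (hb : b ≤ β) (hreg : ∀ t ∈ Ioo a b, MeanSquareRegularAt μ u t) {w : X → ℝ}
    (hw : MemLp w ⊤ μ) : ContinuousOn (fun t => sqDist μ (u t) w) (Icc a b) := by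
  have hI : Icc a b ⊆ Icc α β := Icc_subset_Icc ha hb
  obtain ⟨C, hC⟩ := h.exists_sqDist_le ha hab hb hreg
  intro t ht
  refine h.tendsto_sqDist (hI ht) (eventually_nhdsWithin_of_forall fun s hs => hI hs) ?_ hw
  have hlim : Tendsto (fun s => C * |s - t|) (𝓝[Icc a b] t) (𝓝 0) := by
    have : Tendsto (fun s => C * |s - t|) (𝓝 t) (𝓝 (C * |t - t|)) :=
      (by fun_prop : Continuous fun s => C * |s - t|).tendsto t
    simpa using this.mono_left nhdsWithin_le_nhds
  refine squeeze_zero' (.of_forall fun _ => sqDist_nonneg _ _)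
    (eventually_nhdsWithin_of_forall fun s hs => ?_) hlim
  rcases le_total s t with hle | hle
  · rw [sqDist_comm, abs_sub_comm, abs_of_nonneg (sub_nonneg.2 hle)]
    exact hC s hs t ht hle
  · rw [abs_of_nonneg (sub_nonneg.2 hle)]
    exact hC t ht s hs hle

theorem integral_sq_le_of_regular (h : EnergyFlow μ u u' α β K) {a b : ℝ} (ha : α ≤ a) (hab : a < b)
    (hb : b ≤ β) (hreg : ∀ t ∈ Ioo a b, MeanSquareRegularAt μ u t) {s t : ℝ} (hs : s ∈ Icc a b)
    (ht : t ∈ Icc a b) : ∫ x, u s x ^ 2 ∂μ ≤ exp (K * (β - α)) * ∫ x, u t x ^ 2 ∂μ := by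
  have := h.continuousOn_sqDist ha hab hb hreg (w := fun _ => 0) (by simp)
  simp only [sqDist_zero] at this
  exact h.integral_sq_le_exp_mul ha hb hreg this hs ht

theorem sqDist_le_holder (h : EnergyFlow μ u u' α β K) {a b : ℝ} (ha : α ≤ a) (hab : a < b)
    (hb : b ≤ β) (hreg : ∀ t ∈ Ioo a b, MeanSquareRegularAt μ u t) {s t c : ℝ} (hs : s ∈ Icc a b)
    (ht : t ∈ Icc a b) (hst : s ≤ t) (hc : c ∈ Icc a b) :
    sqDist μ (u t) (u s) ≤ 2 * K * (exp (K * (β - α)) * ∫ x, u c x ^ 2 ∂μ) * (t - s) := by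
  have hI : Icc a b ⊆ Icc α β := Icc_subset_Icc ha hb
  exact h.sqDist_le_of_integral_sq_le (hI hs) (hI ht) hst
    (fun τ hτ => hreg τ ⟨hs.1.trans_lt hτ.1, hτ.2.trans_le ht.2⟩)
    ((h.continuousOn_sqDist ha hab hb hreg (h.memLp (hI hs))).mono (Icc_subset_Icc hs.1 ht.2))
    (fun τ hτ => h.integral_sq_le_of_regular ha hab hb hreg
      ⟨hs.1.trans hτ.1, hτ.2.le.trans ht.2⟩ hc)

/-- The linear forward rate, quantified by the data at the initial time. -/
theorem sqDist_le_forward (h : EnergyFlow μ u u' α β K) {a b : ℝ} (ha : α ≤ a) (hab : a < b)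
    (hb : b ≤ β) (hreg : ∀ t ∈ Ioo a b, MeanSquareRegularAt μ u t) :
    sqDist μ (u b) (u a) ≤ 2 * (K * ((∫ x, u' a x ^ 2 ∂μ)
      + 2 * (exp (K * (β - α)) * ∫ x, u a x ^ 2 ∂μ))) * (b - a) ^ 2 := by
  have hI : Icc a b ⊆ Icc α β := Icc_subset_Icc ha hb
  have haI := hI (left_mem_Icc.2 hab.le)
  have h0 : 0 ≤ ∫ x, u a x ^ 2 ∂μ := integral_nonneg fun _ => sq_nonneg _
  have h0' : 0 ≤ ∫ x, u' a x ^ 2 ∂μ := integral_nonneg fun _ => sq_nonneg _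
  have hle := fun t ht => h.integral_sq_le_of_regular ha hab hb hreg (s := t) ht
    (left_mem_Icc.2 hab.le)
  refine le_two_mul_sq_of_hasDerivWithinAt_Ici hab
    (h.continuousOn_sqDist ha hab hb hreg (h.memLp haI)) (by simp)
    (fun t ht => h.hasDerivWithinAt_sqDist ⟨ha.trans_lt ht.1, ht.2.trans_le hb⟩ (hreg t ht)
      (h.memLp haI) (h.bounded a haI))
    (mul_nonneg h.nonneg (by positivity)) fun t ht => ?_
  refine (h.forward t (hI (Ioo_subset_Icc_self ht)) a haI (b - a) (sub_pos.2 hab)).trans ?_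
  have h1 := hle t (Ioo_subset_Icc_self ht)
  have h2 := hle a (left_mem_Icc.2 hab.le)
  have h3 : 0 ≤ b - a := (sub_pos.2 hab).le
  refine add_le_add le_rfl (mul_le_mul_of_nonneg_left (mul_le_mul_of_nonneg_left ?_ h.nonneg) h3)
  linarith

end EnergyFlow

end EnergyFlowRegularity

section LipschitzOnClosed

variable {X : Type*} [MeasurableSpace X] {μ : Measure X} {u u' : ℝ → X → ℝ} {α β K : ℝ}

/-- Mean square bounds may be checked on the members of an exhausting sequence of sets, which need
not be measurable. -/
theorem sqDist_le_of_forall_restrict {f g : X → ℝ} (hf : MemLp f ⊤ μ) (hg : MemLp g ⊤ μ)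
    [IsFiniteMeasure μ] {A : ℕ → Set X} (hA : Monotone A) (hAU : ⋃ m, A m = univ) {c : ℝ}
    (hc : 0 ≤ c) (h : ∀ m, sqDist (μ.restrict (A m)) f g ≤ c) : sqDist μ f g ≤ c := by
  have hfg := (hf.top_sub hg).top_sq
  have e : ∀ ν : Measure X, AEStronglyMeasurable (fun x => (f x - g x) ^ 2) ν →
      sqDist ν f g = (∫⁻ x, ENNReal.ofReal ((f x - g x) ^ 2) ∂ν).toReal :=
    fun ν hν => integral_eq_lintegral_of_nonneg_ae (.of_forall fun _ => sq_nonneg _) hν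
  have hfin : ∫⁻ x, ENNReal.ofReal ((f x - g x) ^ 2) ∂μ ≠ ⊤ :=
    hfg.top_integrable.lintegral_lt_top.ne
  rw [e μ hfg.1]
  refine ENNReal.toReal_le_of_le_ofReal hc ?_
  have := setLIntegral_iUnion_of_directed (μ := μ)
    (fun x => ENNReal.ofReal ((f x - g x) ^ 2)) hA.directed_le
  rw [hAU, setLIntegral_univ] at this
  rw [this]
  refine iSup_le fun m => ?_
  have hm := h m
  rw [e _ hfg.1.restrict] at hm
  exact (ENNReal.le_ofReal_iff_toReal_le
    ((setLIntegral_le_lintegral _ _).trans_lt hfin.lt_top).ne hc).2 hm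

theorem sqDist_restrict_le {f g : X → ℝ} [IsFiniteMeasure μ] (hf : MemLp f ⊤ μ) (hg : MemLp g ⊤ μ)
    (A : Set X) : sqDist (μ.restrict A) f g ≤ sqDist μ f g :=
  setIntegral_le_integral (hf.top_sub hg).top_sq.top_integrable (.of_forall fun _ => sq_nonneg _)

theorem sqrt_sqDist_restrict_le {f g : X → ℝ} [IsFiniteMeasure μ] (hf : Measurable f)
    (hg : Measurable g) {A : Set X} {c : ℝ} (hc : 0 ≤ c) (hA : ∀ x ∈ A, |f x - g x| ≤ c) :
    √(sqDist (μ.restrict A) f g) ≤ c * √(μ.real univ) := by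
  have hae : ∀ᵐ x ∂μ.restrict A, |f x - g x| ≤ c := by
    refine (ae_restrict_iff (measurableSet_le (hf.sub hg).abs measurable_const)).2
      (.of_forall hA)
  have h1 : sqDist (μ.restrict A) f g ≤ c ^ 2 * (μ.restrict A).real univ := by
    refine (integral_mono_of_nonneg (.of_forall fun _ => sq_nonneg _) (integrable_const (c ^ 2))
      ?_).trans (by simp [mul_comm])
    filter_upwards [hae] with x hx
    exact sq_le_sq' (by linarith [(abs_le.1 hx).1]) (abs_le.1 hx).2
  have h2 : (μ.restrict A).real univ ≤ μ.real univ :=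
    ENNReal.toReal_mono (measure_ne_top _ _) (Measure.restrict_le_self _)
  calc √(sqDist (μ.restrict A) f g) ≤ √(c ^ 2 * μ.real univ) := by gcongr; exact h1.trans (by gcongr)
    _ = c * √(μ.real univ) := by rw [Real.sqrt_mul (sq_nonneg c), Real.sqrt_sq hc]

namespace EnergyFlow

theorem sqrt_sqDist_restrict_le_of_gaps [IsFiniteMeasure μ] (h : EnergyFlow μ u u' α β K)
    {S : Set ℝ} (hS : IsClosed S) (hSI : S ⊆ Icc α β) {k L δ : ℝ} (hk : 0 ≤ k) (hL : 0 ≤ L)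
    (hδ : 0 < δ) (hgap : ∀ p ∈ S, ∀ q ∈ S, p < q → (∀ r ∈ Ioo p q, r ∉ S) →
      sqDist μ (u q) (u p) ≤ L ^ 2 * (q - p) ^ 2) {A : Set X}
    (hA : ∀ x ∈ A, ∀ p ∈ S, ∀ q ∈ Icc α β, |q - p| ≤ δ → |u q x - u p x| ≤ k * |q - p|)
    (N : ℕ) : ∀ p ∈ S, ∀ q ∈ S, p ≤ q → q - p ≤ N * δ →
      √(sqDist (μ.restrict A) (u q) (u p)) ≤ (L + k * √(μ.real univ)) * (q - p) := by
  have hm : 0 ≤ k * √(μ.real univ) := by positivity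
  have close : ∀ p ∈ S, ∀ q ∈ S, p ≤ q → q - p ≤ δ →
      √(sqDist (μ.restrict A) (u q) (u p)) ≤ k * √(μ.real univ) * (q - p) := by
    intro p hp q hq hpq hd
    have e : |q - p| = q - p := abs_of_nonneg (sub_nonneg.2 hpq)
    refine (sqrt_sqDist_restrict_le (h.measurable q (hSI hq)) (h.measurable p (hSI hp))
      (mul_nonneg hk (sub_nonneg.2 hpq)) fun x hx => ?_).trans (by rw [mul_right_comm])
    simpa [e] using hA x hx p hp q (hSI hq) (by rwa [e])
  induction N with
  | zero =>
    intro p hp q hq hpq hd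
    have : q = p := le_antisymm (by simpa using hd) hpq
    simp [this]
  | succ N ih =>
    intro p hp q hq hpq hd
    rcases le_total (q - p) δ with hc | hc
    · refine (close p hp q hq hpq hc).trans ?_
      have := mul_nonneg hL (sub_nonneg.2 hpq)
      linarith
    have hS1 : IsCompact (S ∩ Icc p (p + δ)) := isCompact_Icc.inter_left hS
    have hS2 : IsCompact (S ∩ Icc (p + δ) q) := isCompact_Icc.inter_left hS
    obtain ⟨p₁, ⟨hp₁S, hp₁⟩, hmax⟩ := hS1.exists_isGreatest ⟨p, hp, le_rfl, by linarith⟩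
    obtain ⟨q₁, ⟨hq₁S, hq₁⟩, hmin⟩ := hS2.exists_isLeast ⟨q, hq, by linarith, le_rfl⟩
    have hle : p₁ ≤ q₁ := hp₁.2.trans hq₁.1
    have hmem : ∀ r ∈ S, MemLp (u r) ⊤ (μ.restrict A) := fun r hr => (h.memLp (hSI hr)).restrict A
    have h1 := close p hp p₁ hp₁S hp₁.1 (by linarith [hp₁.2])
    have h2 : √(sqDist (μ.restrict A) (u q₁) (u p₁)) ≤ L * (q₁ - p₁) := by
      rcases hle.eq_or_lt with he | hlt
      · simp [he]
      have := hgap p₁ hp₁S q₁ hq₁S hlt fun r hr hrS => by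
        rcases le_total r (p + δ) with hr' | hr'
        · exact hr.1.not_ge (hmax ⟨hrS, hp₁.1.trans hr.1.le, hr'⟩)
        · exact hr.2.not_ge (hmin ⟨hrS, hr', hr.2.le.trans hq₁.2⟩)
      refine Real.sqrt_le_iff.2 ⟨mul_nonneg hL (sub_nonneg.2 hle), ?_⟩
      rw [mul_pow]
      exact (sqDist_restrict_le (h.memLp (hSI hq₁S)) (h.memLp (hSI hp₁S)) A).trans this
    have h3 := ih q₁ hq₁S q hq hq₁.2 (by push_cast at hd; linarith [hq₁.1])
    have t1 := sqrt_sqDist_triangle (hmem _ hq) (hmem _ hq₁S) (hmem _ hp)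
    have t2 := sqrt_sqDist_triangle (hmem _ hq₁S) (hmem _ hp₁S) (hmem _ hp)
    have e1 := mul_nonneg hL (sub_nonneg.2 hp₁.1)
    have e2 := mul_nonneg hm (sub_nonneg.2 hle)
    linarith

/-- On a closed set of times with bounded derivatives, whose gaps satisfy a mean square Lipschitz
bound, the family is Lipschitz in mean square. -/
theorem sqrt_sqDist_le_of_gaps [IsFiniteMeasure μ] (h : EnergyFlow μ u u' α β K)
    {S : Set ℝ} (hS : IsClosed S) (hSI : S ⊆ Icc α β) {k L : ℝ} (hk : 0 ≤ k) (hL : 0 ≤ L)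
    (hkS : ∀ p ∈ S, ∀ x, |u' p x| ≤ k)
    (hgap : ∀ p ∈ S, ∀ q ∈ S, p < q → (∀ r ∈ Ioo p q, r ∉ S) →
      sqDist μ (u q) (u p) ≤ L ^ 2 * (q - p) ^ 2) {p q : ℝ} (hp : p ∈ S) (hq : q ∈ S)
    (hpq : p ≤ q) :
    √(sqDist μ (u q) (u p)) ≤ (L + (k + 1) * √(μ.real univ)) * (q - p) := by
  set A : ℕ → Set X := fun m => {x | ∀ p ∈ S, ∀ q ∈ Icc α β, |q - p| ≤ 1 / ((m : ℝ) + 1) →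
    |u q x - u p x| ≤ (k + 1) * |q - p|} with hAdef
  have hmono : Monotone A := fun m m' hmm x hx p hp q hq hd =>
    hx p hp q hq (hd.trans (one_div_le_one_div_of_le (by positivity) (by gcongr)))
  have hU : ⋃ m, A m = univ := by
    refine eq_univ_of_forall fun x => mem_iUnion.2 ?_
    have huc := isCompact_Icc.uniformContinuousOn_of_continuous (h.continuousOn_deriv x)
    obtain ⟨δ, hδ, hδ'⟩ := Metric.uniformContinuousOn_iff.1 huc 1 one_pos
    obtain ⟨m, hm⟩ := exists_nat_one_div_lt hδ
    refine ⟨m, fun p hp q hq hd => ?_⟩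
    have hsub : uIcc p q ⊆ Icc α β := uIcc_subset_Icc (hSI hp) hq
    have := (convex_uIcc p q).norm_image_sub_le_of_norm_hasDerivWithin_le
      (f := fun s => u s x) (f' := fun s => u' s x) (C := k + 1)
      (fun s hs => (h.hasDerivAt s (hsub hs) x).hasDerivWithinAt)
      (fun s hs => by
        have h1 : dist s p < δ := by
          rw [Real.dist_eq]
          have := abs_sub_left_of_mem_uIcc hs
          exact this.trans_lt (hd.trans_lt hm)
        have h2 := hδ' s (hsub hs) p (hSI hp) h1
        have h3 := hkS p hp x
        rw [Real.dist_eq] at h2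
        rw [Real.norm_eq_abs]
        have := abs_sub_abs_le_abs_sub (u' s x) (u' p x)
        linarith)
      left_mem_uIcc right_mem_uIcc
    simpa using this
  have hΛ : 0 ≤ (L + (k + 1) * √(μ.real univ)) * (q - p) :=
    mul_nonneg (by positivity) (sub_nonneg.2 hpq)
  refine Real.sqrt_le_iff.2 ⟨hΛ, sqDist_le_of_forall_restrict (h.memLp (hSI hq)) (h.memLp (hSI hp))
    hmono hU (sq_nonneg _) fun m => ?_⟩
  obtain ⟨N, hN⟩ := exists_nat_ge ((q - p) * ((m : ℝ) + 1))
  have := h.sqrt_sqDist_restrict_le_of_gaps hS hSI (k := k + 1) (δ := 1 / ((m : ℝ) + 1))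
    (by linarith) hL (by positivity) hgap (A := A m) (fun x hx => hx) N p hp q hq hpq
    (by rw [mul_one_div, le_div_iff₀ (by positivity)]; exact hN)
  exact (Real.sqrt_le_iff.1 this).2

end EnergyFlow

end LipschitzOnClosed

section BaireRegularity

namespace EnergyFlow

variable {X : Type*} [MeasurableSpace X] {μ : Measure X} [IsFiniteMeasure μ]
  {u u' : ℝ → X → ℝ} {α β K : ℝ}

theorem integral_sq_le_of_abs_le {f : X → ℝ} {k : ℝ} (hf : ∀ x, |f x| ≤ k) :
    ∫ x, f x ^ 2 ∂μ ≤ k ^ 2 * μ.real univ := by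
  refine (integral_mono_of_nonneg (.of_forall fun _ => sq_nonneg _) (integrable_const (c := k ^ 2))
    (.of_forall fun x => ?_)).trans (by simp [mul_comm])
  exact sq_le_sq' (by linarith [(abs_le.1 (hf x)).1]) (abs_le.1 (hf x)).2

/-- If the family and its derivative are uniformly bounded at the times of a closed set whose
complement consists of regular times, then every time is regular. -/
theorem meanSquareRegularAt_of_closed (h : EnergyFlow μ u u' α β K) {c d k : ℝ} {S : Set ℝ}
    (hcd : Icc c d ⊆ Icc α β) (hS : IsClosed S) (hSI : S ⊆ Icc c d) (hk : 0 ≤ k)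
    (hk' : ∀ t ∈ S, ∀ x, |u' t x| ≤ k ∧ |u t x| ≤ k)
    (hreg : ∀ t ∈ Icc c d, t ∉ S → MeanSquareRegularAt μ u t) :
    ∀ t ∈ S, t ∈ Ioo c d → MeanSquareRegularAt μ u t := by
  set B := k ^ 2 * μ.real univ with hB
  have hB0 : 0 ≤ B := by positivity
  have hK := h.nonneg
  set e := exp (K * (β - α))
  have he : 0 < e := exp_pos _
  set L := √(2 * (K * (B + 2 * (e * B)))) with hLdef
  have hL : 0 ≤ L := Real.sqrt_nonneg _
  have hsub : ∀ {a b : ℝ}, a ∈ Icc c d → b ∈ Icc c d → α ≤ a ∧ b ≤ β :=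
    fun ha hb => ⟨(hcd ha).1, (hcd hb).2⟩
  have hforward : ∀ a ∈ S, ∀ b ∈ Icc c d, a < b → (∀ r ∈ Ioo a b, r ∉ S) →
      sqDist μ (u b) (u a) ≤ L ^ 2 * (b - a) ^ 2 := by
    intro a ha b hb hab hgap
    refine (h.sqDist_le_forward (hsub (hSI ha) hb).1 hab (hsub (hSI ha) hb).2 fun t ht =>
      hreg t ⟨(hSI ha).1.trans ht.1.le, ht.2.le.trans hb.2⟩ (hgap t ht)).trans ?_
    rw [hLdef, Real.sq_sqrt (by positivity)]
    have h1 := integral_sq_le_of_abs_le (μ := μ) fun x => (hk' a ha x).1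
    have h2 := integral_sq_le_of_abs_le (μ := μ) fun x => (hk' a ha x).2
    gcongr
  set Λ := L + (k + 1) * √(μ.real univ) with hΛdef
  have hΛ : 0 ≤ Λ := by positivity
  have hLip : ∀ p ∈ S, ∀ q ∈ S, p ≤ q → √(sqDist μ (u q) (u p)) ≤ Λ * (q - p) :=
    fun p hp q hq hpq => h.sqrt_sqDist_le_of_gaps hS (hSI.trans hcd) hk hL
      (fun p hp x => (hk' p hp x).1) (fun p hp q hq => hforward p hp q (hSI hq)) hp hq hpq
  intro t ht htI
  have hmem : ∀ {s}, s ∈ Icc c d → MemLp (u s) ⊤ μ := fun hs => h.memLp (hcd hs)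
  have htI' := hSI ht
  have hfwd : ∀ s ∈ Ioo t d, √(sqDist μ (u s) (u t)) ≤ (L + Λ) * (s - t) := by
    intro s hs
    have hsI : s ∈ Icc c d := ⟨htI'.1.trans hs.1.le, hs.2.le⟩
    obtain ⟨a, ⟨haS, ha⟩, hmax⟩ := (isCompact_Icc.inter_left hS : IsCompact (S ∩ Icc t s)).exists_isGreatest
      ⟨t, ht, le_rfl, hs.1.le⟩
    have h1 := hLip t ht a haS ha.1
    have h2 : √(sqDist μ (u s) (u a)) ≤ L * (s - a) := by
      rcases ha.2.eq_or_lt with rfl | hlt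
      · simp
      refine Real.sqrt_le_iff.2 ⟨mul_nonneg hL (sub_nonneg.2 ha.2), ?_⟩
      rw [mul_pow]
      exact hforward a haS s hsI hlt fun r hr hrS =>
        hr.1.not_ge (hmax ⟨hrS, ha.1.trans hr.1.le, hr.2.le⟩)
    have h3 := sqrt_sqDist_triangle (hmem hsI) (hmem (hSI haS)) (hmem htI')
    nlinarith [mul_nonneg hL (sub_nonneg.2 ha.1), mul_nonneg hΛ (sub_nonneg.2 ha.2)]
  have hbwd : ∀ s ∈ Ioo c t,
      √(sqDist μ (u s) (u t)) ≤ √(2 * K * (e * B) * (t - s)) + Λ * (t - s) := by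
    intro s hs
    have hsI : s ∈ Icc c d := ⟨hs.1.le, hs.2.le.trans htI'.2⟩
    obtain ⟨b, ⟨hbS, hb⟩, hmin⟩ := (isCompact_Icc.inter_left hS : IsCompact (S ∩ Icc s t)).exists_isLeast
      ⟨t, ht, hs.2.le, le_rfl⟩
    have h1 := hLip b hbS t ht hb.2
    have h2 : √(sqDist μ (u b) (u s)) ≤ √(2 * K * (e * B) * (t - s)) := by
      refine Real.sqrt_le_sqrt ?_
      have hts : 0 ≤ t - s := by linarith [hs.2]
      rcases hb.1.eq_or_lt with rfl | hlt
      · simp only [sqDist_self]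
        positivity
      refine (h.sqDist_le_holder (hcd hsI).1 hlt (hcd (hSI hbS)).2 (fun r hr => hreg r
        ⟨hsI.1.trans hr.1.le, hr.2.le.trans (hSI hbS).2⟩ fun hrS =>
          hr.2.not_ge (hmin ⟨hrS, hr.1.le, hr.2.le.trans hb.2⟩))
        (left_mem_Icc.2 hlt.le) (right_mem_Icc.2 hlt.le) hlt.le (right_mem_Icc.2 hlt.le)).trans ?_
      have h2 := integral_sq_le_of_abs_le (μ := μ) fun x => (hk' b hbS x).2
      have : 0 ≤ b - s := by linarith
      gcongr
      exact hb.2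
    have h3 := sqrt_sqDist_triangle (hmem hsI) (hmem (hSI hbS)) (hmem htI')
    rw [sqDist_comm (u s) (u b), sqDist_comm (u b) (u t)] at h3
    nlinarith [mul_nonneg hΛ (sub_nonneg.2 hb.1)]
  refine ⟨?_, (L + Λ) ^ 2, ?_⟩
  · have hlim : Tendsto (fun s => √(2 * K * (e * B) * |s - t|) + (L + Λ) * |s - t|) (𝓝 t) (𝓝 0) := by
      have : Continuous fun s => √(2 * K * (e * B) * |s - t|) + (L + Λ) * |s - t| := by fun_prop
      simpa using this.tendsto t
    have hs0 : Tendsto (fun s => √(sqDist μ (u s) (u t))) (𝓝 t) (𝓝 0) := by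
      refine squeeze_zero' (.of_forall fun _ => Real.sqrt_nonneg _) ?_ hlim
      filter_upwards [Ioo_mem_nhds htI.1 htI.2] with s hs
      rcases lt_trichotomy s t with hlt | rfl | hlt
      · rw [abs_sub_comm, abs_of_pos (sub_pos.2 hlt)]
        have := hbwd s ⟨hs.1, hlt⟩
        nlinarith [mul_nonneg hL (sub_pos.2 hlt).le]
      · simp
      · rw [abs_of_pos (sub_pos.2 hlt)]
        have := hfwd s ⟨hlt, hs.2⟩
        linarith [Real.sqrt_nonneg (2 * K * (e * B) * (s - t))]
    simpa [Real.sq_sqrt (sqDist_nonneg _ _)] using hs0.pow 2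
  · filter_upwards [Ioo_mem_nhdsGT htI.2] with s hs
    rw [← mul_pow]
    exact (Real.sqrt_le_iff.1 (hfwd s hs)).2

/-- Every interior time of an energy flow is regular. -/
theorem meanSquareRegularAt (h : EnergyFlow μ u u' α β K) :
    ∀ t ∈ Ioo α β, MeanSquareRegularAt μ u t := by
  intro t₀ ht₀
  by_contra hnot
  set R : Set ℝ := {t | MeanSquareRegularAt μ u t}
  set P : Set ℝ := Ioo α β ∩ (interior R)ᶜ with hP
  have hPI : P ⊆ Icc α β := fun t ht => Ioo_subset_Icc_self ht.1
  have hloc : IsLocallyClosed P :=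
    isOpen_Ioo.isLocallyClosed.inter isOpen_interior.isClosed_compl.isLocallyClosed
  have := hloc.locallyCompactSpace
  have : Nonempty P := ⟨t₀, ht₀, fun hmem => hnot (interior_subset (s := R) hmem)⟩
  set F : ℕ → Set P := fun k => {t | ∀ x, |u' t x| ≤ k ∧ |u t x| ≤ k} with hF
  have hFc : ∀ k, IsClosed (F k) := by
    intro k
    simp only [hF, ofPred_forall, ofPred_and]
    refine isClosed_iInter fun x => IsClosed.inter ?_ ?_
    · refine isClosed_le (continuous_abs.comp ?_) continuous_const
      exact ((h.continuousOn_deriv x).mono hPI).domRestrict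
    · refine isClosed_le (continuous_abs.comp ?_) continuous_const
      have : ContinuousOn (fun t => u t x) P := fun t ht =>
        (h.hasDerivAt t (hPI ht) x).continuousAt.continuousWithinAt
      exact this.domRestrict
  have hFU : ⋃ k, F k = univ := by
    refine eq_univ_of_forall fun t => mem_iUnion.2 ?_
    obtain ⟨C, hC⟩ := h.bounded t (hPI t.2)
    obtain ⟨C', hC'⟩ := h.bounded_deriv t (hPI t.2)
    obtain ⟨k, hk⟩ := exists_nat_ge (max C C')
    exact ⟨k, fun x => ⟨(hC' x).trans ((le_max_right _ _).trans hk),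
      (hC x).trans ((le_max_left _ _).trans hk)⟩⟩
  obtain ⟨k, ⟨q, hq⟩, hqF⟩ := nonempty_interior_of_iUnion_of_closed hFc hFU
  rw [mem_interior_iff_mem_nhds, mem_nhds_subtype] at hqF
  obtain ⟨O, hO, hOF⟩ := hqF
  have hO' : O ∩ Ioo α β ∈ 𝓝 q := inter_mem hO (isOpen_Ioo.mem_nhds hq.1)
  obtain ⟨ε, hε, hball⟩ := Metric.nhds_basis_closedBall.mem_iff.1 hO'
  rw [Real.closedBall_eq_Icc] at hball
  set c := q - ε
  set d := q + ε
  have key := h.meanSquareRegularAt_of_closed (c := c) (d := d) (k := k)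
    (S := Icc c d ∩ (interior R)ᶜ) (fun t ht => Ioo_subset_Icc_self (hball ht).2)
    (isClosed_Icc.inter isOpen_interior.isClosed_compl) inter_subset_left (Nat.cast_nonneg k)
    (fun t ht => hOF (a := (⟨t, (hball ht.1).2, ht.2⟩ : P)) (hball ht.1).1)
    (fun t ht htS => interior_subset (s := R) (by_contra fun hne => htS ⟨ht, hne⟩))
  refine hq.2 (mem_interior.2 ⟨Ioo c d, fun t ht => ?_, isOpen_Ioo, by simp [c, d, hε]⟩)
  by_cases hti : t ∈ interior R
  · exact interior_subset hti
  · exact key t ⟨Ioo_subset_Icc_self ht, hti⟩ ht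

end EnergyFlow

end BaireRegularity

section BackwardRate

namespace EnergyFlow

variable {X : Type*} [MeasurableSpace X] {μ : Measure X} [IsFiniteMeasure μ]
  {u u' : ℝ → X → ℝ} {α β K : ℝ}

theorem continuousOn_sqDist_Ioo (h : EnergyFlow μ u u' α β K) {w : X → ℝ} (hw : MemLp w ⊤ μ) :
    ContinuousOn (fun t => sqDist μ (u t) w) (Ioo α β) :=
  h.continuousOn_of_regular le_rfl le_rfl h.meanSquareRegularAt hw

/-- The linear backward rate at a time where a backward energy inequality holds. -/
theorem sqDist_le_backward (h : EnergyFlow μ u u' α β K) {t₀ δ C : ℝ} (hα : α ≤ t₀ - δ)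
    (hβ : t₀ < β)
    (hC : ∀ s ∈ Ioo (t₀ - δ) t₀, ∀ r > 0, -(2 * ∫ x, (u s x - u t₀ x) * u' s x ∂μ)
      ≤ C * (t₀ - s) + C * r + sqDist μ (u s) (u t₀) / (2 * r)) (hC0 : 0 ≤ C) :
    ∀ z ∈ Ioo (t₀ - δ) t₀, sqDist μ (u z) (u t₀) ≤ 4 * C * (z - t₀) ^ 2 := by
  intro z hz
  set y : ℝ → ℝ := fun s => sqDist μ (u s) (u t₀) with hy
  have hr : 0 < t₀ - z := sub_pos.2 hz.2
  have hsub : Icc z t₀ ⊆ Ioo α β := fun s hs => ⟨by linarith [hz.1, hs.1], hs.2.trans_lt hβ⟩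
  have ht₀ := Ioo_subset_Icc_self (hsub (right_mem_Icc.2 hz.2.le))
  have hcont : ContinuousOn y (Icc z t₀) := (h.continuousOn_sqDist_Ioo (h.memLp ht₀)).mono hsub
  obtain ⟨m, hm, hmax⟩ := isCompact_Icc.exists_isMaxOn (nonempty_Icc.2 hz.2.le) hcont
  have hmax' : ∀ x ∈ Icc z t₀, y x ≤ y m := fun x hx => hmax hx
  have h0 : 0 ≤ y m := sqDist_nonneg _ _
  have h1 := sub_le_of_hasDerivWithinAt_Ici
    (C := 2 * C * (t₀ - z) + y m / (2 * (t₀ - z))) hm.2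
    (hcont.mono (Icc_subset_Icc_left hm.1)).neg
    (fun s hs => (h.hasDerivWithinAt_sqDist (hsub ⟨hm.1.trans hs.1.le, hs.2.le⟩)
      (h.meanSquareRegularAt s (hsub ⟨hm.1.trans hs.1.le, hs.2.le⟩)) (h.memLp ht₀)
      (h.bounded t₀ ht₀)).neg)
    (fun s hs => by
      have hzs : z < s := hm.1.trans_lt hs.1
      refine (hC s ⟨hz.1.trans hzs, hs.2⟩ (t₀ - z) hr).trans ?_
      have e1 : sqDist μ (u s) (u t₀) / (2 * (t₀ - z)) ≤ y m / (2 * (t₀ - z)) := by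
        gcongr
        exact hmax' s ⟨hzs.le, hs.2.le⟩
      have e2 := mul_le_mul_of_nonneg_left hzs.le hC0
      linarith)
  have h2 : (2 * C * (t₀ - z) + y m / (2 * (t₀ - z))) * (t₀ - m)
      ≤ (2 * C * (t₀ - z) + y m / (2 * (t₀ - z))) * (t₀ - z) :=
    mul_le_mul_of_nonneg_left (by linarith [hm.1]) (by positivity)
  have h3 : (2 * C * (t₀ - z) + y m / (2 * (t₀ - z))) * (t₀ - z)
      = 2 * C * (t₀ - z) ^ 2 + y m / 2 := by field_simp
  have h4 := hmax' z (left_mem_Icc.2 hz.2.le)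
  have e : y t₀ = 0 := sqDist_self _
  simp only [Pi.neg_apply, e] at h1
  change y z ≤ _
  nlinarith

end EnergyFlow

end BackwardRate

/-! ### Functions on a bounded convex domain, regular up to the boundary -/

section ContinuousExtension

variable {E F : Type*} [TopologicalSpace E] [TopologicalSpace F] {Ω : Set E}

/-- The restriction of `f` to `Ω` extends continuously to the closure of `Ω`. -/
def ExtendsToClosure (Ω : Set E) (f : E → F) : Prop :=
  ∃ g, ContinuousOn g (closure Ω) ∧ EqOn f g Ω

theorem ContinuousOn.extendsToClosure {f : E → F} (hf : ContinuousOn f (closure Ω)) :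
    ExtendsToClosure Ω f := ⟨f, hf, fun _ _ => rfl⟩

theorem Continuous.extendsToClosure {f : E → F} (hf : Continuous f) :
    ExtendsToClosure Ω f := hf.continuousOn.extendsToClosure

namespace ExtendsToClosure

theorem mono {f : E → F} (hf : ExtendsToClosure Ω f) {Ω' : Set E} (h : Ω' ⊆ Ω) :
    ExtendsToClosure Ω' f := by
  obtain ⟨g, hg, hfg⟩ := hf
  exact ⟨g, hg.mono (closure_mono h), hfg.mono h⟩

theorem comp {F' : Type*} [TopologicalSpace F'] {φ : F → F'} (hφ : Continuous φ) {f : E → F}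
    (hf : ExtendsToClosure Ω f) : ExtendsToClosure Ω (fun x => φ (f x)) := by
  obtain ⟨g, hg, hfg⟩ := hf
  exact ⟨_, hφ.comp_continuousOn hg, fun x hx => congrArg φ (hfg hx)⟩

theorem prodMk {F' : Type*} [TopologicalSpace F'] {f : E → F} {f' : E → F'}
    (hf : ExtendsToClosure Ω f) (hf' : ExtendsToClosure Ω f') :
    ExtendsToClosure Ω (fun x => (f x, f' x)) := by
  obtain ⟨g, hg, hfg⟩ := hf
  obtain ⟨g', hg', hfg'⟩ := hf'
  exact ⟨_, hg.prodMk hg', fun x hx => Prod.ext (hfg hx) (hfg' hx)⟩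

theorem add {f f' : E → ℝ} (hf : ExtendsToClosure Ω f) (hf' : ExtendsToClosure Ω f') :
    ExtendsToClosure Ω (fun x => f x + f' x) :=
  comp (φ := fun p : ℝ × ℝ => p.1 + p.2) (by fun_prop) (hf.prodMk hf')

theorem mul {f f' : E → ℝ} (hf : ExtendsToClosure Ω f) (hf' : ExtendsToClosure Ω f') :
    ExtendsToClosure Ω (fun x => f x * f' x) :=
  comp (φ := fun p : ℝ × ℝ => p.1 * p.2) (by fun_prop) (hf.prodMk hf')

theorem pow {f : E → ℝ} (hf : ExtendsToClosure Ω f) (k : ℕ) :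
    ExtendsToClosure Ω (fun x => f x ^ k) :=
  comp (φ := fun p : ℝ => p ^ k) (by fun_prop) hf

theorem inner {V : Type*} [NormedAddCommGroup V] [InnerProductSpace ℝ V] {f f' : E → V}
    (hf : ExtendsToClosure Ω f) (hf' : ExtendsToClosure Ω f') :
    ExtendsToClosure Ω (fun x => inner ℝ (f x) (f' x)) :=
  comp (φ := fun p : V × V => Inner.inner ℝ p.1 p.2) (by fun_prop) (hf.prodMk hf')

theorem norm {V : Type*} [NormedAddCommGroup V] {f : E → V} (hf : ExtendsToClosure Ω f) :
    ExtendsToClosure Ω (fun x => ‖f x‖) :=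
  comp (φ := fun p : V => ‖p‖) (by fun_prop) hf

theorem continuousOn {f : E → F} (hf : ExtendsToClosure Ω f) : ContinuousOn f Ω := by
  obtain ⟨g, hg, hfg⟩ := hf
  exact (hg.mono subset_closure).congr hfg

theorem exists_norm_le {V : Type*} [NormedAddCommGroup V] {f : E → V} (hf : ExtendsToClosure Ω f)
    (hΩ : IsCompact (closure Ω)) : ∃ C, 0 ≤ C ∧ ∀ x ∈ Ω, ‖f x‖ ≤ C := by
  obtain ⟨g, hg, hfg⟩ := hf
  obtain ⟨C, hC⟩ := hΩ.exists_bound_of_continuousOn hg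
  exact ⟨max C 0, le_max_right _ _, fun x hx => by
    rw [hfg hx]
    exact (hC x (subset_closure hx)).trans (le_max_left _ _)⟩

theorem exists_abs_le {f : E → ℝ} (hf : ExtendsToClosure Ω f)
    (hΩ : IsCompact (closure Ω)) : ∃ C, 0 ≤ C ∧ ∀ x ∈ Ω, |f x| ≤ C :=
  hf.exists_norm_le hΩ

theorem memLp_top [MeasurableSpace E] [OpensMeasurableSpace E] {μ : Measure E} {f : E → ℝ}
    (hf : ExtendsToClosure Ω f) (hΩ : IsOpen Ω) (hc : IsCompact (closure Ω)) :
    MemLp f ⊤ (μ.restrict Ω) := by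
  obtain ⟨C, -, hC⟩ := hf.exists_abs_le hc
  exact memLp_top_of_bound (hf.continuousOn.aestronglyMeasurable hΩ.measurableSet) C
    ((ae_restrict_iff' hΩ.measurableSet).2 (.of_forall hC))

end ExtendsToClosure

end ContinuousExtension

section Divergence

variable {E : Type*} [NormedAddCommGroup E] [NormedSpace ℝ E] {Ω : Set E}

theorem uniqueDiffOn_closure_of_convex (hΩ : IsOpen Ω) (hconv : Convex ℝ Ω) :
    UniqueDiffOn ℝ (closure Ω) := by
  rcases Ω.eq_empty_or_nonempty with rfl | hne
  · simpa using uniqueDiffOn_empty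
  · exact uniqueDiffOn_convex hconv.closure
      (hne.mono (interior_maximal subset_closure hΩ))

theorem exists_mem_frontier_of_mem_of_notMem (hΩ : IsOpen Ω) {x y : E} (hx : x ∈ Ω) (hy : y ∉ Ω) :
    ∃ z ∈ frontier Ω, dist x z ≤ dist x y := by
  by_contra! hcon
  have hdisj : ∀ z ∈ segment ℝ x y, z ∉ frontier Ω := fun z hz hzf =>
    (hcon z hzf).not_ge (by
      have := dist_add_dist_of_mem_segment hz
      linarith [dist_nonneg (x := z) (y := y)])
  obtain ⟨z, -, hz⟩ := (convex_segment x y).isPreconnected Ω (closure Ω)ᶜ hΩ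
    isClosed_closure.isOpen_compl
    (fun z hz => by
      by_contra hne
      simp only [mem_union, mem_compl_iff, not_or, not_not] at hne
      exact hdisj z hz ⟨hne.2, by rw [hΩ.interior_eq]; exact hne.1⟩)
    ⟨x, left_mem_segment ℝ x y, hx⟩
    ⟨y, right_mem_segment ℝ x y, fun hyc => hdisj y (right_mem_segment ℝ x y)
      ⟨hyc, by rw [hΩ.interior_eq]; exact hy⟩⟩
  exact hz.2 (subset_closure hz.1)

/-- The extension by zero of a function of class `C¹` up to the boundary which vanishes there is
Lipschitz continuous. -/
theorem exists_lipschitzWith_indicator_of_contDiffOn (hΩ : IsOpen Ω) (hc : IsCompact (closure Ω))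
    (hconv : Convex ℝ Ω) {f : E → ℝ} (hf : ContDiffOn ℝ 1 f (closure Ω))
    (hf0 : ∀ x ∈ frontier Ω, f x = 0) : ∃ C, LipschitzWith C (Ω.indicator f) := by
  have hU := uniqueDiffOn_closure_of_convex hΩ hconv
  obtain ⟨C, hC⟩ := hc.exists_bound_of_continuousOn (hf.continuousOn_fderivWithin hU le_rfl)
  have hL : LipschitzOnWith C.toNNReal f (closure Ω) :=
    hconv.closure.lipschitzOnWith_of_nnnorm_fderivWithin_le (𝕜 := ℝ)
      (hf.differentiableOn one_ne_zero)
      fun x hx => by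
        rw [← NNReal.coe_le_coe, coe_nnnorm]
        exact (hC x hx).trans (Real.le_coe_toNNReal C)
  have key : ∀ x ∈ Ω, ∀ y ∉ Ω, dist (f x) 0 ≤ C.toNNReal * dist x y := by
    intro x hx y hy
    obtain ⟨z, hz, hxz⟩ := exists_mem_frontier_of_mem_of_notMem hΩ hx hy
    have := hL.dist_le_mul x (subset_closure hx) z (frontier_subset_closure hz)
    rw [hf0 z hz] at this
    exact this.trans (by gcongr)
  refine ⟨C.toNNReal, LipschitzWith.of_dist_le_mul fun x y => ?_⟩
  by_cases hx : x ∈ Ω <;> by_cases hy : y ∈ Ω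
  · rw [indicator_of_mem hx, indicator_of_mem hy]
    exact hL.dist_le_mul x (subset_closure hx) y (subset_closure hy)
  · rw [indicator_of_mem hx, indicator_of_notMem hy]
    exact key x hx y hy
  · rw [indicator_of_notMem hx, indicator_of_mem hy, dist_comm, dist_comm x]
    exact key y hy x hx
  · rw [indicator_of_notMem hx, indicator_of_notMem hy, dist_self]
    positivity

variable [FiniteDimensional ℝ E] [MeasurableSpace E] [BorelSpace E] {μ : Measure E}
  [μ.IsAddHaarMeasure]

theorem ae_notMem_frontier_of_convex (hconv : Convex ℝ Ω) : ∀ᵐ x ∂μ, x ∉ frontier Ω := by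
  have := hconv.addHaar_frontier μ
  rwa [← compl_mem_ae_iff] at this

theorem setIntegral_fderiv_eq_zero (hΩ : IsOpen Ω) (hc : IsCompact (closure Ω))
    (hconv : Convex ℝ Ω) {f : E → ℝ} (hf : ContDiffOn ℝ 1 f (closure Ω))
    (hf0 : ∀ x ∈ frontier Ω, f x = 0) (v : E) : ∫ x in Ω, fderiv ℝ f x v ∂μ = 0 := by
  obtain ⟨C, hC⟩ := exists_lipschitzWith_indicator_of_contDiffOn hΩ hc hconv hf hf0
  have hsupp : HasCompactSupport (Ω.indicator f) :=
    HasCompactSupport.intro hc fun x hx => indicator_of_notMem (fun h => hx (subset_closure h)) _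
  have h := LipschitzWith.integral_lineDeriv_mul_eq (μ := μ) (LipschitzWith.const (1 : ℝ)) hC
    hsupp (-v)
  simp only [neg_neg, mul_one] at h
  have h0 : ∀ x, lineDeriv ℝ (fun _ : E => (1 : ℝ)) x (-v) = 0 := fun x => by simp [lineDeriv]
  simp only [h0, zero_mul, integral_zero] at h
  rw [← integral_indicator hΩ.measurableSet, h]
  refine integral_congr_ae ?_
  filter_upwards [ae_notMem_frontier_of_convex (μ := μ) hconv] with x hx
  by_cases hxΩ : x ∈ Ω
  · rw [indicator_of_mem hxΩ]
    have he : Ω.indicator f =ᶠ[𝓝 x] f :=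
      Filter.eventuallyEq_of_mem (hΩ.mem_nhds hxΩ) fun y hy => indicator_of_mem hy f
    have hd : DifferentiableAt ℝ f x := ((hf.differentiableOn one_ne_zero).mono subset_closure
      |>.differentiableAt (hΩ.mem_nhds hxΩ))
    rw [he.lineDeriv_eq, hd.lineDeriv_eq_fderiv]
  · rw [indicator_of_notMem hxΩ]
    have hxc : x ∈ (closure Ω)ᶜ := fun hcl => hx ⟨hcl, by rwa [hΩ.interior_eq]⟩
    have he : Ω.indicator f =ᶠ[𝓝 x] fun _ => 0 :=
      Filter.eventuallyEq_of_mem (isClosed_closure.isOpen_compl.mem_nhds hxc)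
        fun y hy => indicator_of_notMem (fun h => hy (subset_closure h)) f
    rw [he.lineDeriv_eq]
    simp [lineDeriv]

end Divergence

section Green

variable {n : ℕ} {Ω : Set (EuclideanSpace ℝ (Fin n))} {v w ρ : EuclideanSpace ℝ (Fin n) → ℝ}

theorem fderivWithin_closure_eq (hΩ : IsOpen Ω) {x : EuclideanSpace ℝ (Fin n)} (hx : x ∈ Ω) :
    fderivWithin ℝ v (closure Ω) x = fderiv ℝ v x :=
  fderivWithin_of_mem_nhds (Filter.mem_of_superset (hΩ.mem_nhds hx) subset_closure)

theorem ContDiffOn.differentiableAt_of_mem (hΩ : IsOpen Ω) (hv : ContDiffOn ℝ 1 v (closure Ω))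
    {x : EuclideanSpace ℝ (Fin n)} (hx : x ∈ Ω) : DifferentiableAt ℝ v x :=
  (hv.differentiableOn one_ne_zero).differentiableAt
    (Filter.mem_of_superset (hΩ.mem_nhds hx) subset_closure)

theorem ContDiffOn.extendsToClosure_fderiv (hΩ : IsOpen Ω) (hconv : Convex ℝ Ω)
    (hv : ContDiffOn ℝ 1 v (closure Ω)) : ExtendsToClosure Ω (fderiv ℝ v) :=
  ⟨_, hv.continuousOn_fderivWithin (uniqueDiffOn_closure_of_convex hΩ hconv) le_rfl,
    fun _ hx => (fderivWithin_closure_eq hΩ hx).symm⟩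

theorem ContDiffOn.extendsToClosure_gradient (hΩ : IsOpen Ω) (hconv : Convex ℝ Ω)
    (hv : ContDiffOn ℝ 1 v (closure Ω)) : ExtendsToClosure Ω (gradient v) :=
  (hv.extendsToClosure_fderiv hΩ hconv).comp
    (φ := (InnerProductSpace.toDual ℝ (EuclideanSpace ℝ (Fin n))).symm) (LinearIsometryEquiv.continuous _)

theorem ContDiffOn.fderivWithin_apply_closure (hΩ : IsOpen Ω) (hconv : Convex ℝ Ω)
    (hv : ContDiffOn ℝ 2 v (closure Ω)) (e : EuclideanSpace ℝ (Fin n)) :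
    ContDiffOn ℝ 1 (fun x => fderivWithin ℝ v (closure Ω) x e) (closure Ω) :=
  (hv.fderivWithin (uniqueDiffOn_closure_of_convex hΩ hconv) (m := 1) (by norm_num)).clm_apply
    contDiffOn_const

theorem fderivWithin_apply_closure_eventuallyEq (hΩ : IsOpen Ω) {x : EuclideanSpace ℝ (Fin n)}
    (hx : x ∈ Ω) (e : EuclideanSpace ℝ (Fin n)) :
    (fun y => fderivWithin ℝ v (closure Ω) y e) =ᶠ[𝓝 x] fun y => fderiv ℝ v y e :=
  Filter.eventuallyEq_of_mem (hΩ.mem_nhds hx) fun y hy => by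
    simp only [fderivWithin_closure_eq hΩ hy]

theorem ContDiffOn.extendsToClosure_lap (hΩ : IsOpen Ω) (hconv : Convex ℝ Ω)
    (hv : ContDiffOn ℝ 2 v (closure Ω)) : ExtendsToClosure Ω (lap v) := by
  have hU := uniqueDiffOn_closure_of_convex hΩ hconv
  refine ⟨fun x => ∑ i : Fin n, fderivWithin ℝ (fun y => fderivWithin ℝ v (closure Ω) y
    (EuclideanSpace.single i 1)) (closure Ω) x (EuclideanSpace.single i 1),
    continuousOn_finsetSum _ fun i _ => ?_, fun x hx => Finset.sum_congr rfl fun i _ => ?_⟩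
  · exact ((hv.fderivWithin_apply_closure hΩ hconv _).continuousOn_fderivWithin hU le_rfl).clm_apply
      continuousOn_const
  · rw [fderivWithin_closure_eq hΩ hx,
      (fderivWithin_apply_closure_eventuallyEq hΩ hx _).fderiv_eq]

theorem inner_gradient_eq_sum (v w : EuclideanSpace ℝ (Fin n) → ℝ) (x : EuclideanSpace ℝ (Fin n)) :
    inner ℝ (gradient v x) (gradient w x) = ∑ i : Fin n,
      fderiv ℝ v x (EuclideanSpace.single i 1) * fderiv ℝ w x (EuclideanSpace.single i 1) := by
  rw [← (EuclideanSpace.basisFun (Fin n) ℝ).sum_inner_mul_inner]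
  refine Finset.sum_congr rfl fun i _ => ?_
  rw [inner_gradient_left, inner_gradient_right]
  simp

/-- Green's first identity with a weight, for a function vanishing on the boundary. -/
theorem setIntegral_mul_inner_gradient (hΩ : IsOpen Ω) (hc : IsCompact (closure Ω))
    (hconv : Convex ℝ Ω) (hv : ContDiffOn ℝ 2 v (closure Ω)) (hw : ContDiffOn ℝ 1 w (closure Ω))
    (hw0 : ∀ x ∈ frontier Ω, w x = 0) (hρ : ContDiff ℝ 1 ρ) :
    ∫ x in Ω, ρ x * inner ℝ (gradient v x) (gradient w x)
      = -∫ x in Ω, w x * (ρ x * lap v x + inner ℝ (gradient v x) (gradient ρ x)) := by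
  have hv1 : ContDiffOn ℝ 1 v (closure Ω) := hv.of_le (by norm_num)
  set F : Fin n → EuclideanSpace ℝ (Fin n) → ℝ := fun i x =>
    (ρ x * w x) * fderivWithin ℝ v (closure Ω) x (EuclideanSpace.single i 1) with hFdef
  have hF : ∀ i, ContDiffOn ℝ 1 (F i) (closure Ω) := fun i =>
    (hρ.contDiffOn.mul hw).mul (hv.fderivWithin_apply_closure hΩ hconv _)
  have hintF : ∀ i, Integrable (fun x => fderiv ℝ (F i) x (EuclideanSpace.single i 1))
      (volume.restrict Ω) := fun i => by
    have : IsFiniteMeasure (volume.restrict Ω) :=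
      ⟨by simpa using (measure_mono subset_closure).trans_lt hc.measure_lt_top⟩
    have e : ExtendsToClosure Ω fun x => fderiv ℝ (F i) x (EuclideanSpace.single i 1) :=
      ((hF i).extendsToClosure_fderiv hΩ hconv).comp
        (φ := fun L : EuclideanSpace ℝ (Fin n) →L[ℝ] ℝ => L (EuclideanSpace.single i 1))
        (by fun_prop)
    exact (e.memLp_top hΩ hc).top_integrable
  have hsum : ∫ x in Ω, ∑ i, fderiv ℝ (F i) x (EuclideanSpace.single i 1) = 0 := by
    rw [integral_finsetSum _ fun i _ => hintF i]
    exact Finset.sum_eq_zero fun i _ => setIntegral_fderiv_eq_zero hΩ hc hconv (hF i)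
      (fun x hx => by simp [hFdef, hw0 x hx]) _
  have hpt : ∀ x ∈ Ω, ∑ i, fderiv ℝ (F i) x (EuclideanSpace.single i 1)
      = ρ x * inner ℝ (gradient v x) (gradient w x)
        + w x * (ρ x * lap v x + inner ℝ (gradient v x) (gradient ρ x)) := by
    intro x hx
    have h1 : ∀ i, fderiv ℝ (F i) x (EuclideanSpace.single i 1)
        = ρ x * (fderiv ℝ v x (EuclideanSpace.single i 1) * fderiv ℝ w x (EuclideanSpace.single i 1))
          + w x * (ρ x * fderiv ℝ (fun y => fderiv ℝ v y (EuclideanSpace.single i 1)) x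
              (EuclideanSpace.single i 1)
            + fderiv ℝ v x (EuclideanSpace.single i 1)
              * fderiv ℝ ρ x (EuclideanSpace.single i 1)) := by
      intro i
      have hdρ : DifferentiableAt ℝ ρ x := hρ.differentiable one_ne_zero x
      have hdw := hw.differentiableAt_of_mem hΩ hx
      have hdv := (hv.fderivWithin_apply_closure hΩ hconv
        (EuclideanSpace.single i 1)).differentiableAt_of_mem hΩ hx
      have e := (fderivWithin_apply_closure_eventuallyEq (v := v) hΩ hx
        (EuclideanSpace.single i 1)).fderiv_eq (𝕜 := ℝ)
      have := ((hdρ.hasFDerivAt.mul hdw.hasFDerivAt).mul hdv.hasFDerivAt).fderiv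
      change fderiv ℝ (F i) x = _ at this
      rw [this, e]
      simp [fderivWithin_closure_eq hΩ hx]
      ring
    simp only [h1, inner_gradient_eq_sum, lap, Finset.sum_add_distrib, Finset.mul_sum, mul_add]
  have e1 : ExtendsToClosure Ω fun x => ρ x * inner ℝ (gradient v x) (gradient w x) :=
    hρ.continuous.extendsToClosure.mul
      ((hv1.extendsToClosure_gradient hΩ hconv).inner (hw.extendsToClosure_gradient hΩ hconv))
  have e2 : ExtendsToClosure Ω
      fun x => w x * (ρ x * lap v x + inner ℝ (gradient v x) (gradient ρ x)) :=
    hw.continuousOn.extendsToClosure.mul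
      ((hρ.continuous.extendsToClosure.mul (hv.extendsToClosure_lap hΩ hconv)).add
        ((hv1.extendsToClosure_gradient hΩ hconv).inner
          (hρ.contDiffOn.extendsToClosure_gradient hΩ hconv)))
  have : IsFiniteMeasure (volume.restrict Ω) :=
    ⟨by simpa using (measure_mono subset_closure).trans_lt hc.measure_lt_top⟩
  rw [setIntegral_congr_fun hΩ.measurableSet hpt,
    integral_add (e1.memLp_top hΩ hc).top_integrable (e2.memLp_top hΩ hc).top_integrable] at hsum
  linarith

end Green

/-! ### The caloric weight -/

section Caloric

variable {n : ℕ} {T lam t : ℝ} {x₀ : EuclideanSpace ℝ (Fin n)}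

theorem contDiff_caloric : ContDiff ℝ 1 fun x => caloric T lam x₀ x t := by
  unfold caloric
  have h : ContDiff ℝ 1 fun x : EuclideanSpace ℝ (Fin n) => ‖x - x₀‖ ^ 2 :=
    (contDiff_id.sub contDiff_const).norm_sq ℝ
  fun_prop

theorem caloric_pos (ht : 0 < T - t + lam) (x : EuclideanSpace ℝ (Fin n)) :
    0 < caloric T lam x₀ x t :=
  mul_pos (Real.rpow_pos_of_pos ht _) (Real.exp_pos _)

theorem hasGradientAt_caloric (x : EuclideanSpace ℝ (Fin n)) :
    HasGradientAt (fun x => caloric T lam x₀ x t)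
      (-(caloric T lam x₀ x t / (2 * (T - t + lam))) • (x - x₀)) x := by
  have h : HasFDerivAt (fun x : EuclideanSpace ℝ (Fin n) => ‖x - x₀‖ ^ 2)
      (2 • (innerSL ℝ (x - x₀))) x := by
    simpa using ((hasFDerivAt_id x).sub_const x₀).norm_sq
  have h2 := (((h.neg.mul_const ((4 * (T - t + lam))⁻¹)).exp).const_mul
    ((T - t + lam) ^ (-(n : ℝ) / 2)))
  rw [hasGradientAt_iff_hasFDerivAt]
  simp only [← div_eq_mul_inv] at h2
  refine h2.congr_fderiv ?_
  ext y
  simp only [caloric]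
  generalize T - t + lam = τ
  simp
  ring

theorem gradient_caloric (x : EuclideanSpace ℝ (Fin n)) :
    gradient (fun x => caloric T lam x₀ x t) x
      = -(caloric T lam x₀ x t / (2 * (T - t + lam))) • (x - x₀) :=
  (hasGradientAt_caloric x).gradient

theorem hasDerivAt_caloric (ht : 0 < T - t + lam) (x : EuclideanSpace ℝ (Fin n)) :
    HasDerivAt (fun s => caloric T lam x₀ x s)
      (((n : ℝ) / (2 * (T - t + lam)) - ‖x - x₀‖ ^ 2 / (4 * (T - t + lam) ^ 2))
        * caloric T lam x₀ x t) t := by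
  have hτ : HasDerivAt (fun s => T - s + lam) (-1) t :=
    ((hasDerivAt_id t).const_sub T).add_const lam
  have h1 := hτ.rpow_const (p := -(n : ℝ) / 2) (.inl ht.ne')
  have h2 := ((hasDerivAt_const t (-‖x - x₀‖ ^ 2)).div (hτ.const_mul 4) (by positivity)).exp
  refine (h1.mul h2).congr_deriv ?_
  rw [Real.rpow_sub_one ht.ne']
  simp only [caloric, Pi.div_apply]
  field_simp
  ring

theorem continuousOn_caloric (hlam : 0 < lam) :
    ContinuousOn (fun p : EuclideanSpace ℝ (Fin n) × ℝ => caloric T lam x₀ p.1 p.2)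
      (univ ×ˢ Iic T) := by
  unfold caloric
  have hτ : ∀ p ∈ (univ : Set (EuclideanSpace ℝ (Fin n))) ×ˢ Iic T, T - p.2 + lam ≠ 0 := by
    rintro p ⟨-, hp⟩
    have : p.2 ≤ T := hp
    linarith
  refine ContinuousOn.mul (ContinuousOn.rpow_const (by fun_prop) fun p hp => .inl (hτ p hp)) ?_
  exact (ContinuousOn.div (by fun_prop) (by fun_prop) fun p hp =>
    mul_ne_zero four_ne_zero (hτ p hp)).rexp

/-- Uniform bounds for the caloric weight and its first derivatives on a bounded cylinder. -/
theorem exists_caloric_bounds {Ω : Set (EuclideanSpace ℝ (Fin n))} (hc : IsCompact (closure Ω))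
    (hlam : 0 < lam) : ∃ c > 0, ∃ C ≥ 0, ∀ t ∈ Icc 0 T, ∀ x ∈ Ω,
      c ≤ caloric T lam x₀ x t ∧ caloric T lam x₀ x t ≤ C ∧
      ‖gradient (fun x => caloric T lam x₀ x t) x‖ ≤ C ∧
      ∀ s ∈ Icc 0 T, |caloric T lam x₀ x s - caloric T lam x₀ x t| ≤ C * |s - t| := by
  rcases (closure Ω ×ˢ Icc 0 T).eq_empty_or_nonempty with he | hne
  · refine ⟨1, one_pos, 0, le_rfl, fun t ht x hx => ?_⟩
    exact absurd (he ▸ mk_mem_prod (subset_closure hx) ht) (notMem_empty _)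
  have hK : IsCompact (closure Ω ×ˢ Icc 0 T) := hc.prod isCompact_Icc
  have hτ : ∀ p ∈ closure Ω ×ˢ Icc 0 T, 0 < T - p.2 + lam := by
    rintro p ⟨-, hp⟩
    linarith [hp.2]
  have hG : ContinuousOn (fun p : EuclideanSpace ℝ (Fin n) × ℝ => caloric T lam x₀ p.1 p.2)
      (closure Ω ×ˢ Icc 0 T) :=
    (continuousOn_caloric hlam).mono fun p hp => ⟨mem_univ _, hp.2.2⟩
  obtain ⟨p, hp, hmin⟩ := hK.exists_isMinOn hne hG
  obtain ⟨C₁, hC₁⟩ := hK.exists_bound_of_continuousOn hG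
  have hgrad : ContinuousOn (fun p : EuclideanSpace ℝ (Fin n) × ℝ =>
      -(caloric T lam x₀ p.1 p.2 / (2 * (T - p.2 + lam))) • (p.1 - x₀))
      (closure Ω ×ˢ Icc 0 T) :=
    ((hG.div (by fun_prop) fun p hp => (mul_pos two_pos (hτ p hp)).ne').neg).smul (by fun_prop)
  obtain ⟨C₂, hC₂⟩ := hK.exists_bound_of_continuousOn hgrad
  have hderiv : ContinuousOn (fun p : EuclideanSpace ℝ (Fin n) × ℝ =>
      ((n : ℝ) / (2 * (T - p.2 + lam)) - ‖p.1 - x₀‖ ^ 2 / (4 * (T - p.2 + lam) ^ 2))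
        * caloric T lam x₀ p.1 p.2) (closure Ω ×ˢ Icc 0 T) :=
    ((ContinuousOn.div (by fun_prop) (by fun_prop) fun p hp => (mul_pos two_pos (hτ p hp)).ne').sub
      (ContinuousOn.div (by fun_prop) (by fun_prop) fun p hp =>
        (mul_pos four_pos (pow_pos (hτ p hp) 2)).ne')).mul hG
  obtain ⟨C₃, hC₃⟩ := hK.exists_bound_of_continuousOn hderiv
  have hm1 : C₁ ≤ max 0 (max C₁ (max C₂ C₃)) := by simp
  have hm2 : C₂ ≤ max 0 (max C₁ (max C₂ C₃)) := by simp
  have hm3 : C₃ ≤ max 0 (max C₁ (max C₂ C₃)) := by simp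
  refine ⟨caloric T lam x₀ p.1 p.2, caloric_pos (hτ p hp) _, max 0 (max C₁ (max C₂ C₃)),
    le_max_left _ _, fun t ht x hx => ?_⟩
  have hxt : (x, t) ∈ closure Ω ×ˢ Icc 0 T := ⟨subset_closure hx, ht⟩
  refine ⟨hmin hxt, ((le_abs_self _).trans (hC₁ _ hxt)).trans hm1, ?_, fun s hs => ?_⟩
  · rw [gradient_caloric]
    exact (hC₂ _ hxt).trans hm2
  · refine (Convex.norm_image_sub_le_of_norm_hasDerivWithin_le (fun r hr =>
      (hasDerivAt_caloric (hτ (x, r) ⟨subset_closure hx, hr⟩) x).hasDerivWithinAt)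
      (fun r hr => ?_) (convex_Icc 0 T) ht hs)
    exact (hC₃ (x, r) ⟨subset_closure hx, hr⟩).trans hm3

end Caloric

/-! ### Energy inequalities at a fixed time -/

section EnergyState

theorem two_mul_integral_mul_le {X : Type*} [MeasurableSpace X] {μ : Measure X} [IsFiniteMeasure μ]
    {f g : X → ℝ} (hf : MemLp f ⊤ μ) (hg : MemLp g ⊤ μ) {r : ℝ} (hr : 0 < r) :
    2 * ∫ x, f x * g x ∂μ ≤ (∫ x, f x ^ 2 ∂μ) / (2 * r) + 2 * r * ∫ x, g x ^ 2 ∂μ := by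
  have h := (le_abs_self _).trans (abs_integral_mul_le hf hg)
  have ha := Real.sq_sqrt (integral_nonneg fun x => sq_nonneg (f x) : 0 ≤ ∫ x, f x ^ 2 ∂μ)
  have hb := Real.sq_sqrt (integral_nonneg fun x => sq_nonneg (g x) : 0 ≤ ∫ x, g x ^ 2 ∂μ)
  set a := √(∫ x, f x ^ 2 ∂μ)
  set b := √(∫ x, g x ^ 2 ∂μ)
  rw [← ha, ← hb]
  have e : a ^ 2 / (2 * r) + 2 * r * b ^ 2 - 2 * (a * b) = (a - 2 * r * b) ^ 2 / (2 * r) := by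
    field_simp
    ring
  have : 0 ≤ (a - 2 * r * b) ^ 2 / (2 * r) := by positivity
  linarith

theorem two_mul_integral_mul_le_add {X : Type*} [MeasurableSpace X] {μ : Measure X}
    [IsFiniteMeasure μ] {f g : X → ℝ} (hf : MemLp f ⊤ μ) (hg : MemLp g ⊤ μ) :
    2 * ∫ x, f x * g x ∂μ ≤ (∫ x, f x ^ 2 ∂μ) + ∫ x, g x ^ 2 ∂μ := by
  have := two_mul_integral_mul_le hf hg (r := 2⁻¹) (by norm_num)
  norm_num at this
  exact this

variable {n : ℕ} {Ω : Set (EuclideanSpace ℝ (Fin n))} {L : ℝ}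
  {U g A b : EuclideanSpace ℝ (Fin n) → ℝ}

theorem isFiniteMeasure_restrict_of_isCompact_closure (hc : IsCompact (closure Ω)) :
    IsFiniteMeasure (volume.restrict Ω) :=
  ⟨by simpa using (measure_mono subset_closure).trans_lt hc.measure_lt_top⟩

theorem gradient_sub_of_mem (hΩ : IsOpen Ω) (hU : ContDiffOn ℝ 1 U (closure Ω))
    (hA : ContDiffOn ℝ 1 A (closure Ω)) {x : EuclideanSpace ℝ (Fin n)} (hx : x ∈ Ω) :
    gradient (fun y => U y - A y) x = gradient U x - gradient A x := by
  simp only [gradient, ← map_sub]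
  congr 1
  exact fderiv_fun_sub (hU.differentiableAt_of_mem hΩ hx) (hA.differentiableAt_of_mem hΩ hx)

theorem setIntegral_mul_lap (hΩ : IsOpen Ω) (hc : IsCompact (closure Ω))
    (hconv : Convex ℝ Ω) (hU : ContDiffOn ℝ 2 U (closure Ω)) (hA : ContDiffOn ℝ 1 A (closure Ω))
    (hA0 : ∀ x ∈ frontier Ω, A x = 0) :
    ∫ x in Ω, A x * lap U x = -∫ x in Ω, inner ℝ (gradient U x) (gradient A x) := by
  have h := setIntegral_mul_inner_gradient hΩ hc hconv hU hA hA0 (ρ := fun _ => 1) contDiff_const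
  have hg : ∀ x : EuclideanSpace ℝ (Fin n), gradient (fun _ => (1 : ℝ)) x = 0 := fun x => by
    simp [gradient]
  simp only [one_mul, hg, inner_zero_right, add_zero] at h
  rw [h, neg_neg]

/-- A weighted Dirichlet energy that is a controlled multiple of the weighted mass controls the
unweighted Dirichlet energy. -/
theorem setIntegral_gradient_sq_le_of_weight (hΩ : IsOpen Ω) (hc : IsCompact (closure Ω))
    (hconv : Convex ℝ Ω) (hU : ContDiffOn ℝ 2 U (closure Ω))
    {W : EuclideanSpace ℝ (Fin n) → ℝ} {c C₁ C₂ k : ℝ} (hW : Continuous W) (hc0 : 0 < c)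
    (hC₂ : 0 ≤ C₂) (hcW : ∀ x ∈ Ω, c ≤ W x) (hWC : ∀ x ∈ Ω, W x ≤ C₁)
    (hk : ∫ x in Ω, ‖gradient U x‖ ^ 2 * W x = k * ∫ x in Ω, U x ^ 2 * W x) (hkC : k ≤ C₂) :
    ∫ x in Ω, ‖gradient U x‖ ^ 2 ≤ C₂ * C₁ / c * ∫ x in Ω, U x ^ 2 := by
  have := isFiniteMeasure_restrict_of_isCompact_closure hc
  have hWL := (hW.extendsToClosure (Ω := Ω)).memLp_top (μ := volume) hΩ hc
  have g2 := (((hU.of_le (by norm_num)).extendsToClosure_gradient hΩ hconv).norm.pow 2).memLp_top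
    (μ := volume) hΩ hc
  have u2 := (hU.continuousOn.extendsToClosure.memLp_top (μ := volume) hΩ hc).top_sq
  have i1 : c * ∫ x in Ω, ‖gradient U x‖ ^ 2 ≤ ∫ x in Ω, ‖gradient U x‖ ^ 2 * W x := by
    rw [← integral_const_mul]
    refine setIntegral_mono_on (g2.top_integrable.const_mul c) (g2.top_mul hWL).top_integrable
      hΩ.measurableSet fun x hx => ?_
    rw [mul_comm]
    exact mul_le_mul_of_nonneg_left (hcW x hx) (sq_nonneg _)
  have i2 : ∫ x in Ω, U x ^ 2 * W x ≤ C₁ * ∫ x in Ω, U x ^ 2 := by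
    rw [← integral_const_mul]
    refine setIntegral_mono_on (u2.top_mul hWL).top_integrable (u2.top_integrable.const_mul _)
      hΩ.measurableSet fun x hx => ?_
    rw [mul_comm C₁]
    exact mul_le_mul_of_nonneg_left (hWC x hx) (sq_nonneg _)
  have i3 : 0 ≤ ∫ x in Ω, U x ^ 2 * W x := setIntegral_nonneg hΩ.measurableSet fun x hx =>
    mul_nonneg (sq_nonneg _) (hc0.le.trans (hcW x hx))
  have i4 := mul_le_mul_of_nonneg_left i2 hC₂
  have i5 := mul_le_mul_of_nonneg_right hkC i3
  rw [div_mul_eq_mul_div, le_div_iff₀' hc0]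
  linarith

/-- A function of class `C²` up to the boundary vanishing there, together with a forcing term, such
that the Dirichlet energy and the forcing are controlled by the function in mean square. -/
structure EnergyState (Ω : Set (EuclideanSpace ℝ (Fin n))) (L : ℝ)
    (U g : EuclideanSpace ℝ (Fin n) → ℝ) : Prop where
  contDiffOn : ContDiffOn ℝ 2 U (closure Ω)
  eq_zero : ∀ x ∈ frontier Ω, U x = 0
  memLp_forcing : MemLp g ⊤ (volume.restrict Ω)
  gradient_le : ∫ x in Ω, ‖gradient U x‖ ^ 2 ≤ L * ∫ x in Ω, U x ^ 2
  forcing_le : ∫ x in Ω, g x ^ 2 ≤ L * ∫ x in Ω, U x ^ 2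

namespace EnergyState

theorem contDiffOn_one (h : EnergyState Ω L U g) : ContDiffOn ℝ 1 U (closure Ω) :=
  h.contDiffOn.of_le (by norm_num)

theorem memLp (h : EnergyState Ω L U g) (hΩ : IsOpen Ω) (hc : IsCompact (closure Ω)) :
    MemLp U ⊤ (volume.restrict Ω) :=
  h.contDiffOn.continuousOn.extendsToClosure.memLp_top hΩ hc

theorem extendsToClosure_gradient (h : EnergyState Ω L U g) (hΩ : IsOpen Ω) (hconv : Convex ℝ Ω) :
    ExtendsToClosure Ω (gradient U) :=
  h.contDiffOn_one.extendsToClosure_gradient hΩ hconv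

theorem memLp_lap (h : EnergyState Ω L U g) (hΩ : IsOpen Ω) (hc : IsCompact (closure Ω))
    (hconv : Convex ℝ Ω) : MemLp (lap U) ⊤ (volume.restrict Ω) :=
  (h.contDiffOn.extendsToClosure_lap hΩ hconv).memLp_top hΩ hc

theorem integral_mul_lap_add (h : EnergyState Ω L U g) (hΩ : IsOpen Ω) (hc : IsCompact (closure Ω))
    (hconv : Convex ℝ Ω) {w : EuclideanSpace ℝ (Fin n) → ℝ} (hw : ContDiffOn ℝ 1 w (closure Ω))
    (hw0 : ∀ x ∈ frontier Ω, w x = 0) :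
    ∫ x in Ω, w x * (lap U x + g x)
      = -(∫ x in Ω, inner ℝ (gradient U x) (gradient w x)) + ∫ x in Ω, w x * g x := by
  have := isFiniteMeasure_restrict_of_isCompact_closure hc
  have hwL := hw.continuousOn.extendsToClosure.memLp_top (μ := volume) hΩ hc
  simp only [mul_add]
  rw [integral_add (hwL.top_mul (h.memLp_lap hΩ hc hconv)).top_integrable
    (hwL.top_mul h.memLp_forcing).top_integrable, setIntegral_mul_lap hΩ hc hconv h.contDiffOn hw hw0]

theorem growth (h : EnergyState Ω L U g) (hΩ : IsOpen Ω) (hc : IsCompact (closure Ω))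
    (hconv : Convex ℝ Ω) :
    |2 * ∫ x in Ω, U x * (lap U x + g x)| ≤ (3 * L + 1) * ∫ x in Ω, U x ^ 2 := by
  have := isFiniteMeasure_restrict_of_isCompact_closure hc
  rw [h.integral_mul_lap_add hΩ hc hconv h.contDiffOn_one h.eq_zero]
  simp only [real_inner_self_eq_norm_sq]
  have h0 : 0 ≤ ∫ x in Ω, ‖gradient U x‖ ^ 2 := integral_nonneg fun x => sq_nonneg _
  have h1 := two_mul_integral_mul_le_add (h.memLp hΩ hc) h.memLp_forcing
  have h2 := two_mul_integral_mul_le_add (h.memLp hΩ hc) h.memLp_forcing.neg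
  simp only [Pi.neg_apply, mul_neg, integral_neg, even_two.neg_pow] at h2
  rw [abs_le]
  constructor <;> linarith [h.gradient_le, h.forcing_le]

theorem integral_sub_mul_le (h : EnergyState Ω L U g) (hA : EnergyState Ω L A b) (hΩ : IsOpen Ω)
    (hc : IsCompact (closure Ω)) (hconv : Convex ℝ Ω) :
    2 * ∫ x in Ω, (U x - A x) * (lap U x + g x)
      ≤ (L + 2) * ((∫ x in Ω, U x ^ 2) + ∫ x in Ω, A x ^ 2) := by
  have := isFiniteMeasure_restrict_of_isCompact_closure hc
  have hV := h.contDiffOn_one.sub hA.contDiffOn_one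
  rw [h.integral_mul_lap_add hΩ hc hconv hV fun x hx => by simp [h.eq_zero x hx, hA.eq_zero x hx]]
  have h1 := two_mul_integral_mul_le_add ((h.memLp hΩ hc).top_sub (hA.memLp hΩ hc)) h.memLp_forcing
  have h2 := integral_sq_sub_le (h.memLp hΩ hc) (hA.memLp hΩ hc)
  have h3 : -(2 * ∫ x in Ω, inner ℝ (gradient U x) (gradient (fun y => U y - A y) x))
      ≤ ∫ x in Ω, ‖gradient A x‖ ^ 2 := by
    rw [← integral_const_mul, ← integral_neg]
    refine setIntegral_mono_on ?_ ?_ hΩ.measurableSet fun x hx => ?_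
    · exact (((h.extendsToClosure_gradient hΩ hconv).inner
        (hV.extendsToClosure_gradient hΩ hconv)).memLp_top hΩ hc).top_integrable.const_mul 2 |>.neg
    · exact (((hA.extendsToClosure_gradient hΩ hconv).norm.pow 2).memLp_top hΩ hc).top_integrable
    · rw [gradient_sub_of_mem hΩ h.contDiffOn_one hA.contDiffOn_one hx, inner_sub_right,
        real_inner_self_eq_norm_sq]
      nlinarith [real_inner_le_norm (gradient U x) (gradient A x),
        sq_nonneg (‖gradient U x‖ - ‖gradient A x‖), sq_nonneg (‖gradient U x‖)]
  linarith [hA.gradient_le, h.forcing_le]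

theorem integral_sub_mul_le_forward (h : EnergyState Ω L U g) (hA : EnergyState Ω L A b)
    (hΩ : IsOpen Ω) (hc : IsCompact (closure Ω)) (hconv : Convex ℝ Ω) {r : ℝ} (hr : 0 < r) :
    2 * ∫ x in Ω, (U x - A x) * (lap U x + g x)
      ≤ (∫ x in Ω, (U x - A x) ^ 2) / (2 * r)
        + 6 * r * ((∫ x in Ω, (lap A x + b x) ^ 2)
          + L * (∫ x in Ω, U x ^ 2) + L * ∫ x in Ω, A x ^ 2) := by
  have := isFiniteMeasure_restrict_of_isCompact_closure hc
  have hV := h.contDiffOn_one.sub hA.contDiffOn_one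
  have hV0 : ∀ x ∈ frontier Ω, U x - A x = 0 := fun x hx => by simp [h.eq_zero x hx, hA.eq_zero x hx]
  have hVL := (h.memLp hΩ hc).top_sub (hA.memLp hΩ hc)
  have hA' := (hA.memLp_lap hΩ hc hconv).top_add hA.memLp_forcing
  have hf := (hA'.top_sub hA.memLp_forcing).top_add h.memLp_forcing
  have h1 : ∫ x in Ω, (U x - A x) * (lap U x + g x)
      ≤ ∫ x in Ω, (U x - A x) * (lap A x + b x - b x + g x) := by
    have e : ∀ x, (U x - A x) * (lap A x + b x - b x + g x)
      = (U x - A x) * (lap A x + b x) - (U x - A x) * b x + (U x - A x) * g x := fun x => by ring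
    simp only [e]
    rw [integral_add ((hVL.top_mul hA').top_sub (hVL.top_mul hA.memLp_forcing)).top_integrable
      (hVL.top_mul h.memLp_forcing).top_integrable,
      integral_sub (hVL.top_mul hA').top_integrable (hVL.top_mul hA.memLp_forcing).top_integrable,
      h.integral_mul_lap_add hΩ hc hconv hV hV0, hA.integral_mul_lap_add hΩ hc hconv hV hV0]
    have : ∫ x in Ω, inner ℝ (gradient A x) (gradient (fun y => U y - A y) x)
        ≤ ∫ x in Ω, inner ℝ (gradient U x) (gradient (fun y => U y - A y) x) := by
      refine setIntegral_mono_on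
        (((hA.extendsToClosure_gradient hΩ hconv).inner
          (hV.extendsToClosure_gradient hΩ hconv)).memLp_top hΩ hc).top_integrable
        (((h.extendsToClosure_gradient hΩ hconv).inner
          (hV.extendsToClosure_gradient hΩ hconv)).memLp_top hΩ hc).top_integrable
        hΩ.measurableSet fun x hx => ?_
      rw [← sub_nonneg, ← inner_sub_left,
        gradient_sub_of_mem hΩ h.contDiffOn_one hA.contDiffOn_one hx]
      exact real_inner_self_nonneg
    linarith
  have h2 := two_mul_integral_mul_le hVL hf hr
  have h3 : ∫ x in Ω, (lap A x + b x - b x + g x) ^ 2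
      ≤ 3 * ((∫ x in Ω, (lap A x + b x) ^ 2) + (∫ x in Ω, b x ^ 2) + ∫ x in Ω, g x ^ 2) := by
    have i1 := hA'.top_sq.top_integrable
    have i2 := hA.memLp_forcing.top_sq.top_integrable
    have i3 := h.memLp_forcing.top_sq.top_integrable
    have i12 := (hA'.top_sq.top_add hA.memLp_forcing.top_sq).top_integrable
    rw [← integral_add i1 i2, ← integral_add i12 i3, ← integral_const_mul]
    refine integral_mono hf.top_sq.top_integrable ((i12.add i3).const_mul 3) fun x => ?_
    change (lap A x + b x - b x + g x) ^ 2 ≤ 3 * ((lap A x + b x) ^ 2 + b x ^ 2 + g x ^ 2)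
    nlinarith [sq_nonneg (lap A x + b x + b x), sq_nonneg (lap A x + b x - g x),
      sq_nonneg (b x + g x)]
  have h4 := mul_le_mul_of_nonneg_left h3 (mul_pos two_pos hr).le
  have h5 := mul_le_mul_of_nonneg_left (add_le_add hA.forcing_le h.forcing_le) (mul_pos
    (by norm_num : (0 : ℝ) < 6) hr).le
  linarith

theorem integral_weight_sq_le (hA : EnergyState Ω L A b) (hΩ : IsOpen Ω)
    (hc : IsCompact (closure Ω)) (hconv : Convex ℝ Ω) {W : EuclideanSpace ℝ (Fin n) → ℝ} {C₁ : ℝ}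
    (hW : ContDiff ℝ 1 W) (hWC : ∀ x ∈ Ω, |W x| ≤ C₁) (hgW : ∀ x ∈ Ω, ‖gradient W x‖ ≤ C₁) :
    ∫ x in Ω, (W x * lap A x + inner ℝ (gradient A x) (gradient W x)) ^ 2
      ≤ 2 * C₁ ^ 2 * ((∫ x in Ω, lap A x ^ 2) + ∫ x in Ω, ‖gradient A x‖ ^ 2) := by
  have := isFiniteMeasure_restrict_of_isCompact_closure hc
  have hlap := hA.memLp_lap hΩ hc hconv
  have hgA := hA.extendsToClosure_gradient hΩ hconv
  have hgr := hgA.norm.memLp_top (μ := volume) hΩ hc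
  have hf := (((hW.continuous.extendsToClosure (Ω := Ω)).memLp_top (μ := volume) hΩ hc).top_mul
    hlap).top_add ((hgA.inner (hW.contDiffOn.extendsToClosure_gradient hΩ hconv)).memLp_top
      (μ := volume) hΩ hc)
  rw [← integral_add hlap.top_sq.top_integrable hgr.top_sq.top_integrable, ← integral_const_mul]
  refine setIntegral_mono_on hf.top_sq.top_integrable
    ((hlap.top_sq.top_add hgr.top_sq).top_integrable.const_mul _) hΩ.measurableSet fun x hx => ?_
  have h1 : |W x * lap A x + inner ℝ (gradient A x) (gradient W x)|
      ≤ C₁ * (|lap A x| + ‖gradient A x‖) := by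
    refine (abs_add_le _ _).trans ?_
    rw [abs_mul, mul_add]
    refine add_le_add (mul_le_mul_of_nonneg_right (hWC x hx) (abs_nonneg _))
      ((abs_real_inner_le_norm _ _).trans ?_)
    rw [mul_comm]
    exact mul_le_mul_of_nonneg_right (hgW x hx) (norm_nonneg _)
  have h2 := pow_le_pow_left₀ (abs_nonneg _) h1 2
  rw [sq_abs] at h2
  refine h2.trans ?_
  rw [mul_pow, ← sq_abs (lap A x)]
  nlinarith [mul_nonneg (sq_nonneg C₁) (sq_nonneg (|lap A x| - ‖gradient A x‖))]

/-- Lower bound for the decay of `U - A` in terms of the change of a weighted Dirichlet energy which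
is a controlled multiple of the weighted mass. -/
theorem neg_integral_sub_mul_le_backward (h : EnergyState Ω L U g) (hA : EnergyState Ω L A b)
    (hΩ : IsOpen Ω) (hc : IsCompact (closure Ω)) (hconv : Convex ℝ Ω)
    {W W₀ : EuclideanSpace ℝ (Fin n) → ℝ} {c C₁ C₂ P B d k k₀ : ℝ} (hc0 : 0 < c) (hC₁ : 0 ≤ C₁)
    (hd : 0 ≤ d) (hL : 0 ≤ L) (hW : ContDiff ℝ 1 W) (hW₀ : ContDiff ℝ 1 W₀)
    (hcW : ∀ x ∈ Ω, c ≤ W x) (hWC : ∀ x ∈ Ω, W x ≤ C₁) (hW₀C : ∀ x ∈ Ω, |W₀ x| ≤ C₁)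
    (hWW₀ : ∀ x ∈ Ω, |W x - W₀ x| ≤ C₁ * d)
    (hUP : ∫ x in Ω, U x ^ 2 ≤ P) (hAP : ∫ x in Ω, A x ^ 2 ≤ P)
    (hk : ∫ x in Ω, ‖gradient U x‖ ^ 2 * W x = k * ∫ x in Ω, U x ^ 2 * W x)
    (hk₀ : ∫ x in Ω, ‖gradient A x‖ ^ 2 * W₀ x = k₀ * ∫ x in Ω, A x ^ 2 * W₀ x)
    (hkC : |k| ≤ C₂) (hkk₀ : |k - k₀| ≤ C₂ * d)
    (hB : ∫ x in Ω, (W x * lap A x + inner ℝ (gradient A x) (gradient W x)) ^ 2 ≤ B)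
    (hB' : ∫ x in Ω, (lap A x + g x) ^ 2 ≤ B) :
    -(2 * ∫ x in Ω, (U x - A x) * (lap U x + g x))
      ≤ 2 / c * (2 * C₂ * C₁ * P + C₁ * L * P) * d
        + (2 / c * (2 * C₁ * C₂ * √P + 2 * √B) + 2 * √B) * √(∫ x in Ω, (U x - A x) ^ 2) := by
  have := isFiniteMeasure_restrict_of_isCompact_closure hc
  have hC₂ : 0 ≤ C₂ := (abs_nonneg _).trans hkC
  have hV := h.contDiffOn_one.sub hA.contDiffOn_one
  have hV0 : ∀ x ∈ frontier Ω, U x - A x = 0 := fun x hx => by simp [h.eq_zero x hx, hA.eq_zero x hx]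
  have hVL := (h.memLp hΩ hc).top_sub (hA.memLp hΩ hc)
  have hWe := hW.continuous.extendsToClosure (Ω := Ω)
  have hWL := hWe.memLp_top (μ := volume) hΩ hc
  have hW₀L := (hW₀.continuous.extendsToClosure (Ω := Ω)).memLp_top (μ := volume) hΩ hc
  have hgU := h.extendsToClosure_gradient hΩ hconv
  have hgA := hA.extendsToClosure_gradient hΩ hconv
  have hgV := hV.extendsToClosure_gradient hΩ hconv
  have hgW := hW.contDiffOn.extendsToClosure_gradient hΩ hconv
  have hgU2 := (hgU.norm.pow 2).memLp_top (μ := volume) hΩ hc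
  have hgA2 := (hgA.norm.pow 2).memLp_top (μ := volume) hΩ hc
  have hgV2 := (hgV.norm.pow 2).memLp_top (μ := volume) hΩ hc
  have hgAV := (hgA.inner hgV).memLp_top (μ := volume) hΩ hc
  have hlapA := hA.memLp_lap hΩ hc hconv
  have hf₁ := (hWL.top_mul hlapA).top_add ((hgA.inner hgW).memLp_top (μ := volume) hΩ hc)
  have hf₂ := hlapA.top_add h.memLp_forcing
  have hAsq := (hA.memLp hΩ hc).top_sq
  set S := ∫ x in Ω, (U x - A x) ^ 2 with hS
  have hP : 0 ≤ P := (integral_nonneg fun x => sq_nonneg (A x)).trans hAP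
  have e1 : ∫ x in Ω, inner ℝ (gradient U x) (gradient (fun y => U y - A y) x)
      = (∫ x in Ω, ‖gradient (fun y => U y - A y) x‖ ^ 2)
        + ∫ x in Ω, inner ℝ (gradient A x) (gradient (fun y => U y - A y) x) := by
    rw [← integral_add hgV2.top_integrable hgAV.top_integrable]
    refine setIntegral_congr_fun hΩ.measurableSet fun x hx => ?_
    simp only [← real_inner_self_eq_norm_sq, ← inner_add_left]
    rw [gradient_sub_of_mem hΩ h.contDiffOn_one hA.contDiffOn_one hx, sub_add_cancel]
  have e2 : ∫ x in Ω, (U x - A x) * (lap A x + g x)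
      = (∫ x in Ω, (U x - A x) * lap A x) + ∫ x in Ω, (U x - A x) * g x := by
    simp only [mul_add]
    exact integral_add (hVL.top_mul hlapA).top_integrable
      (hVL.top_mul h.memLp_forcing).top_integrable
  have e3 := h.integral_mul_lap_add hΩ hc hconv hV hV0
  have e4 := setIntegral_mul_lap hΩ hc hconv hA.contDiffOn hV hV0
  have e5 : ∫ x in Ω, ‖gradient (fun y => U y - A y) x‖ ^ 2 * W x
      = (∫ x in Ω, ‖gradient U x‖ ^ 2 * W x) - (∫ x in Ω, ‖gradient A x‖ ^ 2 * W x)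
        - 2 * ∫ x in Ω, W x * inner ℝ (gradient A x) (gradient (fun y => U y - A y) x) := by
    rw [← integral_const_mul, ← integral_sub (hgU2.top_mul hWL).top_integrable
      (hgA2.top_mul hWL).top_integrable, ← integral_sub
      ((hgU2.top_mul hWL).top_sub (hgA2.top_mul hWL)).top_integrable
      ((hWL.top_mul hgAV).top_integrable.const_mul 2)]
    refine setIntegral_congr_fun hΩ.measurableSet fun x hx => ?_
    simp only [gradient_sub_of_mem hΩ h.contDiffOn_one hA.contDiffOn_one hx, inner_sub_right,
      norm_sub_sq_real, real_inner_self_eq_norm_sq, real_inner_comm (gradient U x)]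
    ring
  rw [setIntegral_mul_inner_gradient hΩ hc hconv hA.contDiffOn hV hV0 hW] at e5
  have i1 : c * ∫ x in Ω, ‖gradient (fun y => U y - A y) x‖ ^ 2
      ≤ ∫ x in Ω, ‖gradient (fun y => U y - A y) x‖ ^ 2 * W x := by
    rw [← integral_const_mul]
    refine setIntegral_mono_on (hgV2.top_integrable.const_mul c) (hgV2.top_mul hWL).top_integrable
      hΩ.measurableSet fun x hx => ?_
    rw [mul_comm]
    exact mul_le_mul_of_nonneg_left (hcW x hx) (sq_nonneg _)
  have i2 : (∫ x in Ω, ‖gradient A x‖ ^ 2 * W₀ x) - (∫ x in Ω, ‖gradient A x‖ ^ 2 * W x)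
      ≤ C₁ * d * (L * P) := by
    calc _ = ∫ x in Ω, (‖gradient A x‖ ^ 2 * W₀ x - ‖gradient A x‖ ^ 2 * W x) :=
          (integral_sub (hgA2.top_mul hW₀L).top_integrable (hgA2.top_mul hWL).top_integrable).symm
      _ ≤ ∫ x in Ω, C₁ * d * ‖gradient A x‖ ^ 2 := by
        refine setIntegral_mono_on
          ((hgA2.top_mul hW₀L).top_sub (hgA2.top_mul hWL)).top_integrable
          (hgA2.top_integrable.const_mul _) hΩ.measurableSet fun x hx => ?_
        rw [← mul_sub, mul_comm]
        refine mul_le_mul_of_nonneg_right ?_ (sq_nonneg _)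
        rw [← neg_sub]
        exact (neg_le_abs _).trans (hWW₀ x hx)
      _ ≤ C₁ * d * (L * P) := by
        rw [integral_const_mul]
        exact mul_le_mul_of_nonneg_left
          (hA.gradient_le.trans (mul_le_mul_of_nonneg_left hAP hL)) (by positivity)
  have hUA : MemLp (fun x => (U x + A x) * W x) ⊤ (volume.restrict Ω) :=
    ((h.memLp hΩ hc).top_add (hA.memLp hΩ hc)).top_mul hWL
  have i3 : |(∫ x in Ω, U x ^ 2 * W x) - ∫ x in Ω, A x ^ 2 * W₀ x|
      ≤ 2 * C₁ * √P * √S + C₁ * d * P := by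
    have e : (∫ x in Ω, U x ^ 2 * W x) - ∫ x in Ω, A x ^ 2 * W₀ x
        = (∫ x in Ω, (U x - A x) * ((U x + A x) * W x)) + ∫ x in Ω, A x ^ 2 * (W x - W₀ x) := by
      rw [← integral_sub ((h.memLp hΩ hc).top_sq.top_mul hWL).top_integrable
        (hAsq.top_mul hW₀L).top_integrable, ← integral_add (hVL.top_mul hUA).top_integrable
        (hAsq.top_mul (hWL.top_sub hW₀L)).top_integrable]
      congr 1 with x
      ring
    rw [e]
    refine (abs_add_le _ _).trans (add_le_add ?_ ?_)
    · refine (abs_integral_mul_le hVL hUA).trans ?_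
      have hle : ∫ x in Ω, ((U x + A x) * W x) ^ 2 ≤ (2 * C₁) ^ 2 * P := by
        calc _ ≤ ∫ x in Ω, (2 * C₁ ^ 2) * (U x ^ 2 + A x ^ 2) := by
              refine setIntegral_mono_on hUA.top_sq.top_integrable
                (((h.memLp hΩ hc).top_sq.top_add hAsq).top_integrable.const_mul _)
                hΩ.measurableSet fun x hx => ?_
              have hWsq : W x ^ 2 ≤ C₁ ^ 2 :=
                pow_le_pow_left₀ (hc0.le.trans (hcW x hx)) (hWC x hx) 2
              rw [mul_pow]
              nlinarith [mul_nonneg (sq_nonneg (U x - A x)) (sq_nonneg C₁),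
                mul_le_mul_of_nonneg_left hWsq (sq_nonneg (U x + A x))]
          _ = (2 * C₁ ^ 2) * ((∫ x in Ω, U x ^ 2) + ∫ x in Ω, A x ^ 2) := by
              rw [integral_const_mul, integral_add (h.memLp hΩ hc).top_sq.top_integrable
                hAsq.top_integrable]
          _ ≤ _ := by nlinarith [sq_nonneg C₁]
      calc √S * √(∫ x in Ω, ((U x + A x) * W x) ^ 2) ≤ √S * √((2 * C₁) ^ 2 * P) := by gcongr
        _ = 2 * C₁ * √P * √S := by
          rw [Real.sqrt_mul (by positivity), Real.sqrt_sq (by positivity)]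
          ring
    · calc |∫ x in Ω, A x ^ 2 * (W x - W₀ x)| ≤ ∫ x in Ω, |A x ^ 2 * (W x - W₀ x)| :=
            abs_integral_le_integral_abs
        _ ≤ ∫ x in Ω, C₁ * d * A x ^ 2 := by
          refine setIntegral_mono_on (hAsq.top_mul (hWL.top_sub hW₀L)).top_integrable.abs
            (hAsq.top_integrable.const_mul _) hΩ.measurableSet fun x hx => ?_
          rw [abs_mul, abs_of_nonneg (sq_nonneg (A x)), mul_comm]
          exact mul_le_mul_of_nonneg_right (hWW₀ x hx) (sq_nonneg _)
        _ ≤ C₁ * d * P := by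
          rw [integral_const_mul]
          exact mul_le_mul_of_nonneg_left hAP (by positivity)
  have i4 : |∫ x in Ω, A x ^ 2 * W₀ x| ≤ C₁ * P := by
    calc |∫ x in Ω, A x ^ 2 * W₀ x| ≤ ∫ x in Ω, |A x ^ 2 * W₀ x| := abs_integral_le_integral_abs
      _ ≤ ∫ x in Ω, C₁ * A x ^ 2 := by
        refine setIntegral_mono_on (hAsq.top_mul hW₀L).top_integrable.abs
          (hAsq.top_integrable.const_mul _) hΩ.measurableSet fun x hx => ?_
        rw [abs_mul, abs_of_nonneg (sq_nonneg (A x)), mul_comm]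
        exact mul_le_mul_of_nonneg_right (hW₀C x hx) (sq_nonneg _)
      _ ≤ C₁ * P := by
        rw [integral_const_mul]
        exact mul_le_mul_of_nonneg_left hAP hC₁
  have i5 : (∫ x in Ω, ‖gradient U x‖ ^ 2 * W x) - (∫ x in Ω, ‖gradient A x‖ ^ 2 * W₀ x)
      ≤ C₂ * (2 * C₁ * √P * √S + C₁ * d * P) + C₂ * d * (C₁ * P) := by
    have e : (∫ x in Ω, ‖gradient U x‖ ^ 2 * W x) - (∫ x in Ω, ‖gradient A x‖ ^ 2 * W₀ x)
        = k * ((∫ x in Ω, U x ^ 2 * W x) - ∫ x in Ω, A x ^ 2 * W₀ x)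
          + (k - k₀) * ∫ x in Ω, A x ^ 2 * W₀ x := by
      rw [hk, hk₀]
      ring
    rw [e]
    refine (le_abs_self _).trans ((abs_add_le _ _).trans (add_le_add ?_ ?_))
    · rw [abs_mul]
      gcongr
    · rw [abs_mul]
      gcongr
  have i6 : ∫ x in Ω, (U x - A x) * (W x * lap A x + inner ℝ (gradient A x) (gradient W x))
      ≤ √S * √B :=
    (le_abs_self _).trans ((abs_integral_mul_le hVL hf₁).trans (by gcongr))
  have i7 : -∫ x in Ω, (U x - A x) * (lap A x + g x) ≤ √S * √B :=
    (neg_le_abs _).trans ((abs_integral_mul_le hVL hf₂).trans (by gcongr))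
  have i8 : ∫ x in Ω, ‖gradient (fun y => U y - A y) x‖ ^ 2
      ≤ (C₂ * (2 * C₁ * √P * √S + C₁ * d * P) + C₂ * d * (C₁ * P) + C₁ * d * (L * P)
        + 2 * (√S * √B)) / c := by
    rw [le_div_iff₀' hc0]
    linarith
  have e6 : 2 / c * (2 * C₂ * C₁ * P + C₁ * L * P) * d
        + (2 / c * (2 * C₁ * C₂ * √P + 2 * √B) + 2 * √B) * √S
      = 2 * ((C₂ * (2 * C₁ * √P * √S + C₁ * d * P) + C₂ * d * (C₁ * P) + C₁ * d * (L * P)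
        + 2 * (√S * √B)) / c) + 2 * (√S * √B) := by
    field_simp
    ring
  rw [e6]
  linarith

end EnergyState

end EnergyState

/-! ### Solutions of the parabolic differential inequality -/

section ParabolicSolution

variable {n : ℕ}

/-- Classical solutions, on a bounded convex domain, of the parabolic differential inequality with
homogeneous Dirichlet boundary values. -/
structure IsParabolicSolution (Ω : Set (EuclideanSpace ℝ (Fin n))) (T M : ℝ)
    (u : EuclideanSpace ℝ (Fin n) → ℝ → ℝ) : Prop where
  isOpen : IsOpen Ω
  isCompact_closure : IsCompact (closure Ω)
  convex : Convex ℝ Ω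
  contDiffOn_space : ∀ t ∈ Icc (0 : ℝ) T, ContDiffOn ℝ 2 (fun x => u x t) (closure Ω)
  contDiffOn_time : ∀ x ∈ closure Ω, ContDiffOn ℝ 1 (fun s => u x s) (Icc (0 : ℝ) T)
  eq_zero : ∀ x ∈ frontier Ω, ∀ t ∈ Icc (0 : ℝ) T, u x t = 0
  abs_sub_le : ∀ x ∈ Ω, ∀ t ∈ Ioc (0 : ℝ) T,
    |deriv (fun s => u x s) t - lap (fun y => u y t) x|
      ≤ M * (‖gradient (fun y => u y t) x‖ + |u x t|)

/-- The extension by zero of the time slices of `u`. -/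
noncomputable def zeroExt (Ω : Set (EuclideanSpace ℝ (Fin n)))
    (u : EuclideanSpace ℝ (Fin n) → ℝ → ℝ) (t : ℝ) : EuclideanSpace ℝ (Fin n) → ℝ :=
  Ω.indicator fun x => u x t

/-- The extension by zero of the time derivative of `u`. -/
noncomputable def zeroExtDeriv (Ω : Set (EuclideanSpace ℝ (Fin n)))
    (u : EuclideanSpace ℝ (Fin n) → ℝ → ℝ) (t : ℝ) : EuclideanSpace ℝ (Fin n) → ℝ :=
  Ω.indicator fun x => deriv (fun s => u x s) t

/-- The difference between the time derivative and the Laplacian. -/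
noncomputable def forcing (u : EuclideanSpace ℝ (Fin n) → ℝ → ℝ) (t : ℝ)
    (x : EuclideanSpace ℝ (Fin n)) : ℝ :=
  deriv (fun s => u x s) t - lap (fun y => u y t) x

theorem lap_add_forcing (u : EuclideanSpace ℝ (Fin n) → ℝ → ℝ) (t : ℝ)
    (x : EuclideanSpace ℝ (Fin n)) :
    lap (fun y => u y t) x + forcing u t x = deriv (fun s => u x s) t := by
  simp [forcing]

namespace IsParabolicSolution

variable {Ω : Set (EuclideanSpace ℝ (Fin n))} {T M L t : ℝ}
  {u : EuclideanSpace ℝ (Fin n) → ℝ → ℝ}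

theorem hasDerivAt (h : IsParabolicSolution Ω T M u) (ht : t ∈ Ioo 0 T)
    {x : EuclideanSpace ℝ (Fin n)} (hx : x ∈ Ω) :
    HasDerivAt (fun s => u x s) (deriv (fun s => u x s) t) t :=
  ((((h.contDiffOn_time x (subset_closure hx)).differentiableOn one_ne_zero) t
    (Ioo_subset_Icc_self ht)).differentiableAt (Icc_mem_nhds ht.1 ht.2)).hasDerivAt

theorem continuousOn_deriv (h : IsParabolicSolution Ω T M u)
    {x : EuclideanSpace ℝ (Fin n)} (hx : x ∈ Ω) :
    ContinuousOn (deriv fun s => u x s) (Ioo 0 T) :=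
  ((h.contDiffOn_time x (subset_closure hx)).mono Ioo_subset_Icc_self).continuousOn_deriv_of_isOpen
    isOpen_Ioo le_rfl

theorem hasDerivAt_zeroExt (h : IsParabolicSolution Ω T M u) (ht : t ∈ Ioo 0 T)
    (x : EuclideanSpace ℝ (Fin n)) :
    HasDerivAt (fun s => zeroExt Ω u s x) (zeroExtDeriv Ω u t x) t := by
  by_cases hx : x ∈ Ω
  · simpa [zeroExt, zeroExtDeriv, hx] using h.hasDerivAt ht hx
  · simpa [zeroExt, zeroExtDeriv, hx] using hasDerivAt_const t (0 : ℝ)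

theorem continuousOn_zeroExtDeriv (h : IsParabolicSolution Ω T M u)
    (x : EuclideanSpace ℝ (Fin n)) :
    ContinuousOn (fun s => zeroExtDeriv Ω u s x) (Ioo 0 T) := by
  by_cases hx : x ∈ Ω
  · simpa [zeroExtDeriv, hx] using h.continuousOn_deriv hx
  · simpa [zeroExtDeriv, hx] using continuousOn_const

theorem measurable_zeroExt (h : IsParabolicSolution Ω T M u) (ht : t ∈ Icc 0 T) :
    Measurable (zeroExt Ω u t) := by
  classical
  rw [zeroExt, ← piecewise_eq_indicator]
  exact ((h.contDiffOn_space t ht).continuousOn.mono subset_closure).measurable_piecewise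
    continuousOn_const h.isOpen.measurableSet

theorem measurable_zeroExtDeriv (h : IsParabolicSolution Ω T M u) (ht : t ∈ Ioo 0 T) :
    Measurable (zeroExtDeriv Ω u t) := by
  have hT : ∀ᶠ k : ℕ in atTop, t + 1 / ((k : ℝ) + 1) ∈ Icc 0 T := by
    have : Tendsto (fun k : ℕ => t + 1 / ((k : ℝ) + 1)) atTop (𝓝 (t + 0)) :=
      tendsto_const_nhds.add tendsto_one_div_add_atTop_nhds_zero_nat
    rw [add_zero] at this
    exact this (Icc_mem_nhds ht.1 ht.2)
  obtain ⟨k₀, hk₀⟩ := eventually_atTop.1 hT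
  refine measurable_of_tendsto_metrizable (f := fun k : ℕ => fun x =>
    (1 / (((k + k₀ : ℕ) : ℝ) + 1))⁻¹ *
      (zeroExt Ω u (t + 1 / (((k + k₀ : ℕ) : ℝ) + 1)) x - zeroExt Ω u t x)) (fun k => ?_) ?_
  · exact ((h.measurable_zeroExt (hk₀ _ (by omega))).sub
      (h.measurable_zeroExt (Ioo_subset_Icc_self ht))).const_mul _
  · refine tendsto_pi_nhds.2 fun x => ?_
    have := (h.hasDerivAt_zeroExt ht x).tendsto_slope_zero_right
    have h0 : Tendsto (fun k : ℕ => 1 / (((k + k₀ : ℕ) : ℝ) + 1)) atTop (𝓝[>] 0) :=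
      tendsto_nhdsWithin_iff.2 ⟨tendsto_one_div_add_atTop_nhds_zero_nat.comp
        (tendsto_add_atTop_nat k₀), .of_forall fun k => by
          have : 0 < 1 / (((k + k₀ : ℕ) : ℝ) + 1) := by positivity
          exact this⟩
    exact this.comp h0

theorem exists_abs_deriv_le (h : IsParabolicSolution Ω T M u) (ht : t ∈ Ioo 0 T) :
    ∃ C, ∀ x, |zeroExtDeriv Ω u t x| ≤ C := by
  have hu := h.contDiffOn_space t (Ioo_subset_Icc_self ht)
  obtain ⟨C₁, h₁, hC₁⟩ := (hu.extendsToClosure_lap h.isOpen h.convex).exists_abs_le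
    h.isCompact_closure
  obtain ⟨C₂, h₂, hC₂⟩ := ((hu.of_le (by norm_num)).extendsToClosure_gradient h.isOpen
    h.convex).exists_norm_le h.isCompact_closure
  obtain ⟨C₃, h₃, hC₃⟩ := hu.continuousOn.extendsToClosure.exists_abs_le h.isCompact_closure
  refine ⟨C₁ + |M| * (C₂ + C₃), fun x => ?_⟩
  by_cases hx : x ∈ Ω
  · rw [zeroExtDeriv, indicator_of_mem hx]
    have e := h.abs_sub_le x hx t (Ioo_subset_Ioc_self ht)
    calc |deriv (fun s => u x s) t|
        ≤ |lap (fun y => u y t) x| + |deriv (fun s => u x s) t - lap (fun y => u y t) x| := by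
          have := abs_add_le (lap (fun y => u y t) x)
            (deriv (fun s => u x s) t - lap (fun y => u y t) x)
          rwa [add_sub_cancel] at this
      _ ≤ C₁ + |M| * (C₂ + C₃) := by
          refine add_le_add (hC₁ x hx) (e.trans ?_)
          refine (mul_le_mul_of_nonneg_right (le_abs_self M) (by positivity)).trans ?_
          gcongr
          exacts [hC₂ x hx, hC₃ x hx]
  · rw [zeroExtDeriv, indicator_of_notMem hx, abs_zero]
    positivity

theorem exists_abs_le (h : IsParabolicSolution Ω T M u) (ht : t ∈ Icc 0 T) :
    ∃ C, ∀ x, |zeroExt Ω u t x| ≤ C := by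
  obtain ⟨C, hC, hCx⟩ := (h.contDiffOn_space t ht).continuousOn.extendsToClosure.exists_abs_le
    h.isCompact_closure
  refine ⟨C, fun x => ?_⟩
  by_cases hx : x ∈ Ω
  · simpa [zeroExt, hx] using hCx x hx
  · simpa [zeroExt, hx] using hC

theorem memLp_deriv (h : IsParabolicSolution Ω T M u) (ht : t ∈ Ioo 0 T) :
    MemLp (fun x => deriv (fun s => u x s) t) ⊤ (volume.restrict Ω) := by
  obtain ⟨C, hC⟩ := h.exists_abs_deriv_le ht
  have hL : MemLp (zeroExtDeriv Ω u t) ⊤ (volume.restrict Ω) :=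
    memLp_top_of_bound (h.measurable_zeroExtDeriv ht).aestronglyMeasurable C (.of_forall hC)
  refine (memLp_congr_ae ?_).1 hL
  filter_upwards [ae_restrict_mem h.isOpen.measurableSet] with x hx
  simp [zeroExtDeriv, hx]

theorem memLp_forcing (h : IsParabolicSolution Ω T M u) (ht : t ∈ Ioo 0 T) :
    MemLp (forcing u t) ⊤ (volume.restrict Ω) :=
  (h.memLp_deriv ht).top_sub (((h.contDiffOn_space t
    (Ioo_subset_Icc_self ht)).extendsToClosure_lap h.isOpen h.convex).memLp_top h.isOpen
      h.isCompact_closure)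

theorem forcing_sq_le (h : IsParabolicSolution Ω T M u) (ht : t ∈ Ioo 0 T)
    {x : EuclideanSpace ℝ (Fin n)} (hx : x ∈ Ω) :
    forcing u t x ^ 2 ≤ 2 * M ^ 2 * (‖gradient (fun y => u y t) x‖ ^ 2 + u x t ^ 2) := by
  have h1 := h.abs_sub_le x hx t (Ioo_subset_Ioc_self ht)
  have h2 := pow_le_pow_left₀ (abs_nonneg _) h1 2
  rw [sq_abs] at h2
  refine h2.trans ?_
  rw [mul_pow, ← sq_abs (u x t)]
  nlinarith [mul_nonneg (sq_nonneg M) (sq_nonneg (‖gradient (fun y => u y t) x‖ - |u x t|))]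

theorem energyState (h : IsParabolicSolution Ω T M u) (ht : t ∈ Ioo 0 T) (hL : 0 ≤ L)
    (hgrad : ∫ x in Ω, ‖gradient (fun y => u y t) x‖ ^ 2 ≤ L * ∫ x in Ω, u x t ^ 2) :
    EnergyState Ω (L + 2 * M ^ 2 * (L + 1)) (fun x => u x t) (forcing u t) := by
  have := isFiniteMeasure_restrict_of_isCompact_closure h.isCompact_closure
  have hu := h.contDiffOn_space t (Ioo_subset_Icc_self ht)
  have hP : 0 ≤ ∫ x in Ω, u x t ^ 2 := integral_nonneg fun x => sq_nonneg _
  have i1 := ((((hu.of_le (by norm_num)).extendsToClosure_gradient h.isOpen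
    h.convex).norm.pow 2).memLp_top (μ := volume) h.isOpen h.isCompact_closure).top_integrable
  have i2 := (hu.continuousOn.extendsToClosure.memLp_top (μ := volume) h.isOpen
    h.isCompact_closure).top_sq.top_integrable
  refine ⟨hu, fun x hx => h.eq_zero x hx t (Ioo_subset_Icc_self ht), h.memLp_forcing ht,
    hgrad.trans (mul_le_mul_of_nonneg_right (by nlinarith [sq_nonneg M]) hP), ?_⟩
  have h1 : ∫ x in Ω, forcing u t x ^ 2 ≤ 2 * M ^ 2 *
      ((∫ x in Ω, ‖gradient (fun y => u y t) x‖ ^ 2) + ∫ x in Ω, u x t ^ 2) := by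
    rw [← integral_add i1 i2, ← integral_const_mul]
    exact setIntegral_mono_on (h.memLp_forcing ht).top_sq.top_integrable
      ((i1.add i2).const_mul _) h.isOpen.measurableSet fun x hx => h.forcing_sq_le ht hx
  nlinarith [mul_nonneg hL hP, mul_le_mul_of_nonneg_left hgrad (sq_nonneg M)]

end IsParabolicSolution

end ParabolicSolution

section ParabolicFlow

variable {n : ℕ} {Ω : Set (EuclideanSpace ℝ (Fin n))} {T M L lam α β : ℝ}
  {u : EuclideanSpace ℝ (Fin n) → ℝ → ℝ} {x₀ : EuclideanSpace ℝ (Fin n)}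

theorem setIntegral_zeroExt_sq (hΩ : MeasurableSet Ω) (t : ℝ) :
    ∫ x in Ω, zeroExt Ω u t x ^ 2 = ∫ x in Ω, u x t ^ 2 :=
  setIntegral_congr_fun hΩ fun x hx => by simp [zeroExt, hx]

theorem sqDist_zeroExt (hΩ : MeasurableSet Ω) (s t : ℝ) :
    sqDist (volume.restrict Ω) (zeroExt Ω u s) (zeroExt Ω u t)
      = ∫ x in Ω, (u x s - u x t) ^ 2 :=
  setIntegral_congr_fun hΩ fun x hx => by simp [zeroExt, hx]

theorem setIntegral_zeroExt_sub_mul (hΩ : MeasurableSet Ω) (s t : ℝ) :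
    ∫ x in Ω, (zeroExt Ω u s x - zeroExt Ω u t x) * zeroExtDeriv Ω u s x
      = ∫ x in Ω, (u x s - u x t) * (lap (fun y => u y s) x + forcing u s x) :=
  setIntegral_congr_fun hΩ fun x hx => by
    simp [zeroExt, zeroExtDeriv, lap_add_forcing, hx]

namespace IsParabolicSolution

theorem energyFlow (h : IsParabolicSolution Ω T M u) (hI : Icc α β ⊆ Ioo 0 T) (hL : 0 ≤ L)
    (hst : ∀ t ∈ Icc α β, EnergyState Ω L (fun x => u x t) (forcing u t)) :
    EnergyFlow (volume.restrict Ω) (zeroExt Ω u) (zeroExtDeriv Ω u) α β (6 * (L + 1)) := by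
  have hΩ := h.isOpen
  have hm := h.isOpen.measurableSet
  have hc := h.isCompact_closure
  have hconv := h.convex
  have hP : ∀ t, 0 ≤ ∫ x in Ω, u x t ^ 2 := fun t => integral_nonneg fun x => sq_nonneg _
  refine
    { measurable := fun t ht => h.measurable_zeroExt (Ioo_subset_Icc_self (hI ht))
      measurable_deriv := fun t ht => h.measurable_zeroExtDeriv (hI ht)
      bounded := fun t ht => h.exists_abs_le (Ioo_subset_Icc_self (hI ht))
      bounded_deriv := fun t ht => h.exists_abs_deriv_le (hI ht)
      hasDerivAt := fun t ht x => h.hasDerivAt_zeroExt (hI ht) x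
      continuousOn_deriv := fun x => (h.continuousOn_zeroExtDeriv x).mono hI
      nonneg := by positivity
      growth := fun t ht => ?_
      holder := fun t ht a ha => ?_
      forward := fun t ht a ha r hr => ?_ }
  · have e : ∫ x in Ω, zeroExt Ω u t x * zeroExtDeriv Ω u t x
        = ∫ x in Ω, u x t * (lap (fun y => u y t) x + forcing u t x) :=
      setIntegral_congr_fun hm fun x hx => by
        simp [zeroExt, zeroExtDeriv, lap_add_forcing, hx]
    rw [e, setIntegral_zeroExt_sq hm]
    refine ((hst t ht).growth hΩ hc hconv).trans ?_
    nlinarith [hP t, mul_nonneg hL (hP t)]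
  · rw [setIntegral_zeroExt_sub_mul hm, setIntegral_zeroExt_sq hm, setIntegral_zeroExt_sq hm]
    refine ((hst t ht).integral_sub_mul_le (hst a ha) hΩ hc hconv).trans ?_
    nlinarith [hP t, hP a, mul_nonneg hL (hP t), mul_nonneg hL (hP a)]
  · have e : ∫ x in Ω, zeroExtDeriv Ω u a x ^ 2
        = ∫ x in Ω, (lap (fun y => u y a) x + forcing u a x) ^ 2 :=
      setIntegral_congr_fun hm fun x hx => by simp [zeroExtDeriv, lap_add_forcing, hx]
    rw [setIntegral_zeroExt_sub_mul hm, setIntegral_zeroExt_sq hm, setIntegral_zeroExt_sq hm, e,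
      sqDist_zeroExt hm]
    refine ((hst t ht).integral_sub_mul_le_forward (hst a ha) hΩ hc hconv hr).trans ?_
    have hQ : 0 ≤ ∫ x in Ω, (lap (fun y => u y a) x + forcing u a x) ^ 2 :=
      integral_nonneg fun x => sq_nonneg _
    rw [add_le_add_iff_left, mul_comm 6 r, mul_assoc]
    refine mul_le_mul_of_nonneg_left ?_ hr.le
    nlinarith [hP t, hP a, mul_nonneg hL (hP t), mul_nonneg hL (hP a), mul_nonneg hL hQ]

/-- Where the frequency is differentiable, nearby time slices form an energy flow which is Lipschitz
continuous in mean square backward in time. -/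
theorem exists_energyFlow_of_hasDerivAt (h : IsParabolicSolution Ω T M u) (hlam : 0 < lam)
    {t₀ k' : ℝ} (ht₀ : t₀ ∈ Ioo 0 T) (hH : ∀ t ∈ Ioo 0 T, 0 < Hfun Ω T lam x₀ u t)
    (hk : HasDerivAt (fun s => Dfun Ω T lam x₀ u s / Hfun Ω T lam x₀ u s) k' t₀) :
    ∃ α β K C, t₀ ∈ Ioo α β ∧ Icc α β ⊆ Ioo 0 T ∧
      EnergyFlow (volume.restrict Ω) (zeroExt Ω u) (zeroExtDeriv Ω u) α β K ∧
      ∀ z ∈ Ioo α t₀, sqDist (volume.restrict Ω) (zeroExt Ω u z) (zeroExt Ω u t₀)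
        ≤ C * (z - t₀) ^ 2 := by
  have hΩ := h.isOpen
  have hm := h.isOpen.measurableSet
  have hc := h.isCompact_closure
  have hconv := h.convex
  have := isFiniteMeasure_restrict_of_isCompact_closure hc
  set k : ℝ → ℝ := fun s => Dfun Ω T lam x₀ u s / Hfun Ω T lam x₀ u s with hkdef
  obtain ⟨c, hc0, C₁, hC₁, hG⟩ := exists_caloric_bounds (T := T) (x₀ := x₀) hc hlam
  obtain ⟨Ck, hCk⟩ := hk.isBigO_sub.bound
  obtain ⟨ε, hε, hball⟩ := Metric.mem_nhds_iff.1 (Filter.inter_mem hCk (Ioo_mem_nhds ht₀.1 ht₀.2))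
  have hIball : Icc (t₀ - ε / 2) (t₀ + ε / 2) ⊆ Metric.ball t₀ ε := fun s hs => by
    rw [Metric.mem_ball, Real.dist_eq, abs_lt]
    constructor <;> linarith [hs.1, hs.2]
  have hI : Icc (t₀ - ε / 2) (t₀ + ε / 2) ⊆ Ioo 0 T := fun s hs => (hball (hIball hs)).2
  have ht₀I : t₀ ∈ Icc (t₀ - ε / 2) (t₀ + ε / 2) := ⟨by linarith, by linarith⟩
  set C₂ := |k t₀| + |Ck| * (ε + 1) with hC₂
  have hkk : ∀ s ∈ Icc (t₀ - ε / 2) (t₀ + ε / 2), |k s - k t₀| ≤ |Ck| * |s - t₀| := fun s hs =>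
    (hball (hIball hs)).1.trans (mul_le_mul_of_nonneg_right (le_abs_self _) (abs_nonneg _))
  have hkk₀ : ∀ s ∈ Icc (t₀ - ε / 2) (t₀ + ε / 2), |k s - k t₀| ≤ C₂ * |s - t₀| := fun s hs =>
    (hkk s hs).trans (mul_le_mul_of_nonneg_right
      (by nlinarith [abs_nonneg (k t₀), abs_nonneg Ck]) (abs_nonneg _))
  have hkC : ∀ s ∈ Icc (t₀ - ε / 2) (t₀ + ε / 2), |k s| ≤ C₂ := fun s hs => by
    have h1 : |s - t₀| ≤ ε := by
      rw [abs_le]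
      constructor <;> linarith [hs.1, hs.2]
    have h2 := abs_add_le (k t₀) (k s - k t₀)
    rw [add_sub_cancel] at h2
    nlinarith [hkk s hs, mul_le_mul_of_nonneg_left h1 (abs_nonneg Ck), abs_nonneg Ck]
  have hC₂0 : 0 ≤ C₂ := by positivity
  have hDk : ∀ t ∈ Ioo 0 T, ∫ x in Ω, ‖gradient (fun y => u y t) x‖ ^ 2 * caloric T lam x₀ x t
      = k t * ∫ x in Ω, u x t ^ 2 * caloric T lam x₀ x t := fun t ht =>
    (div_mul_cancel₀ _ (hH t ht).ne').symm
  have hgrad : ∀ t ∈ Icc (t₀ - ε / 2) (t₀ + ε / 2),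
      ∫ x in Ω, ‖gradient (fun y => u y t) x‖ ^ 2 ≤ C₂ * C₁ / c * ∫ x in Ω, u x t ^ 2 := by
    intro t ht
    have htT := Ioo_subset_Icc_self (hI ht)
    exact setIntegral_gradient_sq_le_of_weight hΩ hc hconv (h.contDiffOn_space t htT)
      contDiff_caloric.continuous hc0 hC₂0 (fun x hx => (hG t htT x hx).1)
      (fun x hx => (hG t htT x hx).2.1) (hDk t (hI ht)) ((le_abs_self _).trans (hkC t ht))
  set L := C₂ * C₁ / c + 2 * M ^ 2 * (C₂ * C₁ / c + 1) with hL
  have hL0 : 0 ≤ L := by positivity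
  have hst : ∀ t ∈ Icc (t₀ - ε / 2) (t₀ + ε / 2),
      EnergyState Ω L (fun x => u x t) (forcing u t) := fun t ht =>
    h.energyState (hI ht) (by positivity) (hgrad t ht)
  have hflow := h.energyFlow hI hL0 hst
  set P := exp (6 * (L + 1) * (t₀ + ε / 2 - (t₀ - ε / 2))) * ∫ x in Ω, u x t₀ ^ 2 with hP
  have hP0 : 0 ≤ P := mul_nonneg (exp_pos _).le (integral_nonneg fun x => sq_nonneg _)
  have hPs : ∀ s ∈ Icc (t₀ - ε / 2) (t₀ + ε / 2), ∫ x in Ω, u x s ^ 2 ≤ P := fun s hs => by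
    have := hflow.integral_sq_le_of_regular le_rfl (by linarith) le_rfl hflow.meanSquareRegularAt
      hs ht₀I
    rwa [setIntegral_zeroExt_sq hm, setIntegral_zeroExt_sq hm] at this
  have hst₀ := hst t₀ ht₀I
  have hlap := hst₀.memLp_lap hΩ hc hconv
  set B := 2 * C₁ ^ 2 * ((∫ x in Ω, lap (fun y => u y t₀) x ^ 2)
    + ∫ x in Ω, ‖gradient (fun y => u y t₀) x‖ ^ 2)
    + (2 * (∫ x in Ω, lap (fun y => u y t₀) x ^ 2) + 2 * (L * P)) with hB
  have hlap0 : 0 ≤ ∫ x in Ω, lap (fun y => u y t₀) x ^ 2 := integral_nonneg fun x => sq_nonneg _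
  have hgr0 : 0 ≤ ∫ x in Ω, ‖gradient (fun y => u y t₀) x‖ ^ 2 :=
    integral_nonneg fun x => sq_nonneg _
  set c₃ := 2 / c * (2 * C₂ * C₁ * P + C₁ * L * P) with hc₃
  set c₄ := 2 / c * (2 * C₁ * C₂ * √P + 2 * √B) + 2 * √B with hc₄
  have hback := hflow.sqDist_le_backward (t₀ := t₀) (δ := ε / 2) (C := c₃ + c₄ ^ 2 / 2) le_rfl
    (by linarith) ?_ (by positivity)
  · exact ⟨t₀ - ε / 2, t₀ + ε / 2, _, _, ⟨by linarith, by linarith⟩, hI, hflow, hback⟩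
  intro s hs r hr
  have hsI : s ∈ Icc (t₀ - ε / 2) (t₀ + ε / 2) := ⟨hs.1.le, hs.2.le.trans (by linarith)⟩
  have hsT := Ioo_subset_Icc_self (hI hsI)
  have htT := Ioo_subset_Icc_self ht₀
  have hsts := hst s hsI
  have hd : |s - t₀| = t₀ - s := by
    rw [abs_sub_comm, abs_of_pos (sub_pos.2 hs.2)]
  have key := hsts.neg_integral_sub_mul_le_backward hst₀ hΩ hc hconv
    (W := fun x => caloric T lam x₀ x s) (W₀ := fun x => caloric T lam x₀ x t₀) (B := B)
    hc0 hC₁ (abs_nonneg (s - t₀)) hL0 contDiff_caloric contDiff_caloric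
    (fun x hx => (hG s hsT x hx).1) (fun x hx => (hG s hsT x hx).2.1)
    (fun x hx => by
      rw [abs_of_pos (hc0.trans_le (hG t₀ htT x hx).1)]
      exact (hG t₀ htT x hx).2.1)
    (fun x hx => (hG t₀ htT x hx).2.2.2 s hsT) (hPs s hsI) (hPs t₀ ht₀I)
    (hDk s (hI hsI)) (hDk t₀ ht₀) (hkC s hsI) (hkk₀ s hsI) ?_ ?_
  · rw [setIntegral_zeroExt_sub_mul hm, sqDist_zeroExt hm]
    refine key.trans ?_
    rw [hd]
    have hS := Real.sq_sqrt (integral_nonneg fun x => sq_nonneg _ :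
      0 ≤ ∫ x in Ω, (u x s - u x t₀) ^ 2)
    set q := √(∫ x in Ω, (u x s - u x t₀) ^ 2)
    rw [← hS]
    have e : c₄ ^ 2 / 2 * r + q ^ 2 / (2 * r) - c₄ * q = (c₄ * r - q) ^ 2 / (2 * r) := by
      field_simp
      ring
    have e1 : 0 ≤ (c₄ * r - q) ^ 2 / (2 * r) := by positivity
    have e2 : 0 ≤ c₄ ^ 2 / 2 * (t₀ - s) := mul_nonneg (by positivity) (sub_pos.2 hs.2).le
    have e3 : 0 ≤ c₃ * r := by positivity
    linarith
  · refine (hst₀.integral_weight_sq_le hΩ hc hconv contDiff_caloric (fun x hx => ?_)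
      fun x hx => (hG s hsT x hx).2.2.1).trans ?_
    · rw [abs_of_pos (hc0.trans_le (hG s hsT x hx).1)]
      exact (hG s hsT x hx).2.1
    · have : 0 ≤ L * P := mul_nonneg hL0 hP0
      rw [hB]
      linarith
  · have hg := hsts.memLp_forcing
    have h1 := integral_sq_sub_le hlap hg.neg
    simp only [Pi.neg_apply, sub_neg_eq_add, even_two.neg_pow] at h1
    have h2 := hsts.forcing_le.trans (mul_le_mul_of_nonneg_left (hPs s hsI) hL0)
    have h3 : 0 ≤ 2 * C₁ ^ 2 * ((∫ x in Ω, lap (fun y => u y t₀) x ^ 2)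
      + ∫ x in Ω, ‖gradient (fun y => u y t₀) x‖ ^ 2) := by positivity
    rw [hB]
    linarith

end IsParabolicSolution

end ParabolicFlow

/-! ### Dilations -/

section Dilation

variable {n : ℕ} {Ω : Set (EuclideanSpace ℝ (Fin n))} {x₀ : EuclideanSpace ℝ (Fin n)} {θ : ℝ}

/-- The dilation with centre `x₀` and ratio `θ`. -/
def dilation (x₀ : EuclideanSpace ℝ (Fin n)) (θ : ℝ) (y : EuclideanSpace ℝ (Fin n)) :
    EuclideanSpace ℝ (Fin n) :=
  x₀ + θ • (y - x₀)

@[fun_prop]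
theorem contDiff_dilation {k : WithTop ℕ∞} : ContDiff ℝ k (dilation x₀ θ) := by
  unfold dilation
  fun_prop

@[fun_prop]
theorem continuous_dilation : Continuous (dilation x₀ θ) :=
  (contDiff_dilation (k := 0)).continuous

@[simp]
theorem dilation_one (y : EuclideanSpace ℝ (Fin n)) : dilation x₀ 1 y = y := by
  simp [dilation]

theorem dilation_sub_self (y : EuclideanSpace ℝ (Fin n)) :
    dilation x₀ θ y - y = (θ - 1) • (y - x₀) := by
  simp only [dilation, sub_smul, one_smul]
  abel

theorem norm_dilation_sub (y : EuclideanSpace ℝ (Fin n)) (hθ : 0 ≤ θ) :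
    ‖dilation x₀ θ y - x₀‖ = θ * ‖y - x₀‖ := by
  simp [dilation, norm_smul, abs_of_nonneg hθ]

theorem dilation_dilation (θ' : ℝ) (y : EuclideanSpace ℝ (Fin n)) :
    dilation x₀ θ (dilation x₀ θ' y) = dilation x₀ (θ * θ') y := by
  simp [dilation, mul_smul]

theorem dilation_inv_dilation (hθ : θ ≠ 0) (y : EuclideanSpace ℝ (Fin n)) :
    dilation x₀ θ⁻¹ (dilation x₀ θ y) = y := by
  rw [dilation_dilation, inv_mul_cancel₀ hθ, dilation_one]

theorem dilation_dilation_inv (hθ : θ ≠ 0) (y : EuclideanSpace ℝ (Fin n)) :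
    dilation x₀ θ (dilation x₀ θ⁻¹ y) = y := by
  rw [dilation_dilation, mul_inv_cancel₀ hθ, dilation_one]

/-- A dilation with nonzero ratio, as a homeomorphism. -/
noncomputable def dilationHomeomorph (x₀ : EuclideanSpace ℝ (Fin n)) (hθ : θ ≠ 0) :
    EuclideanSpace ℝ (Fin n) ≃ₜ EuclideanSpace ℝ (Fin n) where
  toFun := dilation x₀ θ
  invFun := dilation x₀ θ⁻¹
  left_inv := dilation_inv_dilation hθ
  right_inv := dilation_dilation_inv hθ

theorem closure_preimage_dilation (hθ : θ ≠ 0) :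
    closure (dilation x₀ θ ⁻¹' Ω) = dilation x₀ θ ⁻¹' closure Ω :=
  ((dilationHomeomorph x₀ hθ).preimage_closure Ω).symm

theorem frontier_preimage_dilation (hθ : θ ≠ 0) :
    frontier (dilation x₀ θ ⁻¹' Ω) = dilation x₀ θ ⁻¹' frontier Ω :=
  ((dilationHomeomorph x₀ hθ).preimage_frontier Ω).symm

theorem convex_preimage_dilation (hconv : Convex ℝ Ω) : Convex ℝ (dilation x₀ θ ⁻¹' Ω) := by
  intro x hx y hy a b ha hb hab
  have e : dilation x₀ θ (a • x + b • y) = a • dilation x₀ θ x + b • dilation x₀ θ y := by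
    obtain rfl : b = 1 - a := by linarith
    simp only [dilation]
    module
  rw [mem_preimage, e]
  exact hconv hx hy ha hb hab

theorem preimage_dilation_subset (hconv : Convex ℝ Ω) (hx₀ : x₀ ∈ Ω) (hθ : 1 ≤ θ) :
    dilation x₀ θ ⁻¹' Ω ⊆ Ω := by
  intro y hy
  have h := hconv.add_smul_sub_mem hx₀ hy ⟨inv_nonneg.2 (by linarith), inv_le_one_of_one_le₀ hθ⟩
  have e := dilation_inv_dilation (x₀ := x₀) (by linarith : θ ≠ 0) y
  rw [dilation] at e
  rwa [e] at h

theorem integral_comp_dilation (f : EuclideanSpace ℝ (Fin n) → ℝ) (hθ : 0 < θ) :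
    ∫ y, f (dilation x₀ θ y) = (θ ^ n)⁻¹ * ∫ x, f x := by
  simp only [dilation]
  rw [integral_sub_right_eq_self (μ := volume) (fun y => f (x₀ + θ • y)) x₀,
    Measure.integral_comp_smul volume (fun y => f (x₀ + y)) θ,
    integral_add_left_eq_self (μ := volume) f x₀, finrank_euclideanSpace_fin,
    abs_of_pos (by positivity), smul_eq_mul]

theorem setIntegral_comp_dilation (hΩ : MeasurableSet Ω) (f : EuclideanSpace ℝ (Fin n) → ℝ)
    (hθ : 0 < θ) :
    ∫ y in dilation x₀ θ ⁻¹' Ω, f (dilation x₀ θ y) = (θ ^ n)⁻¹ * ∫ x in Ω, f x := by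
  rw [← integral_indicator hΩ, ← integral_comp_dilation _ hθ,
    ← integral_indicator (continuous_dilation.measurable hΩ)]
  rfl

theorem gradient_comp_dilation {f : EuclideanSpace ℝ (Fin n) → ℝ} {y : EuclideanSpace ℝ (Fin n)}
    (hf : DifferentiableAt ℝ f (dilation x₀ θ y)) :
    gradient (fun y => f (dilation x₀ θ y)) y = θ • gradient f (dilation x₀ θ y) := by
  have h1 : HasFDerivAt (dilation x₀ θ) (θ • ContinuousLinearMap.id ℝ _) y :=
    (((hasFDerivAt_id y).sub_const x₀).const_smul θ).const_add x₀
  have h2 := hf.hasFDerivAt.comp y h1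
  rw [gradient, (show HasFDerivAt (fun y => f (dilation x₀ θ y)) _ y from h2).fderiv, gradient,
    ContinuousLinearMap.comp_smul, ContinuousLinearMap.comp_id]
  simp

theorem caloric_dilation {T lam s t : ℝ} (ht : 0 < T - t + lam)
    (hθ : 0 < θ) (h : T - s + lam = θ ^ 2 * (T - t + lam)) (y : EuclideanSpace ℝ (Fin n)) :
    caloric T lam x₀ (dilation x₀ θ y) s = (θ ^ n)⁻¹ * caloric T lam x₀ y t := by
  simp only [caloric]
  rw [norm_dilation_sub y hθ.le, h, Real.mul_rpow (by positivity) ht.le, ← Real.rpow_natCast θ 2,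
    ← Real.rpow_mul hθ.le, mul_pow, ← Real.rpow_natCast θ n, ← Real.rpow_neg hθ.le]
  have e1 : ((2 : ℕ) : ℝ) * (-(n : ℝ) / 2) = -(n : ℝ) := by push_cast; ring
  have e2 : -(θ ^ 2 * ‖y - x₀‖ ^ 2) / (4 * (θ ^ ((2 : ℕ) : ℝ) * (T - t + lam)))
      = -‖y - x₀‖ ^ 2 / (4 * (T - t + lam)) := by
    rw [Real.rpow_natCast]
    field_simp
  rw [e1, e2, mul_assoc]

end Dilation

section DilatedEnergy

variable {n : ℕ} {Ω : Set (EuclideanSpace ℝ (Fin n))} {x₀ : EuclideanSpace ℝ (Fin n)} {θ : ℝ}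
  {U V ρ : EuclideanSpace ℝ (Fin n) → ℝ}

theorem setIntegral_sq_mul (hΩ : IsOpen Ω) (hc : IsCompact (closure Ω)) (hconv : Convex ℝ Ω)
    (hU : ContDiffOn ℝ 2 U (closure Ω)) (hU0 : ∀ x ∈ frontier Ω, U x = 0) (hρ : ContDiff ℝ 1 ρ) :
    ∫ x in Ω, ‖gradient U x‖ ^ 2 * ρ x
      = -∫ x in Ω, U x * (ρ x * lap U x + inner ℝ (gradient U x) (gradient ρ x)) := by
  rw [← setIntegral_mul_inner_gradient hΩ hc hconv hU (hU.of_le (by norm_num)) hU0 hρ]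
  simp only [real_inner_self_eq_norm_sq, mul_comm]

theorem extendsToClosure_weighted_lap (hΩ : IsOpen Ω) (hconv : Convex ℝ Ω)
    (hU : ContDiffOn ℝ 2 U (closure Ω)) (hρ : ContDiff ℝ 1 ρ) :
    ExtendsToClosure Ω fun x => ρ x * lap U x + inner ℝ (gradient U x) (gradient ρ x) :=
  (hρ.continuous.extendsToClosure.mul (hU.extendsToClosure_lap hΩ hconv)).add
    (((hU.of_le (by norm_num)).extendsToClosure_gradient hΩ hconv).inner
      (hρ.contDiffOn.extendsToClosure_gradient hΩ hconv))

/-- Dilating a function which vanishes on the boundary of a convex domain makes it admissible as a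
test function in the domain; its weighted Dirichlet energy is then bounded below by convexity. -/
theorem sub_two_mul_le_setIntegral_gradient_dilation (hΩ : IsOpen Ω) (hc : IsCompact (closure Ω))
    (hconv : Convex ℝ Ω) (hx₀ : x₀ ∈ Ω) (hU : ContDiffOn ℝ 2 U (closure Ω))
    (hU0 : ∀ x ∈ frontier Ω, U x = 0) (hV : ContDiffOn ℝ 1 V (closure Ω))
    (hV0 : ∀ x ∈ frontier Ω, V x = 0) (hρ : ContDiff ℝ 1 ρ) (hρ0 : ∀ x, 0 ≤ ρ x) (hθ : 1 ≤ θ) :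
    (∫ x in Ω, ‖gradient U x‖ ^ 2 * ρ x)
      - 2 * ∫ x in Ω, (Ω.indicator V (dilation x₀ θ x) - U x)
          * (ρ x * lap U x + inner ℝ (gradient U x) (gradient ρ x))
      ≤ ∫ y in dilation x₀ θ ⁻¹' Ω, ‖gradient (fun y => V (dilation x₀ θ y)) y‖ ^ 2 * ρ y := by
  have := isFiniteMeasure_restrict_of_isCompact_closure hc
  have hθ0 : θ ≠ 0 := by linarith
  set Ω' := dilation x₀ θ ⁻¹' Ω with hΩ'def
  set w : EuclideanSpace ℝ (Fin n) → ℝ := fun y => V (dilation x₀ θ y) with hw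
  set Ψ : EuclideanSpace ℝ (Fin n) → ℝ :=
    fun x => ρ x * lap U x + inner ℝ (gradient U x) (gradient ρ x) with hΨdef
  have hsub : Ω' ⊆ Ω := preimage_dilation_subset hconv hx₀ hθ
  have hΩ' : IsOpen Ω' := hΩ.preimage continuous_dilation
  have hc' : IsCompact (closure Ω') := hc.of_isClosed_subset isClosed_closure (closure_mono hsub)
  have := isFiniteMeasure_restrict_of_isCompact_closure hc'
  have hconv' : Convex ℝ Ω' := convex_preimage_dilation hconv
  have hw1 : ContDiffOn ℝ 1 w (closure Ω') :=
    hV.comp contDiff_dilation.contDiffOn (closure_preimage_dilation hθ0).subset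
  have hw0 : ∀ y ∈ frontier Ω', w y = 0 := fun y hy => by
    rw [hΩ'def, frontier_preimage_dilation hθ0] at hy
    exact hV0 _ hy
  have hU' : ContDiffOn ℝ 2 U (closure Ω') := hU.mono (closure_mono hsub)
  have hΨ : MemLp Ψ ⊤ (volume.restrict Ω) :=
    (extendsToClosure_weighted_lap hΩ hconv hU hρ).memLp_top hΩ hc
  have hUL : MemLp U ⊤ (volume.restrict Ω) := hU.continuousOn.extendsToClosure.memLp_top hΩ hc
  have hwΨ : ∀ x, Ω.indicator V (dilation x₀ θ x) * Ψ x = Ω'.indicator (fun x => w x * Ψ x) x :=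
    fun x => by
      by_cases hx : dilation x₀ θ x ∈ Ω
      · have : x ∈ Ω' := hx
        simp [hx, this, hw]
      · have : x ∉ Ω' := hx
        simp [hx, this]
  have hwint : IntegrableOn (fun x => w x * Ψ x) Ω' :=
    (hw1.continuousOn.extendsToClosure.mul
      ((extendsToClosure_weighted_lap hΩ hconv hU hρ).mono hsub)).memLp_top (μ := volume) hΩ' hc'
      |>.top_integrable
  have e1 : ∫ x in Ω, (Ω.indicator V (dilation x₀ θ x) - U x) * Ψ x
      = (∫ x in Ω', w x * Ψ x) - ∫ x in Ω, U x * Ψ x := by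
    simp only [sub_mul, hwΨ]
    rw [integral_sub _ (hUL.top_mul hΨ).top_integrable, setIntegral_indicator hΩ'.measurableSet,
      inter_eq_self_of_subset_right hsub]
    exact ((integrable_indicator_iff hΩ'.measurableSet).2 hwint).restrict
  have e2 := setIntegral_sq_mul hΩ hc hconv hU hU0 hρ
  have e3 := setIntegral_mul_inner_gradient hΩ' hc' hconv' hU' hw1 hw0 hρ
  have gU := (hU'.of_le (by norm_num : (1 : WithTop ℕ∞) ≤ 2)).extendsToClosure_gradient hΩ' hconv'
  have gw := hw1.extendsToClosure_gradient hΩ' hconv'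
  have hρ' := hρ.continuous.extendsToClosure (Ω := Ω')
  have e4 : 2 * (∫ x in Ω', ρ x * inner ℝ (gradient U x) (gradient w x))
      - ∫ x in Ω', ‖gradient U x‖ ^ 2 * ρ x ≤ ∫ x in Ω', ‖gradient w x‖ ^ 2 * ρ x := by
    have i1 := ((hρ'.mul (gU.inner gw)).memLp_top (μ := volume) hΩ' hc').top_integrable
    have i2 := (((gU.norm.pow 2).mul hρ').memLp_top (μ := volume) hΩ' hc').top_integrable
    have i3 := (((gw.norm.pow 2).mul hρ').memLp_top (μ := volume) hΩ' hc').top_integrable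
    rw [← integral_const_mul, ← integral_sub (i1.const_mul 2) i2]
    refine integral_mono ((i1.const_mul 2).sub i2) i3 fun x => ?_
    have h := mul_nonneg (sq_nonneg ‖gradient w x - gradient U x‖) (hρ0 x)
    rw [norm_sub_sq_real, real_inner_comm] at h
    linarith
  have e5 : ∫ x in Ω', ‖gradient U x‖ ^ 2 * ρ x ≤ ∫ x in Ω, ‖gradient U x‖ ^ 2 * ρ x :=
    setIntegral_mono_set
      ((((((hU.of_le (by norm_num)).extendsToClosure_gradient hΩ hconv).norm.pow 2).mul
        hρ.continuous.extendsToClosure).memLp_top (μ := volume) hΩ hc).top_integrable)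
      (.of_forall fun x => mul_nonneg (sq_nonneg _) (hρ0 x)) hsub.eventuallyLE
  rw [e1]
  simp only [hΨdef] at *
  linarith

end DilatedEnergy

section DilatedSolution

variable {n : ℕ} {Ω : Set (EuclideanSpace ℝ (Fin n))} {T M lam α β K t₀ a : ℝ}
  {x₀ : EuclideanSpace ℝ (Fin n)} {u : EuclideanSpace ℝ (Fin n) → ℝ → ℝ}

theorem Hfun_eq_dilation (hΩ : IsOpen Ω) (hconv : Convex ℝ Ω) (hx₀ : x₀ ∈ Ω) {s t θ : ℝ}
    (ht : 0 < T - t + lam) (hθ : 1 ≤ θ) (h : T - s + lam = θ ^ 2 * (T - t + lam)) :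
    Hfun Ω T lam x₀ u s
      = ∫ x in Ω, zeroExt Ω u s (dilation x₀ θ x) ^ 2 * caloric T lam x₀ x t := by
  have hθ0 : 0 < θ := by linarith
  have hsub := preimage_dilation_subset hconv hx₀ hθ
  have hΩ' := (continuous_dilation (x₀ := x₀) (θ := θ)).measurable hΩ.measurableSet
  have e1 := setIntegral_comp_dilation (x₀ := x₀) hΩ.measurableSet
    (fun x => u x s ^ 2 * caloric T lam x₀ x s) hθ0
  simp only [caloric_dilation ht hθ0 h, mul_left_comm _ ((θ ^ n)⁻¹)] at e1
  rw [integral_const_mul] at e1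
  rw [Hfun, ← mul_left_cancel₀ (inv_ne_zero (pow_ne_zero n hθ0.ne')) e1,
    ← inter_eq_self_of_subset_right hsub, ← setIntegral_indicator hΩ']
  refine integral_congr_ae (.of_forall fun x => ?_)
  by_cases hx : dilation x₀ θ x ∈ Ω
  · simp [zeroExt, hx]
  · simp [zeroExt, hx]

theorem mul_Dfun_eq_dilation (h : IsParabolicSolution Ω T M u) {s t θ : ℝ} (hs : s ∈ Icc 0 T)
    (ht : 0 < T - t + lam) (hθ : 0 < θ) (hst : T - s + lam = θ ^ 2 * (T - t + lam)) :
    (T - s + lam) * Dfun Ω T lam x₀ u s = (T - t + lam) * ∫ y in dilation x₀ θ ⁻¹' Ω,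
      ‖gradient (fun y => u (dilation x₀ θ y) s) y‖ ^ 2 * caloric T lam x₀ y t := by
  have e1 := setIntegral_comp_dilation (x₀ := x₀) h.isOpen.measurableSet
    (fun x => ‖gradient (fun y => u y s) x‖ ^ 2 * caloric T lam x₀ x s) hθ
  simp only [caloric_dilation ht hθ hst, mul_left_comm _ ((θ ^ n)⁻¹)] at e1
  rw [integral_const_mul] at e1
  rw [Dfun, ← mul_left_cancel₀ (inv_ne_zero (pow_ne_zero n hθ.ne')) e1, hst, mul_comm (θ ^ 2),
    mul_assoc, ← integral_const_mul]
  congr 1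
  refine setIntegral_congr_fun (continuous_dilation.measurable h.isOpen.measurableSet)
    fun y hy => ?_
  have hd := ((h.contDiffOn_space s hs).of_le one_le_two).differentiableAt_of_mem h.isOpen hy
  simp only [gradient_comp_dilation hd, norm_smul, mul_pow, Real.norm_eq_abs, sq_abs, mul_assoc]

theorem tendsto_slope_integral_comp_dilation (hΩ : IsOpen Ω) (hc : IsCompact (closure Ω))
    (hconv : Convex ℝ Ω) {U Ψ : EuclideanSpace ℝ (Fin n) → ℝ} (hU : ContDiffOn ℝ 1 U (closure Ω))
    (hU0 : ∀ x ∈ frontier Ω, U x = 0) (hΨ : ExtendsToClosure Ω Ψ) {θ : ℝ → ℝ}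
    (hθ : HasDerivAt θ a t₀) (hθ1 : θ t₀ = 1) :
    Tendsto (fun s => (s - t₀)⁻¹ * ∫ x in Ω,
        (Ω.indicator U (dilation x₀ (θ s) x) - Ω.indicator U x) * Ψ x) (𝓝[<] t₀)
      (𝓝 (∫ x in Ω, a * inner ℝ (gradient U x) (x - x₀) * Ψ x)) := by
  have := isFiniteMeasure_restrict_of_isCompact_closure hc
  obtain ⟨C, hC⟩ := exists_lipschitzWith_indicator_of_contDiffOn hΩ hc hconv hU hU0
  obtain ⟨R, hR0, hR⟩ := ((by fun_prop : Continuous fun x => x - x₀).extendsToClosure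
    (Ω := Ω)).exists_norm_le hc
  obtain ⟨B, hB0, hB⟩ := hΨ.exists_abs_le hc
  obtain ⟨c, hc'⟩ := hθ.isBigO_sub.bound
  simp only [← integral_const_mul]
  refine tendsto_integral_filter_of_dominated_convergence (fun _ => C * (|c| * R) * B)
    (.of_forall fun s => ?_) ?_ (integrable_const _) ?_
  · exact (((hC.continuous.comp continuous_dilation).sub hC.continuous).aestronglyMeasurable.mul
      (hΨ.continuousOn.aestronglyMeasurable hΩ.measurableSet)).const_mul _
  · filter_upwards [nhdsWithin_le_nhds hc', self_mem_nhdsWithin] with s hs hst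
    filter_upwards [ae_restrict_mem hΩ.measurableSet] with x hx
    have hpos : 0 < |s - t₀| := abs_pos.2 (sub_ne_zero.2 (ne_of_lt hst))
    rw [hθ1, Real.norm_eq_abs, Real.norm_eq_abs] at hs
    have h1 := hC.dist_le_mul (dilation x₀ (θ s) x) x
    rw [Real.dist_eq, dist_eq_norm, dilation_sub_self, norm_smul, Real.norm_eq_abs] at h1
    rw [Real.norm_eq_abs, abs_mul, abs_mul, abs_inv, ← mul_assoc]
    refine mul_le_mul ?_ (hB x hx) (abs_nonneg _) (by positivity)
    rw [inv_mul_le_iff₀ hpos]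
    calc _ ≤ C * (|θ s - 1| * ‖x - x₀‖) := h1
      _ ≤ C * (|c| * |s - t₀| * R) := by
        gcongr
        · exact hs.trans (mul_le_mul_of_nonneg_right (le_abs_self c) (abs_nonneg _))
        · exact hR x hx
      _ = _ := by ring
  · filter_upwards [ae_restrict_mem hΩ.measurableSet] with x hx
    have h1 : HasFDerivAt (Ω.indicator U) (fderiv ℝ U x) (dilation x₀ (θ t₀) x) := by
      rw [hθ1, dilation_one]
      refine (hU.differentiableAt_of_mem hΩ hx).hasFDerivAt.congr_of_eventuallyEq ?_
      exact Filter.eventuallyEq_of_mem (hΩ.mem_nhds hx) fun y hy => indicator_of_mem hy _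
    have h2 : HasDerivAt (fun s => dilation x₀ (θ s) x) (a • (x - x₀)) t₀ :=
      (hθ.smul_const (x - x₀)).const_add x₀
    have h3 := (hasDerivAt_iff_tendsto_slope.1 (h1.comp_hasDerivAt t₀ h2)).mono_left
      (nhdsWithin_mono t₀ fun s (hs : s < t₀) => hs.ne)
    have h4 := h3.mul_const (Ψ x)
    rw [map_smul, smul_eq_mul, ← inner_gradient_left] at h4
    refine h4.congr fun s => ?_
    simp [slope_def_field, hθ1, div_eq_inv_mul, mul_assoc]

theorem integral_sq_comp_dilation_sub_le (hΩ : IsOpen Ω) (hc : IsCompact (closure Ω))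
    (hconv : Convex ℝ Ω) {U : EuclideanSpace ℝ (Fin n) → ℝ} (hU : ContDiffOn ℝ 1 U (closure Ω))
    (hU0 : ∀ x ∈ frontier Ω, U x = 0) :
    ∃ C, ∀ θ, ∫ x in Ω, (Ω.indicator U (dilation x₀ θ x) - Ω.indicator U x) ^ 2
      ≤ C * (θ - 1) ^ 2 := by
  have := isFiniteMeasure_restrict_of_isCompact_closure hc
  obtain ⟨C, hC⟩ := exists_lipschitzWith_indicator_of_contDiffOn hΩ hc hconv hU hU0
  obtain ⟨R, hR0, hR⟩ := ((by fun_prop : Continuous fun x => x - x₀).extendsToClosure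
    (Ω := Ω)).exists_norm_le hc
  refine ⟨(C * R) ^ 2 * volume.real Ω, fun θ => ?_⟩
  have hb : ∀ x ∈ Ω, (Ω.indicator U (dilation x₀ θ x) - Ω.indicator U x) ^ 2
      ≤ (C * R) ^ 2 * (θ - 1) ^ 2 := fun x hx => by
    have h1 := hC.dist_le_mul (dilation x₀ θ x) x
    rw [Real.dist_eq, dist_eq_norm, dilation_sub_self, norm_smul, Real.norm_eq_abs] at h1
    rw [← mul_pow, sq_le_sq, abs_mul, abs_of_nonneg (by positivity : 0 ≤ (C : ℝ) * R)]
    calc _ ≤ C * (|θ - 1| * ‖x - x₀‖) := h1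
      _ ≤ C * (|θ - 1| * R) := by
        gcongr
        exact hR x hx
      _ = _ := by ring
  have h1 := setIntegral_mono_on (μ := volume) (((hC.continuous.comp continuous_dilation).sub
    hC.continuous).pow 2 |>.extendsToClosure (Ω := Ω) |>.memLp_top hΩ hc |>.top_integrable)
    (integrable_const ((C * R) ^ 2 * (θ - 1) ^ 2)) hΩ.measurableSet hb
  rw [setIntegral_const, smul_eq_mul] at h1
  calc _ ≤ _ := h1
    _ = _ := by ring

end DilatedSolution

section DilatedFlow

variable {n : ℕ} {Ω : Set (EuclideanSpace ℝ (Fin n))} {T M lam α β K C t₀ a : ℝ}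
  {x₀ : EuclideanSpace ℝ (Fin n)} {u : EuclideanSpace ℝ (Fin n) → ℝ → ℝ} {θ : ℝ → ℝ}

theorem setIntegral_comp_dilation_mul (hΩ : MeasurableSet Ω)
    {f Ψ : EuclideanSpace ℝ (Fin n) → ℝ} (hf : ∀ x ∉ Ω, f x = 0) {θ : ℝ} (hθ : 0 < θ) :
    ∫ x in Ω, f (dilation x₀ θ x) * Ψ x
      = (θ ^ n)⁻¹ * ∫ x in Ω, f x * Ω.indicator Ψ (dilation x₀ θ⁻¹ x) := by
  have e := integral_comp_dilation (x₀ := x₀)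
    (fun x => f x * Ω.indicator Ψ (dilation x₀ θ⁻¹ x)) hθ
  simp only [dilation_inv_dilation hθ.ne'] at e
  rw [setIntegral_eq_integral_of_forall_compl_eq_zero
    (f := fun x => f x * Ω.indicator Ψ (dilation x₀ θ⁻¹ x)) fun x hx => by simp [hf x hx], ← e,
    ← integral_indicator hΩ]
  refine integral_congr_ae (.of_forall fun x => ?_)
  by_cases hx : x ∈ Ω <;> simp [hx]

theorem tendsto_slope_integral_sub_comp_dilation (h : IsParabolicSolution Ω T M u)
    (hflow : EnergyFlow (volume.restrict Ω) (zeroExt Ω u) (zeroExtDeriv Ω u) α β K)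
    (ht₀ : t₀ ∈ Ioo α β)
    (hC : ∀ z ∈ Ioo α t₀, sqDist (volume.restrict Ω) (zeroExt Ω u z) (zeroExt Ω u t₀)
      ≤ C * (z - t₀) ^ 2)
    {Ψ : EuclideanSpace ℝ (Fin n) → ℝ} (hΨ : ExtendsToClosure Ω Ψ) (hθ : ContinuousAt θ t₀)
    (hθ1 : θ t₀ = 1) :
    Tendsto (fun s => (s - t₀)⁻¹ * ∫ x in Ω, (zeroExt Ω u s (dilation x₀ (θ s) x)
        - zeroExt Ω u t₀ (dilation x₀ (θ s) x)) * Ψ x) (𝓝[<] t₀)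
      (𝓝 (∫ x in Ω, zeroExtDeriv Ω u t₀ x * Ψ x)) := by
  have hΩ := h.isOpen
  have hm := h.isOpen.measurableSet
  have := isFiniteMeasure_restrict_of_isCompact_closure h.isCompact_closure
  obtain ⟨B, hB0, hB⟩ := hΨ.exists_abs_le h.isCompact_closure
  have hind : Measurable (Ω.indicator Ψ) := by
    classical
    rw [← piecewise_eq_indicator]
    exact hΨ.continuousOn.measurable_piecewise continuousOn_const hm
  have hθt : Tendsto θ (𝓝[<] t₀) (𝓝 1) := hθ1 ▸ hθ.tendsto.mono_left nhdsWithin_le_nhds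
  have h1 := hflow.tendsto_integral_slope_mul (l := 𝓝[<] t₀) (Ioo_subset_Icc_self ht₀)
    (nhdsWithin_mono t₀ fun s (hs : s < t₀) => hs.ne)
    (nhdsWithin_le_nhds (Icc_mem_nhds ht₀.1 ht₀.2))
    (Filter.mem_of_superset (Ioo_mem_nhdsLT ht₀.1) hC)
    (φ := fun s x => Ω.indicator Ψ (dilation x₀ (θ s)⁻¹ x)) (φ₀ := Ψ) (B := B)
    (.of_forall fun s => (hind.comp continuous_dilation.measurable).aestronglyMeasurable)
    (.of_forall fun s x => by
      by_cases hx : dilation x₀ (θ s)⁻¹ x ∈ Ω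
      · simpa [hx] using hB _ hx
      · simpa [hx] using hB0)
    (hΨ.memLp_top hΩ h.isCompact_closure) (by
      filter_upwards [ae_restrict_mem hm] with x hx
      have hc : ContinuousAt (Ω.indicator Ψ) (dilation x₀ 1⁻¹ x) := by
        rw [inv_one, dilation_one]
        refine (hΨ.continuousOn.continuousAt (hΩ.mem_nhds hx)).congr ?_
        exact Filter.eventuallyEq_of_mem (hΩ.mem_nhds hx) fun y hy => (indicator_of_mem hy _).symm
      have hd : Tendsto (fun s => dilation x₀ (θ s)⁻¹ x) (𝓝[<] t₀) (𝓝 (dilation x₀ 1⁻¹ x)) :=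
        (((hθt.inv₀ one_ne_zero).smul_const (x - x₀)).const_add x₀)
      have := hc.tendsto.comp hd
      rwa [inv_one, dilation_one, indicator_of_mem hx] at this)
  have h2 : Tendsto (fun s => ((θ s) ^ n)⁻¹) (𝓝[<] t₀) (𝓝 1) := by
    simpa using (hθt.pow n).inv₀ (by simp)
  have h3 := h2.mul h1
  rw [one_mul] at h3
  refine h3.congr' ?_
  filter_upwards [hθt.eventually (lt_mem_nhds one_pos)] with s hs
  rw [setIntegral_comp_dilation_mul hm (f := fun x => zeroExt Ω u s x - zeroExt Ω u t₀ x)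
    (fun x hx => by simp [zeroExt, hx]) hs]
  ring

theorem tendsto_slope_integral_dilation_mul (h : IsParabolicSolution Ω T M u)
    (hflow : EnergyFlow (volume.restrict Ω) (zeroExt Ω u) (zeroExtDeriv Ω u) α β K)
    (ht₀ : t₀ ∈ Ioo α β) (hI : Icc α β ⊆ Ioo 0 T)
    (hC : ∀ z ∈ Ioo α t₀, sqDist (volume.restrict Ω) (zeroExt Ω u z) (zeroExt Ω u t₀)
      ≤ C * (z - t₀) ^ 2)
    {Ψ : EuclideanSpace ℝ (Fin n) → ℝ} (hΨ : ExtendsToClosure Ω Ψ) (hθ : HasDerivAt θ a t₀)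
    (hθ1 : θ t₀ = 1) :
    Tendsto (fun s => (s - t₀)⁻¹ * ∫ x in Ω, (zeroExt Ω u s (dilation x₀ (θ s) x)
        - u x t₀) * Ψ x) (𝓝[<] t₀)
      (𝓝 (∫ x in Ω, (deriv (fun s => u x s) t₀
        + a * inner ℝ (gradient (fun y => u y t₀) x) (x - x₀)) * Ψ x)) := by
  have hΩ := h.isOpen
  have hm := h.isOpen.measurableSet
  have hc := h.isCompact_closure
  have := isFiniteMeasure_restrict_of_isCompact_closure hc
  have htT := hI (Ioo_subset_Icc_self ht₀)
  have hu := (h.contDiffOn_space t₀ (Ioo_subset_Icc_self htT)).of_le one_le_two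
  have hΨL := hΨ.memLp_top (μ := volume) hΩ hc
  have hd : ∀ s ∈ Icc 0 T, ∀ θ, MemLp (fun x => zeroExt Ω u s (dilation x₀ θ x)) ⊤
      (volume.restrict Ω) := fun s hs θ => by
    obtain ⟨B, hB⟩ := h.exists_abs_le hs
    exact memLp_top_of_bound
      ((h.measurable_zeroExt hs).comp continuous_dilation.measurable).aestronglyMeasurable B
      (.of_forall fun x => hB _)
  have h1 := tendsto_slope_integral_sub_comp_dilation (x₀ := x₀) h hflow ht₀ hC hΨ
    hθ.continuousAt hθ1
  have h2 := tendsto_slope_integral_comp_dilation (x₀ := x₀) hΩ hc h.convex hu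
    (fun x hx => h.eq_zero x hx t₀ (Ioo_subset_Icc_self htT)) hΨ hθ hθ1
  have hgx : ExtendsToClosure Ω fun x => inner ℝ (gradient (fun y => u y t₀) x) (x - x₀) :=
    (hu.extendsToClosure_gradient hΩ h.convex).inner
      (by fun_prop : Continuous fun x => x - x₀).extendsToClosure
  have e : ∫ x in Ω, (deriv (fun s => u x s) t₀
      + a * inner ℝ (gradient (fun y => u y t₀) x) (x - x₀)) * Ψ x
      = (∫ x in Ω, zeroExtDeriv Ω u t₀ x * Ψ x)
        + ∫ x in Ω, a * inner ℝ (gradient (fun y => u y t₀) x) (x - x₀) * Ψ x := by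
    have e1 : ∫ x in Ω, zeroExtDeriv Ω u t₀ x * Ψ x
        = ∫ x in Ω, deriv (fun s => u x s) t₀ * Ψ x :=
      setIntegral_congr_fun hm fun x hx => by simp [zeroExtDeriv, hx]
    rw [e1, ← integral_add ((h.memLp_deriv htT).top_mul hΨL).top_integrable]
    · simp only [add_mul]
    · simp only [mul_assoc]
      exact ((hgx.mul hΨ).memLp_top (μ := volume) hΩ hc).top_integrable.const_mul a
  rw [e]
  refine (h1.add h2).congr' ?_
  filter_upwards [nhdsWithin_le_nhds (Icc_mem_nhds ht₀.1 ht₀.2)] with s hs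
  have hsT := Ioo_subset_Icc_self (hI hs)
  have htT' := Ioo_subset_Icc_self htT
  have m0 : MemLp (zeroExt Ω u t₀) ⊤ (volume.restrict Ω) := by simpa using hd t₀ htT' 1
  have := integral_add (μ := volume.restrict Ω)
    (((hd s hsT (θ s)).top_sub (hd t₀ htT' (θ s))).top_mul hΨL).top_integrable
    (((hd t₀ htT' (θ s)).top_sub m0).top_mul hΨL).top_integrable
  rw [← mul_add]
  congr 1
  refine this.symm.trans (setIntegral_congr_fun hm fun x hx => ?_)
  simp only [zeroExt, indicator_of_mem hx]
  ring

theorem eventually_integral_sq_dilation_sub_le (h : IsParabolicSolution Ω T M u)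
    (ht₀ : t₀ ∈ Ioo α β) (hI : Icc α β ⊆ Ioo 0 T)
    (hC : ∀ z ∈ Ioo α t₀, sqDist (volume.restrict Ω) (zeroExt Ω u z) (zeroExt Ω u t₀)
      ≤ C * (z - t₀) ^ 2)
    (hθ : HasDerivAt θ a t₀) (hθ1 : θ t₀ = 1) (hθ' : ∀ᶠ s in 𝓝[<] t₀, 1 ≤ θ s) :
    ∃ C', ∀ᶠ s in 𝓝[<] t₀, ∫ x in Ω, (zeroExt Ω u s (dilation x₀ (θ s) x) - u x t₀) ^ 2
      ≤ C' * (s - t₀) ^ 2 := by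
  have hΩ := h.isOpen
  have hm := h.isOpen.measurableSet
  have hc := h.isCompact_closure
  have := isFiniteMeasure_restrict_of_isCompact_closure hc
  have htT := Ioo_subset_Icc_self (hI (Ioo_subset_Icc_self ht₀))
  obtain ⟨C₁, hC₁⟩ := integral_sq_comp_dilation_sub_le (x₀ := x₀) hΩ hc h.convex
    ((h.contDiffOn_space t₀ htT).of_le one_le_two) (fun x hx => h.eq_zero x hx t₀ htT)
  obtain ⟨c, hc'⟩ := hθ.isBigO_sub.bound
  have hd : ∀ s ∈ Icc 0 T, ∀ θ, MemLp (fun x => zeroExt Ω u s (dilation x₀ θ x)) ⊤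
      (volume.restrict Ω) := fun s hs θ => by
    obtain ⟨B, hB⟩ := h.exists_abs_le hs
    exact memLp_top_of_bound
      ((h.measurable_zeroExt hs).comp continuous_dilation.measurable).aestronglyMeasurable B
      (.of_forall fun x => hB _)
  have m0 : MemLp (zeroExt Ω u t₀) ⊤ (volume.restrict Ω) := by simpa using hd t₀ htT 1
  refine ⟨2 * C + 2 * (|C₁| * c ^ 2), ?_⟩
  filter_upwards [nhdsWithin_le_nhds hc', Ioo_mem_nhdsLT ht₀.1, hθ'] with s hs hsI hs1
  have hsT := Ioo_subset_Icc_self (hI ⟨hsI.1.le, (hsI.2.trans ht₀.2).le⟩)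
  have hs0 : 0 < θ s := by linarith
  have h1 : ∫ x in Ω, (zeroExt Ω u s (dilation x₀ (θ s) x)
      - zeroExt Ω u t₀ (dilation x₀ (θ s) x)) ^ 2 ≤ C * (s - t₀) ^ 2 := by
    have e := setIntegral_comp_dilation_mul (x₀ := x₀) hm (Ψ := fun _ => 1)
      (f := fun x => (zeroExt Ω u s x - zeroExt Ω u t₀ x) ^ 2)
      (fun x hx => by simp [zeroExt, hx]) hs0
    simp only [mul_one] at e
    have hi : Integrable (fun x => (zeroExt Ω u s x - zeroExt Ω u t₀ x) ^ 2)
        (volume.restrict Ω) := by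
      simpa using ((hd s hsT 1).top_sub (hd t₀ htT 1)).top_sq.top_integrable
    have hle : ∫ x in Ω, (zeroExt Ω u s x - zeroExt Ω u t₀ x) ^ 2
        * Ω.indicator (fun _ => (1 : ℝ)) (dilation x₀ (θ s)⁻¹ x)
        ≤ sqDist (volume.restrict Ω) (zeroExt Ω u s) (zeroExt Ω u t₀) :=
      integral_mono_of_nonneg
        (.of_forall fun x => mul_nonneg (sq_nonneg _)
          (indicator_nonneg (fun _ _ => zero_le_one) _)) hi
        (.of_forall fun x => mul_le_of_le_one_right (sq_nonneg _)
          (indicator_le_self' (fun _ _ => zero_le_one) _))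
    rw [e]
    exact (mul_le_of_le_one_left (integral_nonneg fun x => mul_nonneg (sq_nonneg _)
      (indicator_nonneg (fun _ _ => zero_le_one) _))
      (inv_le_one_of_one_le₀ (one_le_pow₀ hs1))).trans (hle.trans (hC s hsI))
  have h2 : ∫ x in Ω, (zeroExt Ω u t₀ (dilation x₀ (θ s) x) - zeroExt Ω u t₀ x) ^ 2
      ≤ |C₁| * c ^ 2 * (s - t₀) ^ 2 := by
    refine (hC₁ (θ s)).trans ?_
    rw [hθ1, Real.norm_eq_abs, Real.norm_eq_abs] at hs
    have := mul_le_mul (le_abs_self C₁) (pow_le_pow_left₀ (abs_nonneg _) hs 2) (by positivity)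
      (abs_nonneg _)
    rw [mul_pow, sq_abs, sq_abs] at this
    linarith
  have h3 := integral_sq_sub_le
    ((hd s hsT (θ s)).top_sub (hd t₀ htT (θ s))) (m0.top_sub (hd t₀ htT (θ s)))
  have h4 : ∫ x in Ω, (zeroExt Ω u s (dilation x₀ (θ s) x) - u x t₀) ^ 2
      = ∫ x in Ω, ((zeroExt Ω u s (dilation x₀ (θ s) x) - zeroExt Ω u t₀ (dilation x₀ (θ s) x))
        - (zeroExt Ω u t₀ x - zeroExt Ω u t₀ (dilation x₀ (θ s) x))) ^ 2 :=
    setIntegral_congr_fun hm fun x hx => by simp [zeroExt, hx]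
  have h5 : ∫ x in Ω, (zeroExt Ω u t₀ x - zeroExt Ω u t₀ (dilation x₀ (θ s) x)) ^ 2
      = ∫ x in Ω, (zeroExt Ω u t₀ (dilation x₀ (θ s) x) - zeroExt Ω u t₀ x) ^ 2 := by
    simp only [sub_sq_comm]
  rw [h4]
  linarith

end DilatedFlow

section FrequencyBound

variable {n : ℕ} {Ω : Set (EuclideanSpace ℝ (Fin n))} {T M lam α β K C t₀ k' : ℝ}
  {x₀ : EuclideanSpace ℝ (Fin n)} {u : EuclideanSpace ℝ (Fin n) → ℝ → ℝ}

/-- The Laplacian in backward self-similar coordinates centred at `x₀`, at scale `√τ`. -/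
noncomputable def drift (x₀ : EuclideanSpace ℝ (Fin n)) (τ : ℝ)
    (U : EuclideanSpace ℝ (Fin n) → ℝ) (x : EuclideanSpace ℝ (Fin n)) : ℝ :=
  lap U x + -(2 * τ)⁻¹ * inner ℝ (gradient U x) (x - x₀)

theorem caloric_mul_lap_add_inner_gradient (U : EuclideanSpace ℝ (Fin n) → ℝ)
    (x : EuclideanSpace ℝ (Fin n)) :
    caloric T lam x₀ x t₀ * lap U x
        + inner ℝ (gradient U x) (gradient (fun x => caloric T lam x₀ x t₀) x)
      = drift x₀ (T - t₀ + lam) U x * caloric T lam x₀ x t₀ := by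
  rw [gradient_caloric, inner_smul_right, drift]
  ring

theorem ContDiffOn.extendsToClosure_drift (hΩ : IsOpen Ω) (hconv : Convex ℝ Ω)
    {U : EuclideanSpace ℝ (Fin n) → ℝ} (hU : ContDiffOn ℝ 2 U (closure Ω)) (τ : ℝ) :
    ExtendsToClosure Ω (drift x₀ τ U) :=
  (hU.extendsToClosure_lap hΩ hconv).add (continuous_const.extendsToClosure.mul
    (((hU.of_le one_le_two).extendsToClosure_gradient hΩ hconv).inner
      (by fun_prop : Continuous fun x => x - x₀).extendsToClosure))

theorem Dfun_eq_neg_integral_mul_drift (h : IsParabolicSolution Ω T M u) (ht₀ : t₀ ∈ Icc 0 T) :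
    Dfun Ω T lam x₀ u t₀ = -∫ x in Ω, u x t₀
      * (drift x₀ (T - t₀ + lam) (fun y => u y t₀) x * caloric T lam x₀ x t₀) := by
  rw [Dfun, setIntegral_sq_mul h.isOpen h.isCompact_closure h.convex (h.contDiffOn_space t₀ ht₀)
    (fun x hx => h.eq_zero x hx t₀ ht₀) contDiff_caloric]
  simp only [caloric_mul_lap_add_inner_gradient]

/-- The ratio by which space is dilated about `x₀` to compare the caloric weights at two times. -/
noncomputable def caloricRatio (T lam t₀ s : ℝ) : ℝ := √((T - s + lam) / (T - t₀ + lam))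

theorem caloricRatio_self (h : 0 < T - t₀ + lam) : caloricRatio T lam t₀ t₀ = 1 := by
  simp [caloricRatio, div_self h.ne']

theorem hasDerivAt_caloricRatio (h : 0 < T - t₀ + lam) :
    HasDerivAt (caloricRatio T lam t₀) (-(2 * (T - t₀ + lam))⁻¹) t₀ := by
  have h1 : HasDerivAt (fun s => (T - s + lam) / (T - t₀ + lam)) (-1 / (T - t₀ + lam)) t₀ :=
    (((hasDerivAt_id t₀).const_sub T).add_const lam).div_const _
  refine (h1.sqrt (by simp [div_self h.ne'])).congr_deriv ?_
  rw [div_self h.ne', Real.sqrt_one]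
  field_simp

theorem one_le_caloricRatio (h : 0 < T - t₀ + lam) {s : ℝ} (hs : s ≤ t₀) :
    1 ≤ caloricRatio T lam t₀ s := by
  rw [caloricRatio, Real.one_le_sqrt, one_le_div h]
  linarith

theorem eq_caloricRatio_sq_mul (h : 0 < T - t₀ + lam) {s : ℝ} (hs : s ≤ t₀) :
    T - s + lam = caloricRatio T lam t₀ s ^ 2 * (T - t₀ + lam) := by
  rw [caloricRatio, Real.sq_sqrt (div_nonneg (by linarith) h.le), div_mul_cancel₀ _ h.ne']

theorem memLp_caloric (hΩ : IsOpen Ω) (hc : IsCompact (closure Ω)) :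
    MemLp (fun x => caloric T lam x₀ x t₀) ⊤ (volume.restrict Ω) :=
  contDiff_caloric.continuous.extendsToClosure.memLp_top hΩ hc

theorem hasDerivWithinAt_Hfun (h : IsParabolicSolution Ω T M u) (hτ : 0 < T - t₀ + lam)
    (hx₀ : x₀ ∈ Ω) (hflow : EnergyFlow (volume.restrict Ω) (zeroExt Ω u) (zeroExtDeriv Ω u) α β K)
    (ht₀ : t₀ ∈ Ioo α β) (hI : Icc α β ⊆ Ioo 0 T)
    (hC : ∀ z ∈ Ioo α t₀, sqDist (volume.restrict Ω) (zeroExt Ω u z) (zeroExt Ω u t₀)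
      ≤ C * (z - t₀) ^ 2) :
    HasDerivWithinAt (Hfun Ω T lam x₀ u)
      (2 * ∫ x in Ω, (drift x₀ (T - t₀ + lam) (fun y => u y t₀) x + forcing u t₀ x)
        * (u x t₀ * caloric T lam x₀ x t₀)) (Iio t₀) t₀ := by
  have hΩ := h.isOpen
  have hm := h.isOpen.measurableSet
  have hc := h.isCompact_closure
  have := isFiniteMeasure_restrict_of_isCompact_closure hc
  have htT := Ioo_subset_Icc_self (hI (Ioo_subset_Icc_self ht₀))
  set G := fun x => caloric T lam x₀ x t₀ with hG
  have hGE : ExtendsToClosure Ω G := contDiff_caloric.continuous.extendsToClosure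
  have hGL : MemLp G ⊤ (volume.restrict Ω) := memLp_caloric hΩ hc
  obtain ⟨B, hB0, hB⟩ := hGE.exists_abs_le hc
  have huE := (h.contDiffOn_space t₀ htT).continuousOn.extendsToClosure
  have huL := huE.memLp_top (μ := volume) hΩ hc
  have hθ := hasDerivAt_caloricRatio hτ
  have hθ1 := caloricRatio_self hτ
  have h1 := tendsto_slope_integral_dilation_mul (x₀ := x₀) h hflow ht₀ hI hC (huE.mul hGE) hθ hθ1
  obtain ⟨C', hC'⟩ := eventually_integral_sq_dilation_sub_le (x₀ := x₀) h ht₀ hI hC hθ hθ1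
    (by filter_upwards [self_mem_nhdsWithin] with s hs using one_le_caloricRatio hτ (le_of_lt hs))
  set w := fun s x => zeroExt Ω u s (dilation x₀ (caloricRatio T lam t₀ s) x) with hw
  have hwL : ∀ s ∈ Icc 0 T, MemLp (w s) ⊤ (volume.restrict Ω) := fun s hs => by
    obtain ⟨B, hB⟩ := h.exists_abs_le hs
    exact memLp_top_of_bound
      ((h.measurable_zeroExt hs).comp continuous_dilation.measurable).aestronglyMeasurable B
      (.of_forall fun x => hB _)
  have hsq : ∀ s ∈ Icc 0 T, ∫ x in Ω, (w s x - u x t₀) ^ 2 * G x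
      ≤ B * ∫ x in Ω, (w s x - u x t₀) ^ 2 := fun s hs => by
    rw [← integral_const_mul]
    refine setIntegral_mono_on ((((hwL s hs).top_sub huL).top_sq.top_mul hGL).top_integrable)
      (((hwL s hs).top_sub huL).top_sq.top_integrable.const_mul B) hm fun x hx => ?_
    rw [mul_comm]
    exact mul_le_mul_of_nonneg_right ((le_abs_self _).trans (hB x hx)) (sq_nonneg _)
  have hG0 : ∀ x, 0 ≤ G x := fun x => (caloric_pos hτ x).le
  have hmem : Icc 0 T ∈ 𝓝[<] t₀ :=
    Filter.mem_of_superset (nhdsWithin_le_nhds (Icc_mem_nhds ht₀.1 ht₀.2))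
      fun s hs => Ioo_subset_Icc_self (hI hs)
  have h2 : Tendsto (fun s => (s - t₀)⁻¹ * ∫ x in Ω, (w s x - u x t₀) ^ 2 * G x) (𝓝[<] t₀)
      (𝓝 0) := by
    have hz : Tendsto (fun s => B * |C'| * |s - t₀|) (𝓝[<] t₀) (𝓝 0) := by
      have : Tendsto (fun s => B * |C'| * |s - t₀|) (𝓝 t₀) (𝓝 (B * |C'| * |t₀ - t₀|)) :=
        (by fun_prop : Continuous fun s => B * |C'| * |s - t₀|).tendsto t₀
      simpa using this.mono_left nhdsWithin_le_nhds
    refine squeeze_zero_norm' ?_ hz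
    filter_upwards [hC', hmem, self_mem_nhdsWithin] with s hs hsT hst
    have hpos : 0 < |s - t₀| := abs_pos.2 (sub_ne_zero.2 (ne_of_lt hst))
    rw [Real.norm_eq_abs, abs_mul, abs_inv, inv_mul_le_iff₀ hpos, abs_of_nonneg
      (integral_nonneg fun x => mul_nonneg (sq_nonneg _) (hG0 x))]
    calc _ ≤ B * ∫ x in Ω, (w s x - u x t₀) ^ 2 := hsq s hsT
      _ ≤ B * (|C'| * (s - t₀) ^ 2) := by
        gcongr
        exact hs.trans (mul_le_mul_of_nonneg_right (le_abs_self _) (sq_nonneg _))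
      _ = _ := by
        rw [← sq_abs]
        ring
  rw [hasDerivWithinAt_iff_tendsto_slope' (by simp)]
  have h3 := (h1.const_mul 2).add h2
  rw [add_zero] at h3
  have e : ∫ x in Ω, (deriv (fun s => u x s) t₀
      + -(2 * (T - t₀ + lam))⁻¹ * inner ℝ (gradient (fun y => u y t₀) x) (x - x₀)) * (u x t₀ * G x)
      = ∫ x in Ω, (drift x₀ (T - t₀ + lam) (fun y => u y t₀) x + forcing u t₀ x)
        * (u x t₀ * G x) := by
    simp only [drift, forcing]
    congr 1
    ext x
    ring
  rw [e] at h3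
  refine h3.congr' ?_
  filter_upwards [hmem, self_mem_nhdsWithin] with s hsT hst
  rw [slope_def_field, Hfun_eq_dilation hΩ h.convex hx₀ hτ (one_le_caloricRatio hτ (le_of_lt hst))
    (eq_caloricRatio_sq_mul hτ (le_of_lt hst)), Hfun, div_eq_inv_mul, mul_left_comm, ← mul_add]
  congr 1
  have hd := (hwL s hsT).top_sub huL
  rw [← integral_const_mul, ← integral_add ((hd.top_mul (huL.top_mul hGL)).top_integrable.const_mul 2)
    (hd.top_sq.top_mul hGL).top_integrable, ← integral_sub
    ((hwL s hsT).top_sq.top_mul hGL).top_integrable (huL.top_sq.top_mul hGL).top_integrable]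
  congr 1
  ext x
  simp only [hG, hw]
  ring

end FrequencyBound

section FrequencyBound

variable {n : ℕ} {Ω : Set (EuclideanSpace ℝ (Fin n))} {T M lam t₀ k' : ℝ}
  {x₀ : EuclideanSpace ℝ (Fin n)} {u : EuclideanSpace ℝ (Fin n) → ℝ → ℝ}

theorem integral_forcing_sq_le (h : IsParabolicSolution Ω T M u) (hτ : 0 < T - t₀ + lam)
    (ht₀ : t₀ ∈ Ioo 0 T) :
    ∫ x in Ω, forcing u t₀ x ^ 2 * caloric T lam x₀ x t₀
      ≤ 2 * M ^ 2 * (Dfun Ω T lam x₀ u t₀ + Hfun Ω T lam x₀ u t₀) := by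
  have hΩ := h.isOpen
  have hc := h.isCompact_closure
  have := isFiniteMeasure_restrict_of_isCompact_closure hc
  have hu := h.contDiffOn_space t₀ (Ioo_subset_Icc_self ht₀)
  have hG := memLp_caloric (T := T) (lam := lam) (t₀ := t₀) (x₀ := x₀) hΩ hc
  have i1 := (((((hu.of_le one_le_two).extendsToClosure_gradient hΩ
    h.convex).norm.pow 2).memLp_top (μ := volume) hΩ hc).top_mul hG).top_integrable
  have i2 := ((hu.continuousOn.extendsToClosure.memLp_top (μ := volume) hΩ
    hc).top_sq.top_mul hG).top_integrable
  rw [Dfun, Hfun, ← integral_add i1 i2, ← integral_const_mul]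
  refine setIntegral_mono_on ((h.memLp_forcing ht₀).top_sq.top_mul hG).top_integrable
    ((i1.add i2).const_mul _) hΩ.measurableSet fun x hx => ?_
  have := mul_le_mul_of_nonneg_right (h.forcing_sq_le ht₀ hx)
    (caloric_pos (x₀ := x₀) hτ x).le
  linarith

/-- The quadratic form governing the derivative of the frequency is bounded by the forcing: a
completed square, the cross terms cancelling because `k` is the frequency. -/
theorem neg_two_mul_frequency_integral_le (h : IsParabolicSolution Ω T M u)
    (hτ : 0 < T - t₀ + lam) (ht₀ : t₀ ∈ Ioo 0 T) {k : ℝ}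
    (hk : Dfun Ω T lam x₀ u t₀ = k * Hfun Ω T lam x₀ u t₀) :
    -2 * ((∫ x in Ω, (drift x₀ (T - t₀ + lam) (fun y => u y t₀) x + forcing u t₀ x)
          * (drift x₀ (T - t₀ + lam) (fun y => u y t₀) x * caloric T lam x₀ x t₀))
        + k * ∫ x in Ω, (drift x₀ (T - t₀ + lam) (fun y => u y t₀) x + forcing u t₀ x)
          * (u x t₀ * caloric T lam x₀ x t₀))
      ≤ M ^ 2 * (Dfun Ω T lam x₀ u t₀ + Hfun Ω T lam x₀ u t₀) := by
  have hΩ := h.isOpen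
  have hc := h.isCompact_closure
  have := isFiniteMeasure_restrict_of_isCompact_closure hc
  have hu := h.contDiffOn_space t₀ (Ioo_subset_Icc_self ht₀)
  have hg := integral_forcing_sq_le (x₀ := x₀) h hτ ht₀
  have hD := Dfun_eq_neg_integral_mul_drift (lam := lam) (x₀ := x₀) h (Ioo_subset_Icc_self ht₀)
  have hGL := memLp_caloric (T := T) (lam := lam) (t₀ := t₀) (x₀ := x₀) hΩ hc
  have hAL := (hu.extendsToClosure_drift (x₀ := x₀) hΩ h.convex (T - t₀ + lam)).memLp_top
    (μ := volume) hΩ hc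
  have hUL := hu.continuousOn.extendsToClosure.memLp_top (μ := volume) hΩ hc
  have hgL := h.memLp_forcing ht₀
  have hH : Hfun Ω T lam x₀ u t₀ = ∫ x in Ω, u x t₀ ^ 2 * caloric T lam x₀ x t₀ := rfl
  have hG0 : ∀ x, 0 ≤ caloric T lam x₀ x t₀ := fun x => (caloric_pos hτ x).le
  set G := fun x => caloric T lam x₀ x t₀
  set A := drift x₀ (T - t₀ + lam) fun y => u y t₀
  set g := forcing u t₀
  set U := fun x => u x t₀
  have i1 := ((hAL.top_add hgL).top_mul (hAL.top_mul hGL)).top_integrable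
  have i2 := ((hAL.top_add hgL).top_mul (hUL.top_mul hGL)).top_integrable
  have i3 := (hgL.top_sq.top_mul hGL).top_integrable
  have i4 := (hUL.top_mul (hAL.top_mul hGL)).top_integrable
  have i5 := (hUL.top_sq.top_mul hGL).top_integrable
  have hpos : 0 ≤ ∫ x in Ω, 2 * (A x + g x / 2 + k * U x) ^ 2 * G x :=
    integral_nonneg fun x => mul_nonneg (mul_nonneg two_pos.le (sq_nonneg _)) (hG0 x)
  have e : ∫ x in Ω, 2 * (A x + g x / 2 + k * U x) ^ 2 * G x
      = 2 * (∫ x in Ω, (A x + g x) * (A x * G x))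
        + 2 * k * (∫ x in Ω, (A x + g x) * (U x * G x))
        + 2⁻¹ * (∫ x in Ω, g x ^ 2 * G x) + 2 * k * (∫ x in Ω, U x * (A x * G x))
        + 2 * k ^ 2 * ∫ x in Ω, U x ^ 2 * G x := by
    simp only [← integral_const_mul]
    have j2 := (i1.const_mul 2).fun_add (i2.const_mul (2 * k))
    have j3 := j2.fun_add (i3.const_mul 2⁻¹)
    have j4 := j3.fun_add (i4.const_mul (2 * k))
    rw [← integral_add (i1.const_mul 2) (i2.const_mul (2 * k)),
      ← integral_add j2 (i3.const_mul 2⁻¹), ← integral_add j3 (i4.const_mul (2 * k)),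
      ← integral_add j4 (i5.const_mul (2 * k ^ 2))]
    congr 1
    ext x
    ring
  have e4 : ∫ x in Ω, U x * (A x * G x) = -(k * ∫ x in Ω, U x ^ 2 * G x) := by
    rw [← hH, ← hk, hD, neg_neg]
  rw [e4] at e
  rw [e] at hpos
  nlinarith [hpos, hg]

/-- The key differential inequality for the quotient of energy and mass. -/
theorem deriv_frequency_le (h : IsParabolicSolution Ω T M u) (hlam : 0 < lam) (hx₀ : x₀ ∈ Ω)
    (ht₀ : t₀ ∈ Ioo 0 T) (hH : ∀ t ∈ Ioo 0 T, 0 < Hfun Ω T lam x₀ u t)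
    (hk : HasDerivAt (fun s => Dfun Ω T lam x₀ u s / Hfun Ω T lam x₀ u s) k' t₀) :
    (T - t₀ + lam) * k' - Dfun Ω T lam x₀ u t₀ / Hfun Ω T lam x₀ u t₀
      ≤ (T - t₀ + lam) * M ^ 2 * (Dfun Ω T lam x₀ u t₀ / Hfun Ω T lam x₀ u t₀ + 1) := by
  obtain ⟨α, β, K, C, htI, hI, hflow, hC⟩ := h.exists_energyFlow_of_hasDerivAt hlam ht₀ hH hk
  have hτ : 0 < T - t₀ + lam := by linarith [ht₀.2]
  have hH0 := hH t₀ ht₀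
  have htT := Ioo_subset_Icc_self ht₀
  have hu := h.contDiffOn_space t₀ htT
  have h1 := hasDerivWithinAt_Hfun (x₀ := x₀) h hτ hx₀ hflow htI hI hC
  have h2 := tendsto_slope_integral_dilation_mul (x₀ := x₀) h hflow htI hI hC
    ((hu.extendsToClosure_drift (x₀ := x₀) h.isOpen h.convex (T - t₀ + lam)).mul
      (contDiff_caloric (T := T) (lam := lam) (x₀ := x₀) (t := t₀)).continuous.extendsToClosure)
    (hasDerivAt_caloricRatio hτ) (caloricRatio_self hτ)
  have e : ∫ x in Ω, (deriv (fun s => u x s) t₀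
      + -(2 * (T - t₀ + lam))⁻¹ * inner ℝ (gradient (fun y => u y t₀) x) (x - x₀))
        * (drift x₀ (T - t₀ + lam) (fun y => u y t₀) x * caloric T lam x₀ x t₀)
      = ∫ x in Ω, (drift x₀ (T - t₀ + lam) (fun y => u y t₀) x + forcing u t₀ x)
        * (drift x₀ (T - t₀ + lam) (fun y => u y t₀) x * caloric T lam x₀ x t₀) := by
    congr 1
    ext x
    simp only [drift, forcing]
    ring
  rw [e] at h2
  have h3 := neg_two_mul_frequency_integral_le (x₀ := x₀) h hτ ht₀
    (div_mul_cancel₀ (Dfun Ω T lam x₀ u t₀) hH0.ne').symm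
  have hτd : HasDerivAt (fun s => T - s + lam) (-1) t₀ :=
    ((hasDerivAt_id t₀).const_sub T).add_const lam
  have h4 := (hasDerivWithinAt_iff_tendsto_slope' (by simp)).1
    ((hτd.mul hk).hasDerivWithinAt.mul h1)
  have h5 := le_of_tendsto_of_tendsto h4 (h2.const_mul (-2 * (T - t₀ + lam))) (by
    filter_upwards [self_mem_nhdsWithin, Ioo_mem_nhdsLT ht₀.1] with s hst hsI
    have hst' : s < t₀ := hst
    have hsT : s ∈ Ioo 0 T := ⟨hsI.1, hst'.trans ht₀.2⟩
    have hθ := one_le_caloricRatio hτ hst'.le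
    have hs2 := eq_caloricRatio_sq_mul hτ hst'.le
    have hsT' := Ioo_subset_Icc_self hsT
    have hD := mul_Dfun_eq_dilation (x₀ := x₀) h hsT' hτ (by linarith) hs2
    have hle := sub_two_mul_le_setIntegral_gradient_dilation h.isOpen h.isCompact_closure h.convex
      hx₀ hu (fun x hx => h.eq_zero x hx t₀ htT)
      ((h.contDiffOn_space s hsT').of_le one_le_two) (fun x hx => h.eq_zero x hx s hsT')
      (contDiff_caloric (T := T) (lam := lam) (x₀ := x₀) (t := t₀))
      (fun x => (caloric_pos hτ x).le) hθ
    simp only [caloric_mul_lap_add_inner_gradient] at hle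
    have hle' := mul_le_mul_of_nonneg_left hle hτ.le
    rw [← hD] at hle'
    simp only [slope_def_field, Pi.mul_apply, zeroExt]
    rw [mul_assoc, mul_assoc, div_mul_cancel₀ _ (hH s hsT).ne', div_mul_cancel₀ _ hH0.ne',
      div_le_iff_of_neg (sub_neg.2 hst')]
    have hne : s - t₀ ≠ 0 := (sub_neg.2 hst').ne
    rw [mul_assoc, mul_right_comm, mul_right_comm (s - t₀)⁻¹, inv_mul_cancel₀ hne, one_mul]
    rw [← Dfun] at hle'
    linarith)
  simp only [Pi.mul_apply] at h5
  set k := Dfun Ω T lam x₀ u t₀ / Hfun Ω T lam x₀ u t₀ with hkdef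
  have hDk : Dfun Ω T lam x₀ u t₀ = k * Hfun Ω T lam x₀ u t₀ := (div_mul_cancel₀ _ hH0.ne').symm
  have h6 := mul_le_mul_of_nonneg_left h3 hτ.le
  rw [hDk] at h6
  refine le_of_mul_le_mul_right ?_ hH0
  linarith

end FrequencyBound

section WeightedFrequency

variable {n : ℕ} {Ω : Set (EuclideanSpace ℝ (Fin n))} {T M lam t : ℝ}
  {x₀ : EuclideanSpace ℝ (Fin n)} {u : EuclideanSpace ℝ (Fin n) → ℝ → ℝ}

theorem deriv_weighted_frequency_le (h : IsParabolicSolution Ω T M u) (hlam : 0 < lam)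
    (hx₀ : x₀ ∈ Ω) (ht : t ∈ Ioo 0 T) (hH : ∀ t ∈ Ioo 0 T, 0 < Hfun Ω T lam x₀ u t) :
    deriv (fun s => (T - s + lam) * Real.exp (-M ^ 2 * s) * Nfun Ω T lam x₀ u s) t
      ≤ 2 * M ^ 2 * (T + lam) := by
  have hτ : 0 < T - t + lam := by linarith [ht.2]
  set w : ℝ → ℝ := fun s => (T - s + lam) * Real.exp (-M ^ 2 * s) with hw
  set k : ℝ → ℝ := fun s => Dfun Ω T lam x₀ u s / Hfun Ω T lam x₀ u s with hk
  have hF : (fun s => w s * Nfun Ω T lam x₀ u s) = fun s => 2 * (w s * k s) := by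
    ext s
    simp only [hk, Nfun]
    ring
  change deriv (fun s => w s * Nfun Ω T lam x₀ u s) t ≤ _
  rw [hF]
  by_cases hd : DifferentiableAt ℝ (fun s => 2 * (w s * k s)) t
  · have hw' : HasDerivAt w ((-1) * Real.exp (-M ^ 2 * t)
        + (T - t + lam) * (Real.exp (-M ^ 2 * t) * (-M ^ 2))) t :=
      (((hasDerivAt_id t).const_sub T).add_const lam).mul
        (((hasDerivAt_id t).const_mul (-M ^ 2)).congr_deriv (mul_one _)).exp
    have hwt : w t ≠ 0 := (mul_pos hτ (Real.exp_pos _)).ne'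
    have hkd : DifferentiableAt ℝ k t := by
      refine ((hd.div_const 2).div hw'.differentiableAt hwt).congr_of_eventuallyEq ?_
      filter_upwards [hw'.continuousAt.eventually_ne hwt] with s hs
      simp only [Pi.div_apply]
      field_simp
    have hle := deriv_frequency_le h hlam hx₀ ht hH hkd.hasDerivAt
    have hder : HasDerivAt (fun s => 2 * (w s * k s)) _ t :=
      (hw'.mul hkd.hasDerivAt).const_mul 2
    rw [hder.deriv]
    have hexp : Real.exp (-M ^ 2 * t) ≤ 1 :=
      Real.exp_le_one_iff.2 (by nlinarith [mul_nonneg (sq_nonneg M) ht.1.le])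
    calc
      _ = 2 * (Real.exp (-M ^ 2 * t) * ((T - t + lam) * deriv k t - k t
            - (T - t + lam) * M ^ 2 * k t)) := by simp only [hw]; ring
      _ ≤ 2 * (Real.exp (-M ^ 2 * t) * ((T - t + lam) * M ^ 2)) := by
        gcongr
        simp only [hk] at hle ⊢
        linarith
      _ ≤ 2 * (1 * ((T + lam) * M ^ 2)) := by
        gcongr
        linarith [ht.1]
      _ = 2 * M ^ 2 * (T + lam) := by ring
  · rw [deriv_zero_of_not_differentiableAt hd]
    have : 0 ≤ T + lam := by linarith [ht.1]
    positivity

end WeightedFrequency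

end FrequencyEstimate

/-- Lemma 2.3, (2.13): there is a constant `C > 0`, depending only on the
dimension `n`, such that `d/dt [(T−t+λ) e^{−M²t} N_λ(t)] ≤ C M² (T+λ)` on `(0,T)`. -/
theorem weighted_frequency_deriv_bound
    {n : ℕ} (hn : 1 ≤ n) :
    ∃ C > (0:ℝ),
      ∀ (Ω : Set (EuclideanSpace ℝ (Fin n))),
        IsOpen Ω → Bornology.IsBounded Ω → Convex ℝ Ω →
      ∀ (T M lam : ℝ), 0 < T → 0 < M → 0 < lam →
      ∀ x₀ ∈ Ω, ∀ (u : EuclideanSpace ℝ (Fin n) → ℝ → ℝ),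
        (∀ t ∈ Set.Icc (0:ℝ) T, ContDiffOn ℝ 2 (fun x => u x t) (closure Ω)) →
        (∀ x ∈ closure Ω, ContDiffOn ℝ 1 (fun s => u x s) (Set.Icc (0:ℝ) T)) →
        (∀ x ∈ frontier Ω, ∀ t ∈ Set.Icc (0:ℝ) T, u x t = 0) →
        (∀ x ∈ Ω, ∀ t ∈ Set.Ioc (0:ℝ) T,
          |deriv (fun s => u x s) t - lap (fun y => u y t) x| ≤
            M * (‖gradient (fun y => u y t) x‖ + |u x t|)) →
        (∀ t ∈ Set.Ioo (0:ℝ) T, 0 < Hfun Ω T lam x₀ u t) →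
        ∀ t ∈ Set.Ioo (0:ℝ) T,
          deriv (fun s => (T - s + lam) * Real.exp (-M^2 * s) * Nfun Ω T lam x₀ u s) t ≤
            C * M^2 * (T + lam) := by
  refine ⟨2, two_pos, fun Ω hopen hbdd hconv T M lam _ _ hlam x₀ hx₀ u hspace htime hzero hsub hH
    t ht => ?_⟩
  exact deriv_weighted_frequency_le
    ⟨hopen, hbdd.isCompact_closure, hconv, hspace, htime, hzero, hsub⟩ hlam hx₀ ht hH
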